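/- The algebra H∞ of bounded holomorphic functions on the unit disk is a B-ring (has Bass stable rank 1): for every pair f, g of bounded holomorphic functions on 𝔻 that is unimodular, i.e., such that there exist bounded holomorphic functions u, v on 𝔻 with u(z)f(z) + v(z)g(z) = 1 for all z ∈ 𝔻, there exists a bounded holomorphic function G on 𝔻 such that f + gG is invertible in H∞, i.e., inf_{z∈𝔻}|f(z) + g(z)G(z)| > 0. -/

import Mathlib

/-- Membership in `H^∞ = H^∞(𝔻)`: a function holomorphic and bounded on the
open unit disk `𝔻 = {z : |z| < 1}`. -/
def MemHinf (f : ℂ → ℂ) : Prop :=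
  DifferentiableOn ℂ f (Metric.ball 0 1) ∧
    ∃ M : ℝ, ∀ z ∈ Metric.ball (0 : ℂ) 1, ‖f z‖ ≤ M

namespace HinfReduction

section

open Complex Metric Set
open scoped ComplexConjugate

/-- The disc automorphism vanishing at `a`. -/
noncomputable def mob (a z : ℂ) : ℂ := (z - a) / (1 - conj a * z)

abbrev AnaCl (φ : ℂ → ℂ) : Prop := AnalyticOnNhd ℂ φ (closedBall 0 1)

lemma max_principle {φ : ℂ → ℂ} (h : AnaCl φ) {C : ℝ}
    (hb : ∀ z, ‖z‖ = 1 → ‖φ z‖ ≤ C) {z : ℂ} (hz : ‖z‖ ≤ 1) : ‖φ z‖ ≤ C := by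
  have hd : DiffContOnCl ℂ φ (ball 0 1) := by
    refine ⟨h.differentiableOn.mono ball_subset_closedBall, ?_⟩
    rw [closure_ball _ one_ne_zero]
    exact h.continuousOn
  refine Complex.norm_le_of_forall_mem_frontier_norm_le isBounded_ball hd ?_ ?_
  · intro w hw
    rw [frontier_ball _ one_ne_zero] at hw
    exact hb w (by simpa using hw)
  · rw [closure_ball _ one_ne_zero]; simpa using hz

lemma one_sub_conj_mul_norm {a z : ℂ} (hz : ‖z‖ ≤ 1) : 1 - ‖a‖ ≤ ‖1 - conj a * z‖ := by
  have h1 : ‖(1:ℂ)‖ - ‖conj a * z‖ ≤ ‖1 - conj a * z‖ := norm_sub_norm_le _ _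
  rw [norm_mul, RCLike.norm_conj, norm_one] at h1
  nlinarith [norm_nonneg a, norm_nonneg z]

lemma one_sub_conj_mul_ne {a z : ℂ} (ha : ‖a‖ < 1) (hz : ‖z‖ ≤ 1) : 1 - conj a * z ≠ 0 := by
  rw [← norm_pos_iff]
  linarith [one_sub_conj_mul_norm (a := a) hz]

lemma normSq_one_sub_conj_mul (a z : ℂ) :
    ‖1 - conj a * z‖ ^ 2 - ‖z - a‖ ^ 2 = (1 - ‖a‖ ^ 2) * (1 - ‖z‖ ^ 2) := by
  simp only [← Complex.normSq_eq_norm_sq, Complex.normSq_apply]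
  simp
  ring

lemma one_sub_mob_sq {a z : ℂ} (h : 1 - conj a * z ≠ 0) :
    1 - ‖mob a z‖ ^ 2 = (1 - ‖a‖ ^ 2) * (1 - ‖z‖ ^ 2) / ‖1 - conj a * z‖ ^ 2 := by
  have h' : ‖1 - conj a * z‖ ≠ 0 := norm_ne_zero_iff.2 h
  rw [← normSq_one_sub_conj_mul, mob, norm_div, div_pow, sub_div, div_self (pow_ne_zero 2 h')]

lemma mob_norm_one {a z : ℂ} (ha : ‖a‖ < 1) (hz : ‖z‖ = 1) : ‖mob a z‖ = 1 := by
  have := one_sub_mob_sq (one_sub_conj_mul_ne ha hz.le)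
  rw [hz] at this
  have h2 : ‖mob a z‖ ^ 2 = 1 := by
    simp at this; linarith
  have := norm_nonneg (mob a z)
  nlinarith

lemma mob_norm_lt {a z : ℂ} (ha : ‖a‖ < 1) (hz : ‖z‖ < 1) : ‖mob a z‖ < 1 := by
  have h := one_sub_conj_mul_ne ha hz.le
  have h1 := one_sub_mob_sq h
  have h2 : 0 < 1 - ‖mob a z‖ ^ 2 := by
    rw [h1]
    have := norm_nonneg a
    have := norm_nonneg z
    have := norm_pos_iff.2 h
    have : 0 < 1 - ‖a‖^2 := by nlinarith
    have : 0 < 1 - ‖z‖^2 := by nlinarith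
    positivity
  nlinarith [norm_nonneg (mob a z)]

lemma mob_norm_le {a z : ℂ} (ha : ‖a‖ < 1) (hz : ‖z‖ ≤ 1) : ‖mob a z‖ ≤ 1 := by
  rcases hz.lt_or_eq with h | h
  · exact (mob_norm_lt ha h).le
  · exact (mob_norm_one ha h).le

lemma mob_symm_norm (a z : ℂ) : ‖mob a z‖ = ‖mob z a‖ := by
  unfold mob
  rw [norm_div, norm_div, norm_sub_rev]
  congr 1
  rw [← RCLike.norm_conj (1 - conj a * z)]
  congr 1
  simp [mul_comm]

lemma mob_analytic {a : ℂ} (ha : ‖a‖ < 1) : AnaCl (mob a) := by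
  intro z hz
  have hz' : ‖z‖ ≤ 1 := by simpa using hz
  have := one_sub_conj_mul_ne ha hz'
  unfold mob
  fun_prop (disch := assumption)

lemma mob_self (a : ℂ) : mob a a = 0 := by simp [mob]

/-- Division by a Blaschke factor. -/
lemma exists_div_mob {φ : ℂ → ℂ} (h : AnaCl φ) {a : ℂ} (ha : ‖a‖ < 1) (h0 : φ a = 0) :
    ∃ E : ℂ → ℂ, AnaCl E ∧ ∀ z, ‖z‖ ≤ 1 → φ z = mob a z * E z := by
  refine ⟨fun z => dslope φ a z * (1 - conj a * z), ?_, ?_⟩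
  · have hd : AnaCl (dslope φ a) := by
      intro z hz
      rcases eq_or_ne z a with rfl | hza
      · obtain ⟨p, hp⟩ := h z hz
        exact ⟨_, hp.has_fpower_series_dslope_fslope⟩
      · have : (fun w => (w - a)⁻¹ * (φ w - φ a)) =ᶠ[nhds z] dslope φ a := by
          filter_upwards [isOpen_ne.mem_nhds hza] with w hw
          rw [dslope_of_ne _ hw, slope_def_field, div_eq_inv_mul]
        refine AnalyticAt.congr ?_ this
        have h1 := h z hz
        have h2 : z - a ≠ 0 := sub_ne_zero.2 hza
        fun_prop (disch := assumption)
    intro z hz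
    have := hd z hz
    fun_prop
  · intro z hz
    have h1 := one_sub_conj_mul_ne ha hz
    have h2 := sub_smul_dslope φ a z
    rw [h0, sub_zero, smul_eq_mul] at h2
    simp only [mob]
    rw [← h2, div_mul_eq_mul_div, eq_div_iff h1, mul_assoc]

lemma div_mob_bound {φ E : ℂ → ℂ} (hE : AnaCl E) {a : ℂ} (ha : ‖a‖ < 1) {C : ℝ}
    (h : ∀ z, ‖z‖ ≤ 1 → φ z = mob a z * E z) (hb : ∀ z, ‖z‖ = 1 → ‖φ z‖ ≤ C)
    {z : ℂ} (hz : ‖z‖ ≤ 1) : ‖E z‖ ≤ C := by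
  refine max_principle hE (fun w hw => ?_) hz
  have := hb w hw
  rwa [h w hw.le, norm_mul, mob_norm_one ha hw, one_mul] at this

/-- Schwarz-Pick type estimate. -/
lemma norm_sub_le_mob {g : ℂ → ℂ} (h : AnaCl g) (hb : ∀ z, ‖z‖ ≤ 1 → ‖g z‖ ≤ 1) {a z : ℂ}
    (ha : ‖a‖ < 1) (hz : ‖z‖ ≤ 1) : ‖g z - g a‖ ≤ 2 * ‖mob a z‖ := by
  have h1 : AnaCl (fun z => g z - g a) := fun z hz => (h z hz).sub analyticAt_const
  obtain ⟨E, hE, hE'⟩ := exists_div_mob h1 ha (by simp)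
  have := div_mob_bound hE ha hE' (C := 2) (fun w hw => by
    refine (norm_sub_le _ _).trans ?_
    linarith [hb w hw.le, hb a ha.le]) hz
  rw [hE' z hz, norm_mul]
  nlinarith [norm_nonneg (mob a z)]

lemma max_principle_re {L : ℂ → ℂ} (h : AnaCl L) {C : ℝ}
    (hb : ∀ z, ‖z‖ = 1 → (L z).re ≤ C) {z : ℂ} (hz : ‖z‖ ≤ 1) : (L z).re ≤ C := by
  have h1 : AnaCl (fun z => exp (L z)) := fun z hz => (h z hz).cexp
  have := max_principle h1 (C := Real.exp C) (fun w hw => by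
    rw [Complex.norm_exp]; exact Real.exp_le_exp.2 (hb w hw)) hz
  rw [Complex.norm_exp] at this
  exact Real.exp_le_exp.1 this

end

section

open Complex Metric Set
open scoped ComplexConjugate

lemma sum_mul_exp_neg_tail_le {ι : Type*} (r t : ι → ℝ) (S : Finset ι) (ht : ∀ i, 0 ≤ t i) :
    ∑ e ∈ S, t e * Real.exp (-∑ e' ∈ S with r e ≤ r e', t e') ≤
      1 - Real.exp (-∑ e ∈ S, t e) := by
  classical
  induction S using Finset.induction_on_min_value r with
  | empty => simp
  | insert a s has hmin ih =>
    rw [Finset.sum_insert has, Finset.sum_insert has]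
    have h1 : (insert a s).filter (fun e' => r a ≤ r e') = insert a s := by
      apply Finset.filter_true_of_mem
      intro x hx
      rcases Finset.mem_insert.1 hx with rfl | hx
      · exact le_rfl
      · exact hmin x hx
    have h2 : ∑ e ∈ s, t e * Real.exp (-∑ e' ∈ insert a s with r e ≤ r e', t e') ≤
        ∑ e ∈ s, t e * Real.exp (-∑ e' ∈ s with r e ≤ r e', t e') := by
      refine Finset.sum_le_sum fun e _ => mul_le_mul_of_nonneg_left ?_ (ht e)
      refine Real.exp_le_exp.2 (neg_le_neg ?_)
      refine Finset.sum_le_sum_of_subset_of_nonneg ?_ (fun i _ _ => ht i)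
      exact Finset.filter_subset_filter _ (Finset.subset_insert _ _)
    rw [h1, Finset.sum_insert has]
    have h3 := Real.add_one_le_exp (t a)
    have h4 : Real.exp (-∑ x ∈ s, t x) =
        Real.exp (t a) * Real.exp (-(t a + ∑ x ∈ s, t x)) := by
      rw [← Real.exp_add]; congr 1; ring
    have h5 := Real.exp_pos (-(t a + ∑ x ∈ s, t x))
    nlinarith

lemma re_herglotz (a z : ℂ) (h : 1 - conj a * z ≠ 0) :
    ((1 + conj a * z) / (1 - conj a * z)).re =
      (1 - ‖a‖ ^ 2 * ‖z‖ ^ 2) / ‖1 - conj a * z‖ ^ 2 := by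
  have h' : normSq (1 - conj a * z) ≠ 0 := by simpa using h
  rw [Complex.div_re]
  simp only [← Complex.normSq_eq_norm_sq]
  rw [← add_div]
  congr 1
  simp [Complex.normSq_apply]
  ring

/-- Jones' interpolation kernel. -/
theorem jones_kernel {ι : Type*} [Fintype ι] (ζ : ι → ℂ) (s : ι → ℝ) (hζ : ∀ e, ‖ζ e‖ < 1)
    (hs : ∀ e, 0 ≤ s e) (C : ℝ)
    (hC : ∀ w, ‖w‖ < 1 → ∑ e, s e * (1 - ‖mob (ζ e) w‖ ^ 2) ≤ C) :
    ∃ κ : ι → ℂ → ℂ, (∀ e, AnaCl (κ e)) ∧ (∀ e, κ e (ζ e) = 1) ∧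
      (∀ e z, ‖z‖ ≤ 1 → ‖κ e z‖ ≤ 4 * Real.exp (2 * C)) ∧
      ∀ z, ‖z‖ ≤ 1 → ∑ e, s e * ‖κ e z‖ ≤ Real.exp (2 * C) := by
  classical
  set x : ι → ℝ := fun e => s e * (1 - ‖ζ e‖ ^ 2) with hx
  have hq : ∀ e, 0 < 1 - ‖ζ e‖ ^ 2 := fun e => by nlinarith [hζ e, norm_nonneg (ζ e)]
  have hx0 : ∀ e, 0 ≤ x e := fun e => mul_nonneg (hs e) (hq e).le
  set A : ι → ℂ → ℂ := fun e z => (1 + conj (ζ e) * z) / (1 - conj (ζ e) * z) with hA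
  have hAan : ∀ e, AnaCl (A e) := by
    intro e z hz
    have := one_sub_conj_mul_ne (hζ e) (z := z) (by simpa using hz)
    simp only [hA]
    fun_prop (disch := assumption)
  set S : ι → Finset ι := fun e => Finset.univ.filter (fun e' => ‖ζ e‖ ≤ ‖ζ e'‖) with hS
  set κ : ι → ℂ → ℂ := fun e z => (((1 - ‖ζ e‖ ^ 2 : ℝ) : ℂ) / (1 - conj (ζ e) * z)) ^ 2 *
    exp (-∑ e' ∈ S e, (x e' : ℂ) * (A e' z - A e' (ζ e))) with hκ
  have hκan : ∀ e, AnaCl (κ e) := by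
    intro e z hz
    have h1 := one_sub_conj_mul_ne (hζ e) (z := z) (by simpa using hz)
    have h2 : AnalyticAt ℂ (fun z => ∑ e' ∈ S e, (x e' : ℂ) * (A e' z - A e' (ζ e))) z := by
      refine Finset.analyticAt_fun_sum _ fun e' _ => ?_
      have := hAan e' z hz
      fun_prop
    simp only [hκ]
    fun_prop (disch := assumption)
  set P : ι → ℂ → ℝ := fun e z => (1 - ‖ζ e‖ ^ 2) / ‖1 - conj (ζ e) * z‖ ^ 2 with hP
  have hT : ∀ e z, ‖z‖ = 1 → ‖κ e z‖ ≤ (1 - ‖ζ e‖ ^ 2) * P e z * Real.exp (2 * C) *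
      Real.exp (-∑ e' ∈ S e, x e' * P e' z) := by
    intro e z hz
    simp only [hκ]
    rw [norm_mul, Complex.norm_exp, norm_pow, norm_div, Complex.norm_real,
      Real.norm_of_nonneg (hq e).le, mul_assoc, ← Real.exp_add]
    have e1 : ((1 - ‖ζ e‖ ^ 2) / ‖1 - conj (ζ e) * z‖) ^ 2 = (1 - ‖ζ e‖ ^ 2) * P e z := by
      simp only [hP]; ring
    rw [e1]
    have hPn : 0 ≤ P e z := div_nonneg (hq e).le (by positivity)
    refine mul_le_mul_of_nonneg_left (Real.exp_le_exp.2 ?_) (mul_nonneg (hq e).le hPn)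
    have e2 : (-∑ e' ∈ S e, (x e' : ℂ) * (A e' z - A e' (ζ e))).re =
        ∑ e' ∈ S e, x e' * (A e' (ζ e)).re - ∑ e' ∈ S e, x e' * P e' z := by
      rw [neg_re, re_sum, ← Finset.sum_neg_distrib, ← Finset.sum_sub_distrib]
      refine Finset.sum_congr rfl fun e' _ => ?_
      rw [Complex.re_ofReal_mul, sub_re]
      have : (A e' z).re = P e' z := by
        simp only [hA, hP]
        rw [re_herglotz _ _ (one_sub_conj_mul_ne (hζ e') hz.le), hz]
        simp
      rw [this]; ring
    rw [e2]
    have e3 : ∑ e' ∈ S e, x e' * (A e' (ζ e)).re ≤ 2 * C := by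
      calc _ ≤ ∑ e' ∈ S e, 2 * (s e' * (1 - ‖mob (ζ e') (ζ e)‖ ^ 2)) := by
            refine Finset.sum_le_sum fun e' he' => ?_
            have hle : ‖ζ e‖ ≤ ‖ζ e'‖ := by simpa [hS] using he'
            have hne := one_sub_conj_mul_ne (hζ e') (hζ e).le
            simp only [hA]
            rw [re_herglotz _ _ hne, one_sub_mob_sq hne]
            simp only [hx]
            have h3 : 0 < ‖1 - conj (ζ e') * ζ e‖ ^ 2 := by positivity
            have h4 : 1 - ‖ζ e'‖ ^ 2 * ‖ζ e‖ ^ 2 ≤ 2 * (1 - ‖ζ e‖ ^ 2) := by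
              have : ‖ζ e‖ ^ 2 ≤ ‖ζ e'‖ ^ 2 := by gcongr
              nlinarith [sq_nonneg (1 - ‖ζ e‖ ^ 2), sq_nonneg (‖ζ e‖)]
            have h5 := mul_le_mul_of_nonneg_left h4 (hx0 e')
            simp only [hx] at h5
            rw [← mul_div_assoc, ← mul_div_assoc, ← mul_div_assoc]
            gcongr ?_ / _
            linarith
        _ ≤ ∑ e', 2 * (s e' * (1 - ‖mob (ζ e') (ζ e)‖ ^ 2)) := by
            refine Finset.sum_le_sum_of_subset_of_nonneg (Finset.subset_univ _) ?_
            intro i _ _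
            have := mob_norm_lt (hζ i) (hζ e)
            have : 0 ≤ 1 - ‖mob (ζ i) (ζ e)‖ ^ 2 := by nlinarith [norm_nonneg (mob (ζ i) (ζ e))]
            have := hs i
            positivity
        _ ≤ 2 * C := by
            rw [← Finset.mul_sum]; linarith [hC _ (hζ e)]
    linarith
  have hP0 : ∀ e z, 0 ≤ P e z := fun e z => div_nonneg (hq e).le (by positivity)
  refine ⟨κ, hκan, ?_, ?_, ?_⟩
  · intro e
    simp only [hκ, sub_self, mul_zero, Finset.sum_const_zero, neg_zero, exp_zero, mul_one]
    have h1 : ((1 - ‖ζ e‖ ^ 2 : ℝ) : ℂ) = 1 - conj (ζ e) * ζ e := by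
      rw [mul_comm, Complex.mul_conj, Complex.normSq_eq_norm_sq]; push_cast; rfl
    rw [h1, div_self (one_sub_conj_mul_ne (hζ e) (hζ e).le), one_pow]
  · intro e z hz
    refine max_principle (hκan e) (fun w hw => (hT e w hw).trans ?_) hz
    have h1 : Real.exp (-∑ e' ∈ S e, x e' * P e' w) ≤ 1 := by
      rw [Real.exp_le_one_iff, neg_nonpos]
      exact Finset.sum_nonneg fun i _ => mul_nonneg (hx0 i) (hP0 i w)
    have h2 : (1 - ‖ζ e‖ ^ 2) * P e w ≤ 4 := by
      simp only [hP]
      have h3 := one_sub_conj_mul_norm (a := ζ e) hw.le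
      have h5 := norm_nonneg (ζ e)
      have h4 : 0 < 1 - ‖ζ e‖ := by linarith [hζ e]
      have h6 : 0 < ‖1 - conj (ζ e) * w‖ := by linarith
      rw [← mul_div_assoc, div_le_iff₀ (by positivity)]
      have h7 : 1 - ‖ζ e‖ ^ 2 ≤ 2 * ‖1 - conj (ζ e) * w‖ := by nlinarith [hζ e]
      nlinarith [hq e]
    have h3 := mul_nonneg (hq e).le (hP0 e w)
    have h4 := Real.exp_pos (2 * C)
    have h5 := Real.exp_pos (-∑ e' ∈ S e, x e' * P e' w)
    calc _ ≤ (1 - ‖ζ e‖ ^ 2) * P e w * Real.exp (2 * C) * 1 := by gcongr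
      _ ≤ _ := by rw [mul_one]; gcongr
  · have hsumT : ∀ z, ‖z‖ = 1 → ∑ e, s e * ‖κ e z‖ ≤ Real.exp (2 * C) := by
      intro z hz
      calc ∑ e, s e * ‖κ e z‖ ≤ ∑ e, Real.exp (2 * C) * (x e * P e z *
            Real.exp (-∑ e' ∈ S e, x e' * P e' z)) := by
            refine Finset.sum_le_sum fun e _ => ?_
            have := mul_le_mul_of_nonneg_left (hT e z hz) (hs e)
            refine this.trans (le_of_eq ?_)
            simp only [hx]; ring
        _ ≤ Real.exp (2 * C) * 1 := by
            rw [← Finset.mul_sum]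
            refine mul_le_mul_of_nonneg_left ?_ (Real.exp_pos _).le
            have := sum_mul_exp_neg_tail_le (fun e => ‖ζ e‖) (fun e => x e * P e z) Finset.univ
              (fun i => mul_nonneg (hx0 i) (hP0 i z))
            refine this.trans ?_
            linarith [Real.exp_pos (-∑ e, x e * P e z)]
        _ = _ := mul_one _
    intro z hz
    have hph : ∀ e, ∃ u : ℂ, ‖u‖ ≤ 1 ∧ u * κ e z = ‖κ e z‖ := by
      intro e
      by_cases h : κ e z = 0
      · exact ⟨0, by simp, by simp [h]⟩
      · refine ⟨‖κ e z‖ / κ e z, ?_, div_mul_cancel₀ _ h⟩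
        simp [h]
    choose u hu hu' using hph
    have hF : AnaCl (fun w => ∑ e, (s e : ℂ) * (u e * κ e w)) := by
      intro w hw
      refine Finset.analyticAt_fun_sum _ fun e _ => ?_
      have := hκan e w hw
      fun_prop
    have := max_principle hF (C := Real.exp (2 * C)) (fun w hw => by
      refine (norm_sum_le _ _).trans (le_trans (Finset.sum_le_sum fun e _ => ?_) (hsumT w hw))
      rw [norm_mul, norm_mul, Complex.norm_real, Real.norm_of_nonneg (hs e)]
      refine mul_le_mul_of_nonneg_left ?_ (hs e)
      nlinarith [hu e, norm_nonneg (κ e w)]) hz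
    have h2 : ∑ e, (s e : ℂ) * (u e * κ e z) = ((∑ e, s e * ‖κ e z‖ : ℝ) : ℂ) := by
      push_cast
      exact Finset.sum_congr rfl fun e _ => by rw [hu']
    simp only [h2, Complex.norm_real] at this
    exact (le_abs_self _).trans this

end

section

open Complex Metric Set
open scoped ComplexConjugate

lemma norm_one_sub_conj_mul_eq {a z : ℂ} (hz : ‖z‖ = 1) : 1 - conj a * z = z * conj (z - a) := by
  have : z * conj z = 1 := by
    rw [Complex.mul_conj, Complex.normSq_eq_norm_sq, hz]; simp
  rw [map_sub, mul_sub, this]; ring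

lemma mob_sub_mob_le {a b z : ℂ} (ha : ‖a‖ < 1) (hb : ‖b‖ < 1) (hz : ‖z‖ = 1) :
    ‖mob a z - mob b z‖ ≤ 2 * ‖a - b‖ / (1 - ‖b‖) := by
  have h1 : z - a ≠ 0 := by
    rintro h; rw [sub_eq_zero.1 h] at hz; linarith
  have h2 : z - b ≠ 0 := by
    rintro h; rw [sub_eq_zero.1 h] at hz; linarith
  have hz0 : z ≠ 0 := by rintro rfl; simp at hz
  have h1' : conj (z - a) ≠ 0 := (map_ne_zero _).2 h1
  have h2' : conj (z - b) ≠ 0 := (map_ne_zero _).2 h2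
  have key : mob a z - mob b z =
      ((b - a) * conj (z - b) - (z - b) * conj (b - a)) / (z * (conj (z - a) * conj (z - b))) := by
    unfold mob
    rw [norm_one_sub_conj_mul_eq hz, norm_one_sub_conj_mul_eq hz]
    rw [div_sub_div _ _ (mul_ne_zero hz0 h1') (mul_ne_zero hz0 h2'),
      div_eq_div_iff (by positivity) (by positivity)]
    simp only [map_sub]
    ring
  have key' : mob a z - mob b z = -(
      ((a - b) * conj (z - a) - (z - a) * conj (a - b)) / (z * (conj (z - a) * conj (z - b)))) := by
    rw [key, ← neg_div]; congr 1; simp only [map_sub]; ring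
  have hb1 : 1 - ‖b‖ ≤ ‖z - b‖ := by
    have := norm_sub_norm_le z b; rwa [hz] at this
  have h3 : 0 < 1 - ‖b‖ := by linarith
  have h4 : 0 < ‖z - a‖ := norm_pos_iff.2 h1
  have h5 : 0 < ‖z - b‖ := norm_pos_iff.2 h2
  rw [key', norm_neg, norm_div, norm_mul, norm_mul, hz, RCLike.norm_conj, RCLike.norm_conj, one_mul]
  have h6 : ‖(a - b) * conj (z - a) - (z - a) * conj (a - b)‖ ≤ 2 * ‖a - b‖ * ‖z - a‖ := by
    refine (norm_sub_le _ _).trans (le_of_eq ?_)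
    rw [norm_mul, norm_mul, RCLike.norm_conj, RCLike.norm_conj]; ring
  rw [div_le_div_iff₀ (by positivity) h3]
  calc _ ≤ 2 * ‖a - b‖ * ‖z - a‖ * ‖z - b‖ := by gcongr
    _ = _ := by ring

lemma abs_log_le_of {x t : ℝ} (ht : 0 ≤ t) (ht2 : t ≤ 1 / 2) (h1 : 1 - t ≤ x) (h2 : x ≤ 1 + t) :
    |Real.log x| ≤ 2 * t := by
  have hx : 0 < x := by linarith
  rw [abs_le]
  constructor
  · have := Real.one_sub_inv_le_log_of_pos hx
    have h3 : x⁻¹ ≤ 1 + 2 * t := by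
      rw [inv_le_iff_one_le_mul₀ hx]
      nlinarith
    linarith
  · have := Real.log_le_sub_one_of_pos hx
    linarith

lemma slit_of_near {w : ℂ} (h : ‖w - 1‖ ≤ 1 / 2) : w ∈ slitPlane := by
  left
  have := (abs_re_le_norm (w - 1)).trans h
  rw [sub_re, one_re, abs_le] at this
  linarith [this.1]

lemma slit_one_sub {w : ℂ} (h : ‖w‖ ≤ 1 / 2) : 1 - w ∈ slitPlane := by
  apply slit_of_near; simpa using h

lemma norm_log_one_sub_le {w : ℂ} (h : ‖w‖ ≤ 1 / 2) : ‖log (1 - w)‖ ≤ 2 * ‖w‖ := by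
  have h1 := Complex.norm_log_one_add_half_le_self (z := -w) (by simpa using h)
  rw [← sub_eq_add_neg, norm_neg] at h1
  linarith [norm_nonneg w]

structure MoveData (g : ℂ → ℂ) (ε : ℝ) (E τ : ℂ → ℂ) : Prop where
  an : AnaCl E
  near : ∀ z, ‖z‖ ≤ 1 → ‖E z - 1‖ ≤ 1 / 4
  anτ : ∀ x, ‖x‖ < 1 → ‖g x‖ < ε ^ 2 / 16 → AnalyticAt ℂ τ x
  small : ∀ x, ‖x‖ < 1 → ‖g x‖ < ε ^ 2 / 16 → ‖τ x‖ ≤ 1 / 2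

lemma mob_lower {g : ℂ → ℂ} (hg : AnaCl g) (hg1 : ∀ z, ‖z‖ ≤ 1 → ‖g z‖ ≤ 1) {ε : ℝ}
    (hε : 0 < ε) (hε1 : ε ≤ 1) {a x : ℂ} (ha : ‖a‖ < 1) (hga : ε ≤ ‖g a‖)
    (hx : ‖x‖ < 1) (hgx : ‖g x‖ < ε ^ 2 / 16) : ε / 4 ≤ ‖mob a x‖ := by
  have h1 := norm_sub_le_mob hg hg1 ha hx.le
  have h2 : ‖g a‖ - ‖g x‖ ≤ ‖g x - g a‖ := by
    rw [norm_sub_rev]; exact norm_sub_norm_le _ _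
  nlinarith

lemma step_move {g κ : ℂ → ℂ} (hg : AnaCl g) (hg1 : ∀ z, ‖z‖ ≤ 1 → ‖g z‖ ≤ 1) (hκ : AnaCl κ)
    {K1 ε σ : ℝ} (hK : ∀ z, ‖z‖ ≤ 1 → ‖κ z‖ ≤ K1) (hε : 0 < ε) (hε1 : ε ≤ 1)
    (hσ : 2 * σ + K1 * σ / ε ≤ 1 / 4)
    {a a' : ℂ} (ha : ‖a‖ < 1) (ha' : ‖a'‖ < 1) (hκ1 : κ a' = 1)
    (haa : ‖a - a'‖ ≤ σ * (1 - ‖a'‖)) (hga : ε ≤ ‖g a‖) (hga' : ε ≤ ‖g a'‖) :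
    ∃ E τ : ℂ → ℂ, MoveData g ε E τ ∧
      (∀ z, ‖z‖ = 1 → |Real.log ‖E z‖| ≤ 2 / ε * (σ * ‖κ z‖)) ∧
      ∀ x, ‖x‖ < 1 → ‖g x‖ < ε ^ 2 / 16 → ‖τ x‖ ≤ 4 / ε ^ 2 * ‖g x‖ * (σ * ‖κ x‖) ∧
        E x * mob a' x = mob a x * (1 - τ x) := by
  have hσ0 : 0 ≤ σ := by
    have := norm_nonneg (a - a')
    by_contra! h
    nlinarith
  have hK0 : 0 ≤ K1 := (norm_nonneg _).trans (hK 0 (by simp))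
  set q : ℂ := mob a a' / g a' with hq
  have hga0 : g a' ≠ 0 := by rw [← norm_pos_iff]; linarith
  have hmob : ‖mob a a'‖ ≤ σ := by
    rw [mob_symm_norm, mob, norm_div]
    have h1 := one_sub_conj_mul_norm (a := a') ha.le
    rw [div_le_iff₀ (by linarith)]
    exact haa.trans (by gcongr)
  have hqn : ‖q‖ ≤ σ / ε := by
    rw [hq, norm_div]
    gcongr
  have hKσ : 0 ≤ K1 * σ / ε := by positivity
  have hκq : ∀ z, ‖z‖ ≤ 1 → ‖κ z * q‖ ≤ K1 * σ / ε := by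
    intro z hz
    rw [norm_mul]
    calc _ ≤ K1 * (σ / ε) := by gcongr; exact hK z hz
      _ = _ := by ring
  have hκq' : ∀ z, ‖κ z * q‖ ≤ (σ * ‖κ z‖) / ε := by
    intro z
    rw [norm_mul]
    calc _ ≤ ‖κ z‖ * (σ / ε) := by gcongr
      _ = _ := by ring
  have hNum : AnaCl (fun z => mob a z - g z * (κ z * q)) := by
    intro z hz
    have := mob_analytic ha z hz
    have := hg z hz
    have := hκ z hz
    fun_prop
  obtain ⟨E, hE, hE'⟩ := exists_div_mob hNum ha' (by
    show mob a a' - g a' * (κ a' * q) = 0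
    rw [hκ1, hq]; field_simp; ring)
  have hT : ∀ z, ‖z‖ = 1 → |Real.log ‖E z‖| ≤ 2 / ε * (σ * ‖κ z‖) := by
    intro z hz
    have h1 := hE' z hz.le
    have h2 : ‖E z‖ = ‖mob a z - g z * (κ z * q)‖ := by
      rw [h1, norm_mul, mob_norm_one ha' hz, one_mul]
    have h3 : ‖g z * (κ z * q)‖ ≤ ‖κ z * q‖ := by
      rw [norm_mul]; nlinarith [hg1 z hz.le, norm_nonneg (κ z * q)]
    have h4 := hκq z hz.le
    have h5 := abs_norm_sub_norm_le (mob a z) (mob a z - g z * (κ z * q))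
    rw [sub_sub_cancel, mob_norm_one ha hz, ← h2, abs_le] at h5
    refine (abs_log_le_of (t := ‖κ z * q‖) (norm_nonneg _) (by linarith)
      (by linarith [h5.2]) (by linarith [h5.1])).trans ?_
    calc _ ≤ 2 * ((σ * ‖κ z‖) / ε) := by linarith [hκq' z]
      _ = _ := by ring
  have hmx : ∀ b x, ‖b‖ < 1 → ε ≤ ‖g b‖ → ‖x‖ < 1 → ‖g x‖ < ε ^ 2 / 16 → ε / 4 ≤ ‖mob b x‖ :=
    fun b x hb hgb hx hgx => mob_lower hg hg1 hε hε1 hb hgb hx hgx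
  have hmx0 : ∀ x, ‖x‖ < 1 → ‖g x‖ < ε ^ 2 / 16 → mob a x ≠ 0 := by
    intro x hx hgx
    rw [← norm_pos_iff]; linarith [hmx a x ha hga hx hgx]
  refine ⟨E, fun x => g x * (κ x * q) / mob a x, ⟨hE, ?_, ?_, ?_⟩, hT, ?_⟩
  · intro z hz
    refine max_principle (φ := fun z => E z - 1) (fun z hz => (hE z hz).sub analyticAt_const)
      (fun w hw => ?_) hz
    have h1 := hE' w hw.le
    have h2 : ‖E w - 1‖ = ‖(mob a w - mob a' w) - g w * (κ w * q)‖ := by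
      rw [← one_mul ‖E w - 1‖, ← mob_norm_one ha' hw, ← norm_mul]
      congr 1
      linear_combination -h1
    rw [h2]
    refine (norm_sub_le _ _).trans ?_
    have h3 : ‖g w * (κ w * q)‖ ≤ ‖κ w * q‖ := by
      rw [norm_mul]; nlinarith [hg1 w hw.le, norm_nonneg (κ w * q)]
    have h4 := hκq w hw.le
    have h5 := mob_sub_mob_le ha ha' hw
    have h6 : 2 * ‖a - a'‖ / (1 - ‖a'‖) ≤ 2 * σ := by
      rw [div_le_iff₀ (by linarith)]; linarith
    linarith
  · intro x hx hgx
    have hx' : x ∈ closedBall (0:ℂ) 1 := by simpa using hx.le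
    have h0 := hmx0 x hx hgx
    have := mob_analytic ha x hx'
    have := hg x hx'
    have := hκ x hx'
    fun_prop (disch := assumption)
  · intro x hx hgx
    have h0 := hmx a x ha hga hx hgx
    rw [norm_div, norm_mul, div_le_iff₀ (by linarith)]
    have := hκq x hx.le
    have h3 : ‖g x‖ * ‖κ x * q‖ ≤ ε ^ 2 / 16 * (1 / 4) := by
      gcongr; linarith
    nlinarith
  · intro x hx hgx
    have h0 := hmx a x ha hga hx hgx
    constructor
    · rw [norm_div, norm_mul, div_le_iff₀ (by linarith)]
      calc ‖g x‖ * ‖κ x * q‖ ≤ ‖g x‖ * ((σ * ‖κ x‖) / ε) := by gcongr; exact hκq' x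
        _ = 4 / ε ^ 2 * ‖g x‖ * (σ * ‖κ x‖) * (ε / 4) := by field_simp
        _ ≤ _ := by gcongr
    · rw [mul_sub, mul_one, mul_div_cancel₀ _ (hmx0 x hx hgx), mul_comm, ← hE' x hx.le]

lemma end_move {g : ℂ → ℂ} (hg : AnaCl g) (hg1 : ∀ z, ‖z‖ ≤ 1 → ‖g z‖ ≤ 1)
    {K ε : ℝ} (hK0 : 0 < K) (hK : ∀ z w, ‖z‖ ≤ 1 → ‖w‖ ≤ 1 → ‖g z - g w‖ ≤ K * ‖z - w‖)
    (hε : 0 < ε) (hε1 : ε ≤ 1) {a : ℂ} (ha : ‖a‖ < 1) (hga : ε ≤ ‖g a‖)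
    (hv : 8 * K * (1 - ‖a‖) ≤ ε) (hv' : 1 / 2 ≤ ‖a‖) :
    ∃ E τ : ℂ → ℂ, MoveData g ε E τ ∧
      (∀ z, ‖z‖ ≤ 1 → ‖E z - 1‖ ≤ 8 * K * (1 - ‖a‖) / ε / 4) ∧
      ∀ x, ‖x‖ < 1 → ‖g x‖ < ε ^ 2 / 16 →
        ‖τ x‖ ≤ 2 / ε ^ 2 * (8 * K * (1 - ‖a‖) / ε) * ‖g x‖ ∧
        ‖E x‖ = ‖mob a x‖ * ‖1 - τ x‖ := by
  have ha0 : a ≠ 0 := by rintro rfl; norm_num at hv'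
  have hna : (‖a‖ : ℂ) ≠ 0 := by simpa using ha0
  set ν : ℂ := -conj a / ‖a‖ with hν
  have hνn : ‖ν‖ = 1 := by
    rw [hν, norm_div, norm_neg, RCLike.norm_conj, Complex.norm_real, norm_norm, div_self]
    simpa using ha0
  have hν0 : ν ≠ 0 := by rw [← norm_pos_iff, hνn]; norm_num
  have hga0 : g a ≠ 0 := by rw [← norm_pos_iff]; linarith
  have haconj : a * conj a = (‖a‖ : ℂ) ^ 2 := by
    rw [Complex.mul_conj, Complex.normSq_eq_norm_sq]; push_cast; rfl
  have hone : ∀ z, ‖z‖ ≤ 1 → ‖1 - ν * mob a z‖ * ‖1 - conj a * z‖ ≤ 2 * (1 - ‖a‖) := by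
    intro z hz
    have hne := one_sub_conj_mul_ne ha hz
    rw [← norm_mul]
    have : (1 - ν * mob a z) * (1 - conj a * z) = (1 - ‖a‖ : ℂ) * (1 + conj a * z / ‖a‖) := by
      simp only [mob, hν]
      field_simp
      linear_combination (-1 : ℂ) * haconj
    rw [this, norm_mul]
    have h1 : ‖(1 - ‖a‖ : ℂ)‖ = 1 - ‖a‖ := by
      rw [← Complex.ofReal_one, ← Complex.ofReal_sub, Complex.norm_real,
        Real.norm_of_nonneg (by linarith)]
    have h2 : ‖1 + conj a * z / ‖a‖‖ ≤ 2 := by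
      refine (norm_add_le _ _).trans ?_
      rw [norm_div, norm_mul, RCLike.norm_conj, Complex.norm_real, norm_norm, norm_one,
        mul_div_right_comm, div_self (by simpa using ha0)]
      linarith
    rw [h1]
    nlinarith
  have hza : ∀ z, ‖z‖ ≤ 1 → ‖z - a‖ ≤ ‖1 - conj a * z‖ := by
    intro z hz
    have h1 := mob_norm_le ha hz
    have h2 := one_sub_conj_mul_ne ha hz
    rw [mob, norm_div, div_le_one (norm_pos_iff.2 h2)] at h1
    exact h1
  have hm0 : ∀ x, ‖x‖ < 1 → ‖g x‖ < ε ^ 2 / 16 → ε / 4 ≤ ‖mob a x‖ := fun x hx hgx =>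
    mob_lower hg hg1 hε hε1 ha hga hx hgx
  have hq0 : 0 ≤ 8 * K * (1 - ‖a‖) / ε := by
    have : 0 ≤ 1 - ‖a‖ := by linarith
    positivity
  have hsm : ∀ x, ‖x‖ < 1 → ‖g x‖ < ε ^ 2 / 16 →
      ‖-(g x / g a) * (1 - ν * mob a x) / (ν * mob a x)‖ ≤
      2 / ε ^ 2 * (8 * K * (1 - ‖a‖) / ε) * ‖g x‖ := by
    intro x hx hgx
    have h1 := hm0 x hx hgx
    have h2 := hone x hx.le
    have h3 := hza x hx.le
    have h4 := hK x a hx.le ha.le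
    have h5 : ‖g a‖ - ‖g x‖ ≤ ‖g x - g a‖ := by
      rw [norm_sub_rev]; exact norm_sub_norm_le _ _
    have h6 : ε / 2 ≤ K * ‖1 - conj a * x‖ := by
      have : ε ^ 2 / 16 ≤ ε / 2 := by nlinarith
      have := mul_le_mul_of_nonneg_left h3 hK0.le
      linarith
    have h7 : ‖1 - ν * mob a x‖ ≤ 1 / 2 * (8 * K * (1 - ‖a‖) / ε) := by
      have h8 : ‖1 - ν * mob a x‖ * (ε / 2) ≤ 2 * (1 - ‖a‖) * K := by
        calc _ ≤ ‖1 - ν * mob a x‖ * (K * ‖1 - conj a * x‖) := by gcongr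
          _ = ‖1 - ν * mob a x‖ * ‖1 - conj a * x‖ * K := by ring
          _ ≤ _ := by gcongr
      rw [← mul_le_mul_iff_left₀ (show 0 < ε / 2 by positivity)]
      refine h8.trans (le_of_eq ?_)
      field_simp; ring
    rw [norm_div, norm_mul, norm_mul, norm_neg, norm_div, hνn, one_mul,
      div_le_iff₀ (by linarith)]
    calc ‖g x‖ / ‖g a‖ * ‖1 - ν * mob a x‖ ≤ ‖g x‖ / ε * (1 / 2 * (8 * K * (1 - ‖a‖) / ε)) := by
          gcongr
      _ = 2 / ε ^ 2 * (8 * K * (1 - ‖a‖) / ε) * ‖g x‖ * (ε / 4) := by field_simp; ring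
      _ ≤ _ := by gcongr
  have hq1 : 8 * K * (1 - ‖a‖) / ε ≤ 1 := (div_le_one hε).2 hv
  have hnear : ∀ z, ‖z‖ ≤ 1 → ‖ν * mob a z + g z / g a * (1 - ν * mob a z) - 1‖ ≤
      8 * K * (1 - ‖a‖) / ε / 4 := by
    intro z hz
    have h1 := hone z hz
    have h2 := hza z hz
    have h3 := hK z a hz ha.le
    have e1 : ν * mob a z + g z / g a * (1 - ν * mob a z) - 1 =
        (g z - g a) / g a * (1 - ν * mob a z) := by
      field_simp; ring
    rw [e1, norm_mul, norm_div]
    calc ‖g z - g a‖ / ‖g a‖ * ‖1 - ν * mob a z‖ ≤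
          (K * ‖1 - conj a * z‖) / ε * ‖1 - ν * mob a z‖ := by
            gcongr
            exact h3.trans (by gcongr)
      _ = K * (‖1 - ν * mob a z‖ * ‖1 - conj a * z‖) / ε := by ring
      _ ≤ K * (2 * (1 - ‖a‖)) / ε := by gcongr
      _ = _ := by ring
  refine ⟨fun z => ν * mob a z + g z / g a * (1 - ν * mob a z),
    fun x => -(g x / g a) * (1 - ν * mob a x) / (ν * mob a x), ⟨?_, ?_, ?_, ?_⟩, hnear, ?_⟩
  · intro z hz
    have := mob_analytic ha z hz
    have := hg z hz
    fun_prop (disch := assumption)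
  · exact fun z hz => (hnear z hz).trans (by linarith)
  · intro x hx hgx
    have hx' : x ∈ closedBall (0:ℂ) 1 := by simpa using hx.le
    have h0 : mob a x ≠ 0 := by rw [← norm_pos_iff]; linarith [hm0 x hx hgx]
    have h1 : ν * mob a x ≠ 0 := mul_ne_zero hν0 h0
    have := mob_analytic ha x hx'
    have := hg x hx'
    fun_prop (disch := assumption)
  · intro x hx hgx
    refine (hsm x hx hgx).trans ?_
    calc 2 / ε ^ 2 * (8 * K * (1 - ‖a‖) / ε) * ‖g x‖ ≤ 2 / ε ^ 2 * 1 * (ε ^ 2 / 16) := by gcongr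
      _ ≤ 1 / 2 := by field_simp; norm_num
  · intro x hx hgx
    refine ⟨hsm x hx hgx, ?_⟩
    have h0 : mob a x ≠ 0 := by rw [← norm_pos_iff]; linarith [hm0 x hx hgx]
    rw [← one_mul ‖mob a x‖, ← hνn, ← norm_mul, ← norm_mul]
    congr 1
    field_simp
    ring

end

section

open Complex Metric Set
open scoped ComplexConjugate

lemma norm_sum_mul_log_le {ι : Type*} (S : Finset ι) (w : ι → ℝ) (hw : ∀ i, 0 ≤ w i)
    (τ : ι → ℂ) (hτ : ∀ i ∈ S, ‖τ i‖ ≤ 1 / 2) :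
    ‖∑ i ∈ S, (w i : ℂ) * log (1 - τ i)‖ ≤ 2 * ∑ i ∈ S, w i * ‖τ i‖ := by
  refine (norm_sum_le _ _).trans ?_
  rw [Finset.mul_sum]
  refine Finset.sum_le_sum fun i hi => ?_
  rw [norm_mul, Complex.norm_real, Real.norm_of_nonneg (hw i)]
  have := norm_log_one_sub_le (hτ i hi)
  nlinarith [hw i]

lemma MoveData.an_log {g : ℂ → ℂ} {ε : ℝ} {E τ : ℂ → ℂ} (h : MoveData g ε E τ) :
    AnaCl (fun z => log (E z)) := fun z hz =>
  (h.an z hz).clog (slit_of_near ((h.near z (by simpa using hz)).trans (by norm_num)))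

lemma MoveData.an_logτ {g : ℂ → ℂ} {ε : ℝ} {E τ : ℂ → ℂ} (h : MoveData g ε E τ) {x : ℂ}
    (hx : ‖x‖ < 1) (hgx : ‖g x‖ < ε ^ 2 / 16) : AnalyticAt ℂ (fun z => log (1 - τ z)) x :=
  (analyticAt_const.sub (h.anτ x hx hgx)).clog (slit_one_sub (h.small x hx hgx))

lemma MoveData.E_ne {g : ℂ → ℂ} {ε : ℝ} {E τ : ℂ → ℂ} (h : MoveData g ε E τ) {x : ℂ}
    (hx : ‖x‖ ≤ 1) : E x ≠ 0 := by
  intro h0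
  have := h.near x hx
  rw [h0] at this
  norm_num at this

lemma MoveData.τ_ne {g : ℂ → ℂ} {ε : ℝ} {E τ : ℂ → ℂ} (h : MoveData g ε E τ) {x : ℂ}
    (hx : ‖x‖ < 1) (hgx : ‖g x‖ < ε ^ 2 / 16) : 1 - τ x ≠ 0 :=
  Complex.slitPlane_ne_zero (slit_one_sub (h.small x hx hgx))

/-- Moving the weighted zeros `a p 0` to the circle along chains on which `g` is large. -/
theorem chains_lemma {g : ℂ → ℂ} (hg : AnaCl g) (hg1 : ∀ z, ‖z‖ ≤ 1 → ‖g z‖ ≤ 1)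
    {K ε σ C1 W : ℝ} (hK0 : 0 < K)
    (hK : ∀ z w, ‖z‖ ≤ 1 → ‖w‖ ≤ 1 → ‖g z - g w‖ ≤ K * ‖z - w‖)
    (hε : 0 < ε) (hε1 : ε ≤ 1) (hσ0 : 0 ≤ σ)
    (hσ : 2 * σ + 4 * Real.exp (2 * C1) * σ / ε ≤ 1 / 4)
    {ι : Type*} [Fintype ι] (n : ℕ) (a : ι → ℕ → ℂ) (w : ι → ℝ) (hw : ∀ p, 0 ≤ w p)
    (ha : ∀ p i, i ≤ n → ‖a p i‖ < 1) (hga : ∀ p i, i ≤ n → ε ≤ ‖g (a p i)‖)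
    (hstep : ∀ p i, i < n → ‖a p i - a p (i + 1)‖ ≤ σ * (1 - ‖a p (i + 1)‖))
    (hend : ∀ p, 8 * K * (1 - ‖a p n‖) ≤ ε) (hend' : ∀ p, 1 / 2 ≤ ‖a p n‖)
    (hW : ∑ p, w p * (8 * K * (1 - ‖a p n‖) / ε) ≤ W)
    (hC : ∀ x, ‖x‖ < 1 → ∑ p, ∑ i ∈ Finset.range n,
      (w p * σ) * (1 - ‖mob (a p (i + 1)) x‖ ^ 2) ≤ C1) :
    ∃ Λ : ℂ → ℂ, AnaCl Λ ∧
      (∀ z, ‖z‖ ≤ 1 → |(Λ z).re| ≤ 2 / ε * Real.exp (2 * C1) + W) ∧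
      ∃ ξ : ℂ → ℂ, (∀ x, ‖x‖ < 1 → ‖g x‖ < ε ^ 2 / 16 → AnalyticAt ℂ ξ x) ∧
        ∀ x, ‖x‖ < 1 → ‖g x‖ < ε ^ 2 / 16 →
          ‖ξ x‖ ≤ (8 / ε ^ 2 * Real.exp (2 * C1) + 4 / ε ^ 2 * W) * ‖g x‖ ∧
          (Λ x - ξ x).re = ∑ p, w p * Real.log ‖mob (a p 0) x‖ := by
  classical
  obtain ⟨κ, hκan, hκ1, hκb, hκs⟩ := jones_kernel (ι := ι × Fin n) (fun e => a e.1 (e.2 + 1))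
    (fun e => w e.1 * σ) (fun e => ha _ _ e.2.2) (fun e => mul_nonneg (hw _) hσ0) C1 (by
      intro x hx
      refine le_trans (le_of_eq ?_) (hC x hx)
      rw [Fintype.sum_prod_type]
      refine Finset.sum_congr rfl fun p _ => ?_
      rw [Finset.sum_range])
  have hstep' : ∀ e : ι × Fin n, ∃ E τ : ℂ → ℂ, MoveData g ε E τ ∧
      (∀ z, ‖z‖ = 1 → |Real.log ‖E z‖| ≤ 2 / ε * (σ * ‖κ e z‖)) ∧
      ∀ x, ‖x‖ < 1 → ‖g x‖ < ε ^ 2 / 16 → ‖τ x‖ ≤ 4 / ε ^ 2 * ‖g x‖ * (σ * ‖κ e x‖) ∧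
        E x * mob (a e.1 (e.2 + 1)) x = mob (a e.1 e.2) x * (1 - τ x) := fun e =>
    step_move hg hg1 (hκan e) (hκb e) hε hε1 hσ (ha _ _ e.2.2.le) (ha _ _ e.2.2) (hκ1 e)
      (hstep _ _ e.2.2) (hga _ _ e.2.2.le) (hga _ _ e.2.2)
  choose E τ hEτ hET hτ using hstep'
  have hend'' := fun p => end_move hg hg1 hK0 hK hε hε1 (ha p n le_rfl) (hga p n le_rfl)
    (hend p) (hend' p)
  choose E' τ' hEτ' hE' hτ' using hend''
  have hq0 : ∀ p, 0 ≤ 8 * K * (1 - ‖a p n‖) / ε := fun p => by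
    have : 0 ≤ 1 - ‖a p n‖ := by linarith [ha p n le_rfl]
    positivity
  have hq1 : ∀ p, 8 * K * (1 - ‖a p n‖) / ε ≤ 1 := fun p => (div_le_one hε).2 (hend p)
  set Λ : ℂ → ℂ := fun z => ∑ e : ι × Fin n, (w e.1 : ℂ) * log (E e z) +
    ∑ p, (w p : ℂ) * log (E' p z) with hΛ
  have hΛan : AnaCl Λ := by
    intro z hz
    refine AnalyticAt.add ?_ ?_
    · exact Finset.analyticAt_fun_sum _ fun e _ => analyticAt_const.mul ((hEτ e).an_log z hz)
    · exact Finset.analyticAt_fun_sum _ fun e _ => analyticAt_const.mul ((hEτ' e).an_log z hz)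
  have hΛre : ∀ z, (Λ z).re = ∑ e : ι × Fin n, w e.1 * Real.log ‖E e z‖ +
      ∑ p, w p * Real.log ‖E' p z‖ := by
    intro z
    simp only [hΛ, add_re, re_sum, re_ofReal_mul, log_re]
  have hT : ∀ z, ‖z‖ = 1 → |(Λ z).re| ≤ 2 / ε * Real.exp (2 * C1) + W := by
    intro z hz
    rw [hΛre]
    refine (abs_add_le _ _).trans (add_le_add ?_ ?_)
    · refine (Finset.abs_sum_le_sum_abs _ _).trans ?_
      refine le_trans ?_ (mul_le_mul_of_nonneg_left (hκs z hz.le) (by positivity))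
      rw [Finset.mul_sum]
      refine Finset.sum_le_sum fun e _ => ?_
      rw [abs_mul, abs_of_nonneg (hw _)]
      calc _ ≤ w e.1 * (2 / ε * (σ * ‖κ e z‖)) :=
            mul_le_mul_of_nonneg_left (hET e z hz) (hw _)
        _ = _ := by ring
    · refine (Finset.abs_sum_le_sum_abs _ _).trans (le_trans ?_ hW)
      refine Finset.sum_le_sum fun p _ => ?_
      rw [abs_mul, abs_of_nonneg (hw _)]
      have h1 := hE' p z hz.le
      have hq0 := hq0 p
      have hq1 := hq1 p
      set q := 8 * K * (1 - ‖a p n‖) / ε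
      have h2 := abs_norm_sub_norm_le (E' p z) 1
      rw [norm_one, abs_le] at h2
      have := abs_log_le_of (t := q / 4) (by linarith) (by linarith)
        (x := ‖E' p z‖) (by linarith) (by linarith)
      nlinarith [hw p]
  refine ⟨Λ, hΛan, fun z hz => ?_, fun x => ∑ e : ι × Fin n, (w e.1 : ℂ) * log (1 - τ e x) +
    ∑ p, (w p : ℂ) * log (1 - τ' p x), fun x hx hgx => ?_, fun x hx hgx => ⟨?_, ?_⟩⟩
  · rw [abs_le]
    constructor
    · have := max_principle_re (L := fun z => -Λ z) (fun z hz => (hΛan z hz).neg)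
        (C := 2 / ε * Real.exp (2 * C1) + W) (fun w hw => by
          rw [neg_re]; linarith [(abs_le.1 (hT w hw)).1]) hz
      rw [neg_re] at this
      linarith
    · exact max_principle_re hΛan (fun w hw => (abs_le.1 (hT w hw)).2) hz
  · refine AnalyticAt.add ?_ ?_
    · exact Finset.analyticAt_fun_sum _ fun e _ =>
        analyticAt_const.mul ((hEτ e).an_logτ hx hgx)
    · exact Finset.analyticAt_fun_sum _ fun e _ =>
        analyticAt_const.mul ((hEτ' e).an_logτ hx hgx)
  · rw [add_mul]
    refine (norm_add_le _ _).trans (add_le_add ?_ ?_)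
    · refine (norm_sum_mul_log_le _ (fun e : ι × Fin n => w e.1) (fun _ => hw _) _
        (fun e _ => (hEτ e).small x hx hgx)).trans ?_
      calc _ ≤ 2 * ∑ e : ι × Fin n, 4 / ε ^ 2 * ‖g x‖ * (w e.1 * σ * ‖κ e x‖) := by
            refine mul_le_mul_of_nonneg_left (Finset.sum_le_sum fun e _ => ?_) (by norm_num)
            calc _ ≤ w e.1 * (4 / ε ^ 2 * ‖g x‖ * (σ * ‖κ e x‖)) :=
                  mul_le_mul_of_nonneg_left (hτ e x hx hgx).1 (hw _)
              _ = _ := by ring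
        _ = 8 / ε ^ 2 * ‖g x‖ * ∑ e : ι × Fin n, (w e.1 * σ * ‖κ e x‖) := by
            rw [← Finset.mul_sum]; ring
        _ ≤ 8 / ε ^ 2 * ‖g x‖ * Real.exp (2 * C1) := by
            gcongr; exact hκs x hx.le
        _ = _ := by ring
    · refine (norm_sum_mul_log_le _ w hw _ (fun p _ => (hEτ' p).small x hx hgx)).trans ?_
      calc _ ≤ 2 * ∑ p, w p * (2 / ε ^ 2 * (8 * K * (1 - ‖a p n‖) / ε) * ‖g x‖) := by
            gcongr with p _
            · exact hw p
            · exact (hτ' p x hx hgx).1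
        _ = 4 / ε ^ 2 * (∑ p, w p * (8 * K * (1 - ‖a p n‖) / ε)) * ‖g x‖ := by
            simp only [Finset.mul_sum, Finset.sum_mul]
            exact Finset.sum_congr rfl fun p _ => by ring
        _ ≤ _ := by gcongr
  · rw [sub_re, hΛre]
    simp only [add_re, re_sum, re_ofReal_mul, log_re]
    have hm0 : ∀ p i, i ≤ n → ‖mob (a p i) x‖ ≠ 0 := by
      intro p i hi
      have := mob_lower hg hg1 hε hε1 (ha p i hi) (hga p i hi) hx hgx
      linarith
    have h1 : ∀ e : ι × Fin n, Real.log ‖E e x‖ = Real.log ‖1 - τ e x‖ +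
        (Real.log ‖mob (a e.1 e.2) x‖ - Real.log ‖mob (a e.1 (e.2 + 1)) x‖) := by
      intro e
      have h2 := congrArg (fun z => Real.log ‖z‖) (hτ e x hx hgx).2
      simp only [norm_mul] at h2
      rw [Real.log_mul (norm_ne_zero_iff.2 ((hEτ e).E_ne hx.le)) (hm0 _ _ e.2.2),
        Real.log_mul (hm0 _ _ e.2.2.le) (norm_ne_zero_iff.2 ((hEτ e).τ_ne hx hgx))] at h2
      linarith
    have h2 : ∀ p, Real.log ‖E' p x‖ = Real.log ‖1 - τ' p x‖ + Real.log ‖mob (a p n) x‖ := by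
      intro p
      rw [(hτ' p x hx hgx).2, Real.log_mul (hm0 _ _ le_rfl)
        (norm_ne_zero_iff.2 ((hEτ' p).τ_ne hx hgx)), add_comm]
    have h3 : ∑ e : ι × Fin n, w e.1 * Real.log ‖E e x‖ =
        ∑ e : ι × Fin n, w e.1 * Real.log ‖1 - τ e x‖ +
        ∑ p, w p * (Real.log ‖mob (a p 0) x‖ - Real.log ‖mob (a p n) x‖) := by
      simp_rw [h1, mul_add, Finset.sum_add_distrib]
      congr 1
      rw [Fintype.sum_prod_type]
      refine Finset.sum_congr rfl fun p _ => ?_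
      simp only []
      rw [← Finset.mul_sum]
      congr 1
      rw [← Finset.sum_range_sub' (fun i => Real.log ‖mob (a p i) x‖), Finset.sum_range]
    rw [h3]
    simp_rw [h2, mul_add, mul_sub, Finset.sum_add_distrib, Finset.sum_sub_distrib]
    ring

end

section

open Complex Metric Set
open scoped ComplexConjugate

/-- The `j`-th of the `M`-th roots of unity. -/
noncomputable def rtu (M : ℕ) (j : ℕ) : ℂ := exp (2 * Real.pi * I / M) ^ j

lemma rtu_norm (M j : ℕ) : ‖rtu M j‖ = 1 := by
  have : (2 * Real.pi * I / M : ℂ) = ((2 * Real.pi / M : ℝ) : ℂ) * I := by push_cast; ring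
  rw [rtu, norm_pow, this, Complex.norm_exp_ofReal_mul_I, one_pow]

lemma rtu_pow {M : ℕ} (hM : M ≠ 0) (j : ℕ) : rtu M j ^ M = 1 := by
  rw [rtu, ← pow_mul, mul_comm j, pow_mul, (Complex.isPrimitiveRoot_exp M hM).pow_eq_one, one_pow]

lemma rtu_conj_mul (M j : ℕ) : conj (rtu M j) * rtu M j = 1 := by
  rw [mul_comm, Complex.mul_conj, Complex.normSq_eq_norm_sq, rtu_norm]; simp

lemma rtu_orth {M n m : ℕ} (hn : n < M) (hm : m < M) :
    ∑ j ∈ Finset.range M, rtu M j ^ n * conj (rtu M j) ^ m = if n = m then (M : ℂ) else 0 := by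
  have hM : M ≠ 0 := by omega
  split_ifs with h
  · subst h
    simp_rw [← mul_pow, mul_comm (rtu M _), rtu_conj_mul]
    simp
  · have hω := Complex.isPrimitiveRoot_exp M hM
    set ω := exp (2 * Real.pi * I / M) with hω'
    have h1 : conj ω * ω = 1 := by have := rtu_conj_mul M 1; simpa [rtu] using this
    have hr : ω ^ n * conj ω ^ m ≠ 1 := by
      intro h2
      apply h
      refine hω.pow_inj hn hm ?_
      calc ω ^ n = ω ^ n * (conj ω * ω) ^ m := by rw [h1]; simp
        _ = (ω ^ n * conj ω ^ m) * ω ^ m := by ring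
        _ = _ := by rw [h2, one_mul]
    have h3 : ∀ j, rtu M j ^ n * conj (rtu M j) ^ m = (ω ^ n * conj ω ^ m) ^ j := by
      intro j; simp only [rtu, map_pow]; ring
    simp_rw [h3]
    rw [geom_sum_eq hr]
    have h4 : ω ^ M = 1 := hω.pow_eq_one
    have h5 : (ω ^ n * conj ω ^ m) ^ M = 1 := by
      calc _ = (ω ^ M) ^ n * conj (ω ^ M) ^ m := by rw [map_pow]; ring
        _ = 1 := by rw [h4]; simp
    rw [h5]; simp

lemma rtu_parseval {M : ℕ} (w : ℂ) :
    ∑ j ∈ Finset.range M, ‖∑ n ∈ Finset.range M, (w * conj (rtu M j)) ^ n‖ ^ 2 =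
      M * ∑ n ∈ Finset.range M, (‖w‖ ^ 2) ^ n := by
  have : ((∑ j ∈ Finset.range M, ‖∑ n ∈ Finset.range M, (w * conj (rtu M j)) ^ n‖ ^ 2 : ℝ) : ℂ) =
      ((M * ∑ n ∈ Finset.range M, (‖w‖ ^ 2) ^ n : ℝ) : ℂ) := by
    push_cast
    have h1 : ∀ j, ((‖∑ n ∈ Finset.range M, (w * conj (rtu M j)) ^ n‖ : ℂ)) ^ 2 =
        ∑ m ∈ Finset.range M, ∑ n ∈ Finset.range M,
          (conj w ^ m * w ^ n) * (rtu M j ^ m * conj (rtu M j) ^ n) := by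
      intro j
      rw [← Complex.conj_mul', map_sum, Finset.sum_mul_sum]
      refine Finset.sum_congr rfl fun m _ => Finset.sum_congr rfl fun n _ => ?_
      simp only [map_pow, map_mul, conj_conj]; ring
    simp_rw [h1]
    rw [Finset.sum_comm, Finset.mul_sum]
    refine Finset.sum_congr rfl fun m hm => ?_
    rw [Finset.sum_comm]
    simp_rw [← Finset.mul_sum]
    rw [Finset.sum_congr rfl (fun n hn => by
      rw [rtu_orth (Finset.mem_range.1 hm) (Finset.mem_range.1 hn)])]
    simp only [mul_ite, mul_zero, Finset.sum_ite_eq, hm, if_true]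
    rw [← mul_pow, Complex.conj_mul']; ring
  exact_mod_cast this

lemma pow_le_half {M : ℕ} {r : ℝ} (hr : 0 ≤ r) (h : 1 / (M : ℝ) ≤ 1 - r) (hM : M ≠ 0) :
    r ^ M ≤ 1 / 2 := by
  have hM' : (0:ℝ) < M := by positivity
  have h1 : r ≤ Real.exp (-(1 / M)) := by
    have := Real.add_one_le_exp (-(1 / (M:ℝ)))
    linarith
  calc r ^ M ≤ Real.exp (-(1 / M)) ^ M := by gcongr
    _ = Real.exp (-1) := by rw [← Real.exp_nat_mul]; congr 1; field_simp
    _ ≤ 1 / 2 := by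
      rw [Real.exp_neg, one_div]
      apply inv_anti₀ (by norm_num)
      have := Real.add_one_le_exp (1:ℝ)
      linarith

lemma rtu_sub_ne {M j : ℕ} {w : ℂ} (hw : ‖w‖ < 1) : 0 < ‖rtu M j - w‖ := by
  have := norm_sub_norm_le (rtu M j) w
  rw [rtu_norm] at this; linarith

lemma rtu_sum_inv_sq {M : ℕ} {w : ℂ} (hM : M ≠ 0) (h : 1 / (M : ℝ) ≤ 1 - ‖w‖) :
    ∑ j ∈ Finset.range M, 1 / ‖rtu M j - w‖ ^ 2 ≤ 4 * M / (1 - ‖w‖) := by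
  have hM' : (0:ℝ) < M := by positivity
  have h1M : 0 < 1 / (M:ℝ) := by positivity
  have hw : ‖w‖ < 1 := by linarith
  have hwM := pow_le_half (norm_nonneg w) h hM
  have h1 : ∀ j, 1 / ‖rtu M j - w‖ ^ 2 ≤
      4 * ‖∑ n ∈ Finset.range M, (w * conj (rtu M j)) ^ n‖ ^ 2 := by
    intro j
    have e1 : (∑ n ∈ Finset.range M, (w * conj (rtu M j)) ^ n) * (rtu M j - w) =
        rtu M j * (1 - w ^ M) := by
      have h2 := geom_sum_mul_neg (w * conj (rtu M j)) M
      have h3 : (rtu M j - w) = rtu M j * (1 - w * conj (rtu M j)) := by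
        linear_combination w * rtu_conj_mul M j
      rw [h3, mul_left_comm, h2, mul_pow, ← map_pow, rtu_pow hM, map_one, mul_one]
    have e2 := congrArg norm e1
    rw [norm_mul, norm_mul, rtu_norm, one_mul] at e2
    have e3 : 1 / 2 ≤ ‖1 - w ^ M‖ := by
      have := norm_sub_norm_le 1 (w ^ M)
      rw [norm_one, norm_pow] at this; linarith
    have e4 := rtu_sub_ne (M := M) (j := j) hw
    rw [div_le_iff₀ (by positivity), mul_assoc, ← mul_pow, e2]
    nlinarith
  calc _ ≤ ∑ j ∈ Finset.range M, 4 * ‖∑ n ∈ Finset.range M, (w * conj (rtu M j)) ^ n‖ ^ 2 :=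
        Finset.sum_le_sum fun j _ => h1 j
    _ = 4 * M * ∑ n ∈ Finset.range M, (‖w‖ ^ 2) ^ n := by
        rw [← Finset.mul_sum, rtu_parseval]; ring
    _ ≤ 4 * M * (1 - ‖w‖)⁻¹ := by
        gcongr
        have hsq : ‖w‖ ^ 2 < 1 := by nlinarith [norm_nonneg w]
        calc _ ≤ (1 - ‖w‖ ^ 2)⁻¹ := by
              have := geom_sum_mul_neg (‖w‖ ^ 2) M
              rw [← one_div, le_div_iff₀ (by linarith), this]
              have : 0 ≤ (‖w‖ ^ 2) ^ M := by positivity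
              linarith
          _ ≤ _ := by
              apply inv_anti₀ (by linarith)
              nlinarith [norm_nonneg w]
    _ = _ := by rw [div_eq_mul_inv]

lemma rtu_count_le {M : ℕ} {w : ℂ} (hM : M ≠ 0) (h : 1 / (M : ℝ) ≤ 1 - ‖w‖) {τ : ℝ}
    (S : Finset ℕ) (hS : S ⊆ Finset.range M) (hτ : ∀ j ∈ S, ‖rtu M j - w‖ ≤ τ) :
    (S.card : ℝ) ≤ τ ^ 2 * (4 * M / (1 - ‖w‖)) := by
  have hM' : (0:ℝ) < M := by positivity
  have h1M : 0 < 1 / (M:ℝ) := by positivity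
  have hw : ‖w‖ < 1 := by linarith
  calc (S.card : ℝ) = ∑ j ∈ S, 1 := by simp
    _ ≤ ∑ j ∈ S, τ ^ 2 * (1 / ‖rtu M j - w‖ ^ 2) := by
        refine Finset.sum_le_sum fun j hj => ?_
        have := rtu_sub_ne (M := M) (j := j) hw
        rw [mul_one_div, le_div_iff₀ (by positivity), one_mul]
        have := hτ j hj
        gcongr
    _ = τ ^ 2 * ∑ j ∈ S, (1 / ‖rtu M j - w‖ ^ 2) := by rw [Finset.mul_sum]
    _ ≤ τ ^ 2 * ∑ j ∈ Finset.range M, (1 / ‖rtu M j - w‖ ^ 2) := by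
        gcongr
    _ ≤ _ := by gcongr; exact rtu_sum_inv_sq hM h

lemma rtu_prod_eq {M : ℕ} (hM : M ≠ 0) : (Polynomial.X ^ M - 1 : Polynomial ℂ) =
    ∏ j ∈ Finset.range M, (Polynomial.X - Polynomial.C (rtu M j)) := by
  have hω := Complex.isPrimitiveRoot_exp M hM
  have : NeZero M := ⟨hM⟩
  rw [Polynomial.X_pow_sub_one_eq_prod (Nat.pos_of_ne_zero hM) hω]
  refine (Finset.prod_bij (fun j _ => rtu M j) ?_ ?_ ?_ ?_).symm
  · intro j _
    rw [Polynomial.mem_nthRootsFinset (Nat.pos_of_ne_zero hM)]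
    exact rtu_pow hM j
  · intro i hi j hj h
    exact hω.pow_inj (Finset.mem_range.1 hi) (Finset.mem_range.1 hj) h
  · intro b hb
    rw [Polynomial.mem_nthRootsFinset (Nat.pos_of_ne_zero hM)] at hb
    obtain ⟨i, hi, rfl⟩ := hω.eq_pow_of_pow_eq_one hb
    exact ⟨i, Finset.mem_range.2 hi, rfl⟩
  · intros; rfl

lemma rtu_prod {M : ℕ} (hM : M ≠ 0) (w : ℂ) :
    ∏ j ∈ Finset.range M, ‖rtu M j - w‖ = ‖1 - w ^ M‖ := by
  have h3 := congrArg (fun p => ‖p.eval w‖) (rtu_prod_eq hM)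
  simp only [Polynomial.eval_sub, Polynomial.eval_pow, Polynomial.eval_X, Polynomial.eval_one,
    Polynomial.eval_prod, Polynomial.eval_C, norm_prod] at h3
  rw [norm_sub_rev 1, h3]
  exact Finset.prod_congr rfl fun j _ => norm_sub_rev _ _

lemma norm_exp_sub_exp_le (s t : ℝ) : ‖exp (s * I) - exp (t * I)‖ ≤ |s - t| := by
  have h1 : exp (s * I) - exp (t * I) = exp (t * I) * (exp (I * ((s - t : ℝ) : ℂ)) - 1) := by
    rw [mul_sub, ← Complex.exp_add, mul_one]; congr 2; push_cast; ring
  rw [h1, norm_mul, Complex.norm_exp_ofReal_mul_I, one_mul]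
  exact Real.norm_exp_I_mul_ofReal_sub_one_le

lemma rtu_eq (M j : ℕ) : rtu M j = exp ((2 * Real.pi * j / M : ℝ) * I) := by
  rw [rtu, ← Complex.exp_nat_mul]; congr 1; push_cast; ring

/-- Lower bound for the number of grid points near a given unimodular number. -/
lemma rtu_count_ge {M : ℕ} {e : ℂ} (he : ‖e‖ = 1) {τ : ℝ} (hτ1 : τ ≤ 1)
    (hτ : 100 ≤ M * τ) (S : Finset ℕ) (hS : ∀ j, j < M → ‖rtu M j - e‖ ≤ τ → j ∈ S) :
    M * τ / 100 ≤ S.card := by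
  have hM0 : M ≠ 0 := by rintro rfl; norm_num at hτ
  have hM' : (0:ℝ) < M := by positivity
  have hpi := Real.pi_gt_three
  have hpi4 := Real.pi_lt_d2
  have hτ0 : 0 < τ := by by_contra! h; nlinarith
  obtain ⟨α, hα0, hα1, rfl⟩ : ∃ α : ℝ, 0 ≤ α ∧ α ≤ 2 * Real.pi ∧ e = exp (α * I) := by
    have h1 : e = exp (arg e * I) := by
      have := Complex.norm_mul_exp_arg_mul_I e
      rw [he] at this; simpa using this.symm
    rcases le_or_gt 0 (arg e) with h | h
    · exact ⟨arg e, h, by linarith [Complex.arg_le_pi e], h1⟩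
    · refine ⟨arg e + 2 * Real.pi, by linarith [Complex.neg_pi_lt_arg e], by linarith, ?_⟩
      push_cast
      rw [add_mul, Complex.exp_periodic]
      exact h1
  set L : ℕ := ⌊M * τ / (4 * Real.pi)⌋₊ with hL
  have hL1 : (L : ℝ) ≤ M * τ / (4 * Real.pi) := Nat.floor_le (by positivity)
  have hL2 : M * τ / (4 * Real.pi) < L + 1 := Nat.lt_floor_add_one _
  have hLlow : M * τ / 100 ≤ L := by
    have : M * τ / 16 ≤ M * τ / (4 * Real.pi) := by
      gcongr; linarith
    linarith
  have hLM : 4 * Real.pi * L ≤ M * τ := by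
    rw [le_div_iff₀ (by positivity)] at hL1; linarith
  refine hLlow.trans ?_
  have main : ∃ b : ℕ, ∀ i < L, b + i < M ∧ ‖rtu M (b + i) - exp (α * I)‖ ≤ τ := by
    rcases le_or_gt α Real.pi with h | h
    · refine ⟨⌈M * α / (2 * Real.pi)⌉₊, fun i hi => ?_⟩
      set b := ⌈M * α / (2 * Real.pi)⌉₊ with hb
      have hb1 : M * α / (2 * Real.pi) ≤ b := Nat.le_ceil _
      have hb2 : (b : ℝ) < M * α / (2 * Real.pi) + 1 := Nat.ceil_lt_add_one (by positivity)
      have hi' : (i : ℝ) + 1 ≤ L := by exact_mod_cast hi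
      rw [div_le_iff₀ (by positivity)] at hb1
      rw [← sub_lt_iff_lt_add, lt_div_iff₀ (by positivity)] at hb2
      have key : (b + i : ℝ) * (2 * Real.pi) - M * α ≤ M * τ / 2 := by nlinarith
      have key0 : 0 ≤ (b + i : ℝ) * (2 * Real.pi) - M * α := by
        have : 0 ≤ (i:ℝ) * (2 * Real.pi) := by positivity
        nlinarith
      constructor
      · have h9 : M * τ / 2 + M * α ≤ M * (1 / 2 + Real.pi) := by nlinarith
        have : (b + i : ℝ) < M := by
          by_contra! h8
          have : M * (2 * Real.pi) ≤ (b + i : ℝ) * (2 * Real.pi) := by gcongr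
          nlinarith
        exact_mod_cast this
      · rw [rtu_eq]
        refine (norm_exp_sub_exp_le _ _).trans ?_
        have e1 : 2 * Real.pi * ((b + i : ℕ) : ℝ) / M - α =
            ((b + i : ℝ) * (2 * Real.pi) - M * α) / M := by
          push_cast; field_simp
        rw [e1, abs_of_nonneg (by positivity), div_le_iff₀ hM']
        nlinarith
    · have hfl : L ≤ ⌊M * α / (2 * Real.pi)⌋₊ := by
        apply Nat.le_floor
        rw [le_div_iff₀ (by positivity)]
        nlinarith
      refine ⟨⌊M * α / (2 * Real.pi)⌋₊ - L, fun i hi => ?_⟩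
      set B := ⌊M * α / (2 * Real.pi)⌋₊ with hB
      have hb1 : (B : ℝ) ≤ M * α / (2 * Real.pi) := Nat.floor_le (by positivity)
      have hb2 : M * α / (2 * Real.pi) < B + 1 := Nat.lt_floor_add_one _
      have hi' : (i : ℝ) + 1 ≤ L := by exact_mod_cast hi
      have hc : ((B - L + i : ℕ) : ℝ) = B - L + i := by push_cast [Nat.cast_sub hfl]; ring
      rw [le_div_iff₀ (by positivity)] at hb1
      rw [div_lt_iff₀ (by positivity)] at hb2
      have key : M * α - (B - L + i : ℝ) * (2 * Real.pi) ≤ M * τ := by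
        have : 0 ≤ (i:ℝ) * (2 * Real.pi) := by positivity
        nlinarith
      have key0 : 0 ≤ M * α - (B - L + i : ℝ) * (2 * Real.pi) := by nlinarith
      constructor
      · have : B ≤ M := by
          have : (B : ℝ) ≤ M := by
            by_contra! h8
            have : (M:ℝ) * (2 * Real.pi) < (B : ℝ) * (2 * Real.pi) := by gcongr
            nlinarith
          exact_mod_cast this
        omega
      · rw [rtu_eq]
        refine (norm_exp_sub_exp_le _ _).trans ?_
        have e1 : 2 * Real.pi * ((B - L + i : ℕ) : ℝ) / M - α =
            -((M * α - (B - L + i : ℝ) * (2 * Real.pi)) / M) := by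
          rw [hc]; field_simp; ring
        rw [e1, abs_neg, abs_of_nonneg (by positivity), div_le_iff₀ hM']
        nlinarith
  obtain ⟨b, hb⟩ := main
  have : L ≤ S.card := by
    have h1 : (Finset.range L).image (fun i => b + i) ⊆ S := by
      intro j hj
      obtain ⟨i, hi, rfl⟩ := Finset.mem_image.1 hj
      exact hS _ (hb i (Finset.mem_range.1 hi)).1 (hb i (Finset.mem_range.1 hi)).2
    have h2 := Finset.card_le_card h1
    rwa [Finset.card_image_of_injective _ (add_right_injective b), Finset.card_range] at h2
  exact_mod_cast this

end

section

open Complex Metric Set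
open scoped ComplexConjugate

lemma inv_mob_sq_le {ζ x : ℂ} (hζ : ‖ζ‖ < 1) (hx : ‖x‖ < 1) (h : x ≠ ζ) :
    (‖mob ζ x‖⁻¹) ^ 2 ≤ 1 + 4 * (1 - ‖ζ‖) * (1 - ‖x‖) / ‖x - ζ‖ ^ 2 := by
  have h1 := normSq_one_sub_conj_mul ζ x
  have ha : 0 < ‖x - ζ‖ := norm_pos_iff.2 (sub_ne_zero.2 h)
  rw [mob, norm_div, inv_div, div_pow, div_le_iff₀ (by positivity), add_mul,
    div_mul_cancel₀ _ (by positivity), one_mul]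
  have h2 := norm_nonneg ζ
  have h3 := norm_nonneg x
  have h4 : (1 - ‖ζ‖ ^ 2) * (1 - ‖x‖ ^ 2) =
      ((1 - ‖ζ‖) * (1 - ‖x‖)) * ((1 + ‖ζ‖) * (1 + ‖x‖)) := by ring
  have h5 : 0 ≤ (1 - ‖ζ‖) * (1 - ‖x‖) := mul_nonneg (by linarith) (by linarith)
  have h6 : (1 + ‖ζ‖) * (1 + ‖x‖) ≤ 4 := by nlinarith
  nlinarith

lemma norm_sub_sq_ratio {e u : ℂ} (he : ‖e‖ = 1) (hu : ‖u‖ = 1) {r s : ℝ} (hr : 0 < r)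
    (hrs : r ≤ s) (hs : s ≤ 1) :
    r * ‖e - s * u‖ ^ 2 ≤ s * ‖e - r * u‖ ^ 2 := by
  have key : ∀ t : ℝ, ‖e - t * u‖ ^ 2 = 1 + t ^ 2 - 2 * t * (e * conj u).re := by
    intro t
    have h1 : normSq e = 1 := by rw [Complex.normSq_eq_norm_sq, he]; norm_num
    have h2 : normSq u = 1 := by rw [Complex.normSq_eq_norm_sq, hu]; norm_num
    rw [← Complex.normSq_eq_norm_sq]
    rw [Complex.normSq_apply] at *
    simp at *
    linear_combination h1 + t ^ 2 * h2
  rw [key, key]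
  have : 0 ≤ (s - r) * (1 - r * s) := mul_nonneg (by linarith) (by nlinarith)
  nlinarith

lemma log_ratio_nonneg {M : ℕ} (hM : M ≠ 0) {d : ℝ} (hd : 0 < d)
    {e x u : ℂ} (he : ‖e‖ = 1) (hx : ‖x‖ < 1) (hxd : d / 2 ≤ ‖x‖)
    (hu : ‖u‖ = 1) (hxu : x = ‖x‖ * u) (hy : 1 / (M : ℝ) ≤ 1 - ‖x‖)
    (hW0 : 0 < ‖e - ((1 - 1 / M : ℝ) : ℂ) * u‖) :
    0 ≤ Real.log ‖e - x‖ - Real.log ‖e - ((1 - 1 / M : ℝ) : ℂ) * u‖ + (1 - ‖x‖) / d := by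
  have hx0 : 0 < ‖x‖ := by linarith
  have hM1 : 0 < 1 / (M:ℝ) := by positivity
  have h1 := norm_sub_sq_ratio he hu (r := ‖x‖) (s := 1 - 1 / M) hx0
    (by linarith) (by linarith)
  rw [← hxu] at h1
  generalize ((1 - 1 / M : ℝ) : ℂ) * u = w at *
  generalize hyd : 1 - ‖x‖ = y at *
  have hy0 : 0 < y := by linarith
  have h2 : ‖x‖ * ‖e - w‖ ^ 2 ≤ ‖e - x‖ ^ 2 := by
    refine h1.trans ?_
    have := sq_nonneg ‖e - x‖
    nlinarith
  have h3 := Real.log_le_log (by positivity) h2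
  rw [Real.log_mul (by positivity) (by positivity), Real.log_pow, Real.log_pow] at h3
  have h4 := Real.one_sub_inv_le_log_of_pos hx0
  have h5 : ‖x‖⁻¹ ≤ 1 + 2 * (y / d) := by
    rw [inv_le_iff_one_le_mul₀ hx0]
    have h6 : 1 + 2 * (y / d) = (d + 2 * y) / d := by field_simp
    rw [h6, div_mul_eq_mul_div, le_div_iff₀ hd]
    nlinarith
  push_cast at h3
  linarith

set_option maxHeartbeats 1000000 in
lemma green_term_le {M : ℕ} (hM : M ≠ 0) {d s v : ℝ} (hd : 0 < d) (hs : 0 < s) (hs1 : s ≤ 1)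
    (hv : 0 < v) (hvd : v ≤ 1 - d) {e x u : ℂ} (he : ‖e‖ = 1) (hx : ‖x‖ < 1) (hxd : d / 2 ≤ ‖x‖)
    (hu : ‖u‖ = 1) (hxu : x = ‖x‖ * u) (hy : 1 / (M : ℝ) ≤ 1 - ‖x‖)
    (hmob : s ≤ ‖mob (((1 - v : ℝ) : ℂ) * e) x‖) :
    1 / (M * v) * Real.log ‖mob (((1 - v : ℝ) : ℂ) * e) x‖⁻¹ ≤
      128 * ((1 - ‖x‖) / M) * (1 / ‖e - x‖ ^ 2) +
      (if ‖e - ((1 - 1 / M : ℝ) : ℂ) * u‖ ≤ 2 / M then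
        8 / (7 * (M * (1 - ‖x‖))) * Real.log s⁻¹ else 0) +
      (if ‖e - x‖ ≤ 4 / 3 * (1 - ‖x‖) then
        8 / (7 * (M * (1 - ‖x‖))) * Real.log (12 / d) else 0) +
      8 / (7 * (M * (1 - ‖x‖))) *
        (Real.log ‖e - x‖ - Real.log ‖e - ((1 - 1 / M : ℝ) : ℂ) * u‖ + (1 - ‖x‖) / d) := by
  have hM' : (0:ℝ) < M := by positivity
  have hM1 : 0 < 1 / (M:ℝ) := by positivity
  set y : ℝ := 1 - ‖x‖ with hydef
  have hy0 : 0 < y := by linarith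
  set ζ : ℂ := ((1 - v : ℝ) : ℂ) * e with hζ
  set w : ℂ := ((1 - 1 / M : ℝ) : ℂ) * u with hw
  have hζn : ‖ζ‖ = 1 - v := by
    rw [hζ, norm_mul, Complex.norm_real, he, mul_one, Real.norm_of_nonneg (by linarith)]
  have hζ1 : ‖ζ‖ < 1 := by linarith
  have hM1' : 1 / (M:ℝ) ≤ 1 := by linarith [norm_nonneg x]
  have hwn : ‖w‖ = 1 - 1 / M := by
    rw [hw, norm_mul, Complex.norm_real, hu, mul_one, Real.norm_of_nonneg (by linarith)]
  have hX : y ≤ ‖e - x‖ := by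
    have := norm_sub_norm_le e x; rw [he] at this; exact this
  have hX0 : 0 < ‖e - x‖ := by linarith
  have hW : 1 / M ≤ ‖e - w‖ := by
    have := norm_sub_norm_le e w; rw [he, hwn] at this; linarith
  have hW0 : 0 < ‖e - w‖ := by linarith
  have hm0 : 0 < ‖mob ζ x‖ := by linarith
  have hxζ : x ≠ ζ := by
    rintro h; rw [h, mob_self] at hm0; simp at hm0
  have ha0 : 0 < ‖x - ζ‖ := norm_pos_iff.2 (sub_ne_zero.2 hxζ)
  have hxn : ‖x‖ = 1 - y := by rw [hydef]; ring
  have hd1 : d < 1 := by linarith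
  -- the fourth term is nonnegative
  have hT4 : 0 ≤ Real.log ‖e - x‖ - Real.log ‖e - w‖ + y / d :=
    log_ratio_nonneg hM hd he hx hxd hu hxu hy hW0
  have hT1 : 0 ≤ 128 * (y / M) * (1 / ‖e - x‖ ^ 2) := by positivity
  have hLs : 0 ≤ Real.log s⁻¹ := Real.log_nonneg ((one_le_inv₀ hs).2 hs1)
  have hLd : 0 ≤ Real.log (12 / d) := Real.log_nonneg (by rw [le_div_iff₀ hd]; linarith)
  have hT2 : 0 ≤ (if ‖e - w‖ ≤ 2 / M then 8 / (7 * (M * y)) * Real.log s⁻¹ else 0) := by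
    split_ifs <;> positivity
  have hT3 : 0 ≤ (if ‖e - x‖ ≤ 4 / 3 * y then 8 / (7 * (M * y)) * Real.log (12 / d) else 0) := by
    split_ifs <;> positivity
  have hT4' : 0 ≤ 8 / (7 * (M * y)) * (Real.log ‖e - x‖ - Real.log ‖e - w‖ + y / d) := by
    positivity
  have hmain := inv_mob_sq_le hζ1 hx hxζ
  rw [hζn, ← hydef, sub_sub_cancel] at hmain
  have hlog : Real.log ‖mob ζ x‖⁻¹ ≤ 1 / 2 * Real.log (1 + 4 * v * y / ‖x - ζ‖ ^ 2) := by
    have := Real.log_le_log (by positivity) hmain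
    rw [Real.log_pow] at this
    push_cast at this
    linarith
  have hζe : ‖e - ζ‖ = v := by
    have : e - ζ = (v : ℂ) * e := by rw [hζ]; push_cast; ring
    rw [this, norm_mul, he, mul_one, Complex.norm_real, Real.norm_of_nonneg hv.le]
  rcases le_or_gt (‖e - x‖ / 8) ‖x - ζ‖ with hA | hB
  · have h1 : Real.log ‖mob ζ x‖⁻¹ ≤ 128 * v * y * (1 / ‖e - x‖ ^ 2) := by
      refine hlog.trans ?_
      have h2 := Real.log_le_sub_one_of_pos (show 0 < 1 + 4 * v * y / ‖x - ζ‖ ^ 2 by positivity)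
      have h3 : 4 * v * y / ‖x - ζ‖ ^ 2 ≤ 4 * v * y / (‖e - x‖ / 8) ^ 2 := by gcongr
      have h4 : 4 * v * y / (‖e - x‖ / 8) ^ 2 = 2 * (128 * v * y * (1 / ‖e - x‖ ^ 2)) := by
        field_simp; norm_num
      linarith
    have h2 : 1 / (M * v) * Real.log ‖mob ζ x‖⁻¹ ≤ 128 * (y / M) * (1 / ‖e - x‖ ^ 2) := by
      calc _ ≤ 1 / (M * v) * (128 * v * y * (1 / ‖e - x‖ ^ 2)) := by gcongr
        _ = _ := by field_simp
    linarith
  · have h1 : ‖e - x‖ ≤ v + ‖x - ζ‖ := by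
      rw [← hζe, norm_sub_rev x ζ]
      have := norm_add_le (e - ζ) (ζ - x)
      rwa [sub_add_sub_cancel] at this
    have h2 : |‖x‖ - ‖ζ‖| ≤ ‖x - ζ‖ := abs_norm_sub_norm_le _ _
    rw [hζn, hxn, abs_le] at h2
    have hvy : 7 / 8 * y ≤ v := by
      have : v ≥ 7 / 8 * ‖e - x‖ := by linarith
      linarith
    have hXy : ‖e - x‖ ≤ 4 / 3 * y := by linarith [h2.1, h2.2]
    have hvy' : v ≤ 7 / 6 * y := by linarith [h2.1, h2.2]
    have hβ : 1 / (M * v) ≤ 8 / (7 * (M * y)) := by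
      rw [div_le_div_iff₀ (by positivity) (by positivity)]
      linarith [mul_le_mul_of_nonneg_left hvy hM'.le]
    have hm1 : ‖mob ζ x‖ ≤ 1 := (mob_norm_lt hζ1 hx).le
    have hl0 : 0 ≤ Real.log ‖mob ζ x‖⁻¹ := Real.log_nonneg ((one_le_inv₀ hm0).2 hm1)
    have hred : 1 / (M * v) * Real.log ‖mob ζ x‖⁻¹ ≤
        8 / (7 * (M * y)) * Real.log ‖mob ζ x‖⁻¹ := by gcongr
    rcases le_or_gt ‖e - w‖ (2 / M) with hn | hn
    · rw [if_pos hn]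
      rw [if_pos hn] at hT2
      have : Real.log ‖mob ζ x‖⁻¹ ≤ Real.log s⁻¹ :=
        Real.log_le_log (by positivity) (inv_anti₀ hs hmob)
      have : 8 / (7 * (M * y)) * Real.log ‖mob ζ x‖⁻¹ ≤ 8 / (7 * (M * y)) * Real.log s⁻¹ := by
        gcongr
      linarith
    · rw [if_pos hXy]
      have h3 : d * ‖e - u‖ ≤ 2 * ‖x - ζ‖ := by
        have e1 : ((1 - v : ℝ) : ℂ) * (e - u) = (ζ - x) + ((‖x‖ - (1 - v) : ℝ) : ℂ) * u := by
          rw [hζ, Complex.ofReal_sub ‖x‖]; linear_combination hxu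
        have e2 := congrArg norm e1
        rw [norm_mul, Complex.norm_real, Real.norm_of_nonneg (by linarith)] at e2
        have e3 := norm_add_le (ζ - x) (((‖x‖ - (1 - v) : ℝ) : ℂ) * u)
        rw [norm_mul, hu, mul_one, Complex.norm_real, Real.norm_eq_abs] at e3
        have e4 : |‖x‖ - (1 - v)| ≤ ‖x - ζ‖ := by rw [abs_le, hxn]; exact h2
        rw [norm_sub_rev ζ x] at e3
        have e5 : d * ‖e - u‖ ≤ (1 - v) * ‖e - u‖ := by gcongr; linarith
        linarith
      have h4 : ‖e - w‖ ≤ ‖e - u‖ + 1 / M := by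
        have e1 : e - w = (e - u) + ((1 / M : ℝ) : ℂ) * u := by rw [hw]; push_cast; ring
        rw [e1]
        refine (norm_add_le _ _).trans ?_
        rw [norm_mul, hu, mul_one, Complex.norm_real, Real.norm_of_nonneg hM1.le]
      have h5 : ‖e - w‖ ≤ 2 * ‖e - u‖ := by
        have : 2 / (M:ℝ) = 2 * (1 / M) := by ring
        linarith
      have h6 : d * ‖e - w‖ ≤ 4 * ‖x - ζ‖ := by linarith [mul_le_mul_of_nonneg_left h5 hd.le]
      have h7 : Real.log ‖mob ζ x‖⁻¹ ≤
          Real.log (12 / d) + (Real.log ‖e - x‖ - Real.log ‖e - w‖) := by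
        have e1 : 1 + 4 * v * y / ‖x - ζ‖ ^ 2 ≤ (3 * y / ‖x - ζ‖) ^ 2 := by
          have : 1 + 4 * v * y / ‖x - ζ‖ ^ 2 = (‖x - ζ‖ ^ 2 + 4 * v * y) / ‖x - ζ‖ ^ 2 := by
            field_simp
          rw [this, div_pow]
          gcongr
          have e4 : ‖x - ζ‖ ^ 2 ≤ y ^ 2 := pow_le_pow_left₀ ha0.le (by linarith) 2
          have e5 : v * y ≤ 7 / 6 * y * y := mul_le_mul_of_nonneg_right hvy' hy0.le
          have e6 : 0 ≤ y ^ 2 := sq_nonneg y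
          linarith
        have e2 : 3 * y / ‖x - ζ‖ ≤ 12 / d * ‖e - x‖ / ‖e - w‖ := by
          rw [div_le_div_iff₀ ha0 hW0, div_mul_eq_mul_div, div_mul_eq_mul_div, le_div_iff₀ hd]
          linarith [mul_le_mul_of_nonneg_left h6 hy0.le, mul_le_mul_of_nonneg_right hX ha0.le]
        have e3 := Real.log_le_log (by positivity) e1
        rw [Real.log_pow] at e3
        push_cast at e3
        have e4 := Real.log_le_log (by positivity) e2
        rw [Real.log_div (by positivity) hW0.ne', Real.log_mul (by positivity) hX0.ne'] at e4
        linarith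
      have h8 : 8 / (7 * (M * y)) * Real.log ‖mob ζ x‖⁻¹ ≤ 8 / (7 * (M * y)) *
          (Real.log (12 / d) + (Real.log ‖e - x‖ - Real.log ‖e - w‖ + y / d)) := by
        have : 0 ≤ y / d := by positivity
        gcongr; linarith
      linarith

set_option maxHeartbeats 1000000 in
/-- Bound for the logarithmic potential of points on distinct radii. -/
lemma green_potential_le {M : ℕ} (hM : M ≠ 0) {d s : ℝ} (hd : 0 < d) (hs : 0 < s) (hs1 : s ≤ 1)
    (B : Finset ℕ) (hB : B ⊆ Finset.range M) (v : ℕ → ℝ) (hv : ∀ j ∈ B, 0 < v j)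
    (hvd : ∀ j ∈ B, v j ≤ 1 - d) {x : ℂ} (hx : ‖x‖ < 1) (hxd : d / 2 ≤ ‖x‖)
    (hy : 1 / (M : ℝ) ≤ 1 - ‖x‖) (hys : Real.log s⁻¹ ≤ M * (1 - ‖x‖))
    (hmob : ∀ j ∈ B, s ≤ ‖mob (((1 - v j : ℝ) : ℂ) * rtu M j) x‖) :
    ∑ j ∈ B, 1 / (M * v j) * Real.log ‖mob (((1 - v j : ℝ) : ℂ) * rtu M j) x‖⁻¹ ≤
      600 + 10 * Real.log (12 / d) + 2 / d := by
  have hM' : (0:ℝ) < M := by positivity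
  have hM1 : 0 < 1 / (M:ℝ) := by positivity
  have hM1' : 1 / (M:ℝ) ≤ 1 := by linarith [norm_nonneg x]
  have hx0 : 0 < ‖x‖ := by linarith
  have hd2 : d ≤ 2 := by linarith
  have hxC : (‖x‖ : ℂ) ≠ 0 := by exact_mod_cast hx0.ne'
  obtain ⟨u, hu, hxu⟩ : ∃ u : ℂ, ‖u‖ = 1 ∧ x = ‖x‖ * u := by
    refine ⟨x / ‖x‖, ?_, by field_simp⟩
    rw [norm_div, Complex.norm_real, norm_norm, div_self hx0.ne']
  set y : ℝ := 1 - ‖x‖ with hydef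
  have hy0 : 0 < y := by linarith
  set w : ℂ := ((1 - 1 / M : ℝ) : ℂ) * u with hw
  have hwn : ‖w‖ = 1 - 1 / M := by
    rw [hw, norm_mul, Complex.norm_real, hu, mul_one, Real.norm_of_nonneg (by linarith)]
  have hwh : 1 / (M : ℝ) ≤ 1 - ‖w‖ := by rw [hwn]; linarith
  have hMy : 1 ≤ M * y := by
    rw [div_le_iff₀ hM'] at hy; linarith
  set c : ℝ := 8 / (7 * (M * y)) with hc
  have hc0 : 0 < c := by positivity
  have hcMy : c * (M * y) = 8 / 7 := by rw [hc]; field_simp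
  have hLs : 0 ≤ Real.log s⁻¹ := Real.log_nonneg ((one_le_inv₀ hs).2 hs1)
  have hLd : 0 ≤ Real.log (12 / d) := Real.log_nonneg (by rw [le_div_iff₀ hd]; linarith)
  have hone : ∀ j, 0 < v j → v j ≤ 1 - d → s ≤ ‖mob (((1 - v j : ℝ) : ℂ) * rtu M j) x‖ →
    1 / (M * v j) * Real.log ‖mob (((1 - v j : ℝ) : ℂ) * rtu M j) x‖⁻¹ ≤
      128 * (y / M) * (1 / ‖rtu M j - x‖ ^ 2) +
      (if ‖rtu M j - w‖ ≤ 2 / M then c * Real.log s⁻¹ else 0) +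
      (if ‖rtu M j - x‖ ≤ 4 / 3 * y then c * Real.log (12 / d) else 0) +
      c * (Real.log ‖rtu M j - x‖ - Real.log ‖rtu M j - w‖ + y / d) :=
    fun j h1 h2 h3 => green_term_le hM hd hs hs1 h1 h2 (rtu_norm M j) hx hxd hu hxu hy h3
  have hnonneg4 : ∀ j, 0 ≤ Real.log ‖rtu M j - x‖ - Real.log ‖rtu M j - w‖ + y / d := by
    intro j
    exact log_ratio_nonneg hM hd (rtu_norm M j) hx hxd hu hxu hy
      (rtu_sub_ne (w := w) (by linarith))
  calc _ ≤ ∑ j ∈ B, (128 * (y / M) * (1 / ‖rtu M j - x‖ ^ 2) +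
      (if ‖rtu M j - w‖ ≤ 2 / M then c * Real.log s⁻¹ else 0) +
      (if ‖rtu M j - x‖ ≤ 4 / 3 * y then c * Real.log (12 / d) else 0) +
      c * (Real.log ‖rtu M j - x‖ - Real.log ‖rtu M j - w‖ + y / d)) :=
        Finset.sum_le_sum fun j hj => hone j (hv j hj) (hvd j hj) (hmob j hj)
    _ ≤ ∑ j ∈ Finset.range M, (128 * (y / M) * (1 / ‖rtu M j - x‖ ^ 2) +
      (if ‖rtu M j - w‖ ≤ 2 / M then c * Real.log s⁻¹ else 0) +
      (if ‖rtu M j - x‖ ≤ 4 / 3 * y then c * Real.log (12 / d) else 0) +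
      c * (Real.log ‖rtu M j - x‖ - Real.log ‖rtu M j - w‖ + y / d)) := by
        refine Finset.sum_le_sum_of_subset_of_nonneg hB fun j _ _ => ?_
        have := hnonneg4 j
        refine add_nonneg (add_nonneg (add_nonneg ?_ ?_) ?_) ?_
        · positivity
        · split_ifs <;> positivity
        · split_ifs <;> positivity
        · positivity
    _ ≤ 512 + 64 + 10 * Real.log (12 / d) + (4 + 2 / d) := by
        simp only [Finset.sum_add_distrib]
        have t1 : ∑ j ∈ Finset.range M, 128 * (y / M) * (1 / ‖rtu M j - x‖ ^ 2) ≤ 512 := by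
          rw [← Finset.mul_sum]
          calc _ ≤ 128 * (y / M) * (4 * M / y) := by
                gcongr; exact rtu_sum_inv_sq hM hy
            _ = 512 := by field_simp; norm_num
        have t2 : ∑ j ∈ Finset.range M, (if ‖rtu M j - w‖ ≤ 2 / M then c * Real.log s⁻¹ else 0) ≤
            64 := by
          rw [← Finset.sum_filter, Finset.sum_const, nsmul_eq_mul]
          have := rtu_count_le hM hwh (τ := 2 / M) ((Finset.range M).filter
            (fun j => ‖rtu M j - w‖ ≤ 2 / M)) (Finset.filter_subset _ _)
            (fun j hj => (Finset.mem_filter.1 hj).2)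
          rw [hwn, sub_sub_cancel] at this
          have e1 : (2 / (M:ℝ)) ^ 2 * (4 * M / (1 / M)) = 16 := by field_simp; norm_num
          rw [e1] at this
          have e2 : c * Real.log s⁻¹ ≤ 8 / 7 := by rw [← hcMy]; gcongr
          have e3 : 0 ≤ c * Real.log s⁻¹ := by positivity
          nlinarith
        have t3 : ∑ j ∈ Finset.range M, (if ‖rtu M j - x‖ ≤ 4 / 3 * y then
            c * Real.log (12 / d) else 0) ≤ 10 * Real.log (12 / d) := by
          rw [← Finset.sum_filter, Finset.sum_const, nsmul_eq_mul]
          have := rtu_count_le hM hy (τ := 4 / 3 * y) ((Finset.range M).filter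
            (fun j => ‖rtu M j - x‖ ≤ 4 / 3 * y)) (Finset.filter_subset _ _)
            (fun j hj => (Finset.mem_filter.1 hj).2)
          rw [← hydef] at this
          have e1 : (4 / 3 * y) ^ 2 * (4 * M / y) = 64 / 9 * (M * y) := by field_simp; norm_num
          rw [e1] at this
          rw [← mul_assoc]
          gcongr
          calc _ ≤ 64 / 9 * (M * y) * c := by gcongr
            _ = 64 / 9 * (c * (M * y)) := by ring
            _ ≤ 10 := by rw [hcMy]; norm_num
        have t4 : ∑ j ∈ Finset.range M, c * (Real.log ‖rtu M j - x‖ - Real.log ‖rtu M j - w‖ +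
            y / d) ≤ 4 + 2 / d := by
          rw [← Finset.mul_sum, Finset.sum_add_distrib, Finset.sum_sub_distrib,
            ← Real.log_prod (fun j _ => (rtu_sub_ne hx).ne'),
            ← Real.log_prod (fun j _ => (rtu_sub_ne (w := w) (by linarith)).ne'),
            rtu_prod hM, rtu_prod hM, Finset.sum_const, Finset.card_range, nsmul_eq_mul]
          have e1 : ‖1 - x ^ M‖ ≤ 2 := by
            refine (norm_sub_le _ _).trans ?_
            rw [norm_one, norm_pow]
            have := pow_le_one₀ (norm_nonneg x) hx.le (n := M)
            linarith
          have e1' : 0 < ‖1 - x ^ M‖ := by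
            have := norm_sub_norm_le 1 (x ^ M)
            rw [norm_one, norm_pow] at this
            have := pow_le_half (norm_nonneg x) hy hM
            linarith
          have e2 : 1 / 2 ≤ ‖1 - w ^ M‖ := by
            have := norm_sub_norm_le 1 (w ^ M)
            rw [norm_one, norm_pow] at this
            have := pow_le_half (norm_nonneg w) hwh hM
            linarith
          have e3 : Real.log ‖1 - x ^ M‖ ≤ 1 := (Real.log_le_sub_one_of_pos e1').trans (by linarith)
          have e4 : -1 ≤ Real.log ‖1 - w ^ M‖ := by
            have := Real.one_sub_inv_le_log_of_pos (show 0 < ‖1 - w ^ M‖ by linarith)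
            have h2 : ‖1 - w ^ M‖⁻¹ ≤ 2 := by
              rw [inv_le_comm₀ (by linarith) (by norm_num)]; linarith
            linarith
          calc _ ≤ c * (2 + M * (y / d)) := by gcongr; linarith
            _ = 2 * c + c * (M * y) / d := by ring
            _ ≤ 4 + 2 / d := by
              rw [hcMy]
              have : c ≤ 8 / 7 := by rw [← hcMy]; nlinarith
              have : 8 / 7 / d ≤ 2 / d := by gcongr; norm_num
              linarith
        linarith
    _ ≤ _ := by linarith

end

section

open Complex Metric Set
open scoped ComplexConjugate

lemma log_inv_ge_half {m : ℝ} (h : 0 < m) : 1 / 2 * (1 - m ^ 2) ≤ Real.log m⁻¹ := by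
  have := Real.log_le_sub_one_of_pos (show 0 < m ^ 2 by positivity)
  rw [Real.log_pow] at this
  rw [Real.log_inv]
  push_cast at this
  linarith

lemma norm_sub_le_of_mob {a x : ℂ} (ha : ‖a‖ < 1) (hx : ‖x‖ < 1) {s : ℝ}
    (h : ‖mob a x‖ ≤ s) : ‖x - a‖ * (1 - s) ≤ 2 * s * (1 - ‖a‖) := by
  have h0 := norm_pos_iff.2 (one_sub_conj_mul_ne ha hx.le)
  rw [mob, norm_div, div_le_iff₀ h0] at h
  have h1 : ‖1 - conj a * x‖ ≤ (1 - ‖a‖ ^ 2) + ‖x - a‖ := by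
    have e : 1 - conj a * x = ((1 - ‖a‖ ^ 2 : ℝ) : ℂ) - conj a * (x - a) := by
      push_cast; rw [← Complex.conj_mul' a]; ring
    rw [e]
    refine (norm_sub_le _ _).trans ?_
    rw [Complex.norm_real, Real.norm_of_nonneg (by nlinarith [norm_nonneg a]), norm_mul,
      RCLike.norm_conj]
    nlinarith [norm_nonneg (x - a)]
  have hs0 : 0 ≤ s := by
    by_contra! hc
    nlinarith [norm_nonneg (x - a)]
  have h2 : s * (1 - ‖a‖ ^ 2) ≤ s * (2 * (1 - ‖a‖)) := by
    gcongr; nlinarith [norm_nonneg a]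
  nlinarith [mul_le_mul_of_nonneg_left h1 hs0]

/-- Maximum principle for a power of `g` divided by a Blaschke product. -/
lemma green_max_principle {g : ℂ → ℂ} (hg : AnaCl g) (hg1 : ∀ x, ‖x‖ ≤ 1 → ‖g x‖ ≤ 1)
    (B : Finset ℕ) (ζ : ℕ → ℂ) (hζ : ∀ j ∈ B, ‖ζ j‖ < 1) {s : ℝ} (hs : 0 < s) (P : ℕ) (p : ℕ → ℕ)
    (hbd : ∀ x, ‖x‖ < 1 → (∀ j ∈ B, s ≤ ‖mob (ζ j) x‖) → (∃ j ∈ B, ‖mob (ζ j) x‖ = s) →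
      ‖g x‖ ^ P ≤ ∏ j ∈ B, ‖mob (ζ j) x‖ ^ p j)
    {z : ℂ} (hz : ‖z‖ < 1) (hzs : ∀ j ∈ B, s < ‖mob (ζ j) z‖) :
    ‖g z‖ ^ P ≤ ∏ j ∈ B, ‖mob (ζ j) z‖ ^ p j := by
  set H : ℂ → ℂ := fun x => g x ^ P / ∏ j ∈ B, mob (ζ j) x ^ p j with hH
  set Ω : Set ℂ := ball 0 1 ∩ {x | ∀ j ∈ B, s < ‖mob (ζ j) x‖} with hΩ
  set K : Set ℂ := closedBall 0 1 ∩ {x | ∀ j ∈ B, s ≤ ‖mob (ζ j) x‖} with hK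
  have hmc : ∀ j ∈ B, ContinuousOn (fun x => ‖mob (ζ j) x‖) (closedBall 0 1) := fun j hj =>
    (mob_analytic (hζ j hj)).continuousOn.norm
  have hKc : IsClosed K := by
    have : K = closedBall 0 1 ∩ ⋂ j ∈ B, (closedBall 0 1 ∩ {x | s ≤ ‖mob (ζ j) x‖}) := by
      ext x; simp only [hK, mem_inter_iff, mem_ofPred_eq, mem_iInter]
      constructor
      · rintro ⟨h1, h2⟩; exact ⟨h1, fun j hj => ⟨h1, h2 j hj⟩⟩
      · rintro ⟨h1, h2⟩; exact ⟨h1, fun j hj => (h2 j hj).2⟩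
    rw [this]
    refine isClosed_closedBall.inter (isClosed_biInter fun j hj => ?_)
    exact (hmc j hj).preimage_isClosed_of_isClosed isClosed_closedBall isClosed_Ici
  have hΩo : IsOpen Ω := by
    have : Ω = ball 0 1 ∩ ⋂ j ∈ B, (ball 0 1 ∩ {x | s < ‖mob (ζ j) x‖}) := by
      ext x; simp only [hΩ, mem_inter_iff, mem_ofPred_eq, mem_iInter]
      constructor
      · rintro ⟨h1, h2⟩; exact ⟨h1, fun j hj => ⟨h1, h2 j hj⟩⟩
      · rintro ⟨h1, h2⟩; exact ⟨h1, fun j hj => (h2 j hj).2⟩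
    rw [this]
    refine isOpen_ball.inter (isOpen_biInter_finset fun j hj => ?_)
    exact ((hmc j hj).mono ball_subset_closedBall).isOpen_inter_preimage isOpen_ball isOpen_Ioi
  have hΩK : closure Ω ⊆ K := closure_minimal
    (fun x hx => ⟨ball_subset_closedBall hx.1, fun j hj => (hx.2 j hj).le⟩) hKc
  have hne : ∀ x ∈ K, ∏ j ∈ B, mob (ζ j) x ^ p j ≠ 0 := by
    intro x hx
    refine Finset.prod_ne_zero_iff.2 fun j hj => pow_ne_zero _ (norm_pos_iff.1 ?_)
    exact lt_of_lt_of_le hs (hx.2 j hj)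
  have hHd : DifferentiableOn ℂ H (closure Ω) := by
    intro x hx
    have hx' := hΩK hx
    refine DifferentiableAt.differentiableWithinAt ?_
    have h1 : AnalyticAt ℂ (fun x => ∏ j ∈ B, mob (ζ j) x ^ p j) x := by
      apply Finset.analyticAt_fun_prod
      intro j hj
      exact (mob_analytic (hζ j hj) x hx'.1).pow _
    exact (((hg x hx'.1).pow P).div h1 (hne x hx')).differentiableAt
  have hnorm : ∀ x, ‖H x‖ = ‖g x‖ ^ P / ∏ j ∈ B, ‖mob (ζ j) x‖ ^ p j := by
    intro x; simp [hH]
  have hzΩ : z ∈ Ω := ⟨by simpa using hz, hzs⟩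
  have hpos : ∀ x ∈ K, 0 < ∏ j ∈ B, ‖mob (ζ j) x‖ ^ p j := by
    intro x hx
    exact Finset.prod_pos fun j hj => pow_pos (lt_of_lt_of_le hs (hx.2 j hj)) _
  have := Complex.norm_le_of_forall_mem_frontier_norm_le (U := Ω) (f := H) (C := 1)
    (isBounded_ball.subset inter_subset_left) hHd.diffContOnCl (fun x hx => by
      have hxK : x ∈ K := hΩK (frontier_subset_closure hx)
      have hxΩ : x ∉ Ω := by
        rw [hΩo.frontier_eq] at hx; exact hx.2
      have hx1 : ‖x‖ ≤ 1 := by simpa using hxK.1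
      rw [hnorm, div_le_one (hpos x hxK)]
      rcases hx1.lt_or_eq with h | h
      · refine hbd x h hxK.2 ?_
        by_contra! hc
        exact hxΩ ⟨by simpa using h, fun j hj => lt_of_le_of_ne (hxK.2 j hj) (hc j hj).symm⟩
      · rw [Finset.prod_eq_one fun j hj => by rw [mob_norm_one (hζ j hj) h, one_pow]]
        exact pow_le_one₀ (norm_nonneg _) (hg1 x hx1)) (subset_closure hzΩ)
  rwa [hnorm, div_le_one (hpos z (hΩK (subset_closure hzΩ)))] at this

lemma hall_aux_one {a b c m y : ℝ} (hm : m ≠ 0) (hy : y ≠ 0) (hc : c ≠ 0) :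
    b * a = a / c * (b * (1 / (18 * m * y))) * (18 * m * y * c) := by
  field_simp

lemma hall_aux_two {c l m y t : ℝ} (ht : t ≠ 0) :
    18 * m * y * c * l = m * (t * y) / 200 * (3600 * c * l / t + 1 - 1) := by
  field_simp; ring

set_option maxHeartbeats 2000000 in
lemma hall_core {δ ε v0 : ℝ} (hδ : 0 < δ) (hδ1 : δ ≤ 1) (hε : 0 < ε) (hεδ : ε ≤ δ / 64)
    (hv0 : 0 < v0) {M : ℕ} (hM1 : 2 ≤ M * v0) (hM2 : 2 * Real.log (ε / 2)⁻¹ ≤ M * v0)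
    {g : ℂ → ℂ} (hg : AnaCl g) (hg1 : ∀ x, ‖x‖ ≤ 1 → ‖g x‖ ≤ 1)
    {z e : ℂ} (hz : ‖z‖ < 1) (hgz : δ ≤ ‖g z‖) (hze : z = ‖z‖ * e)
    (B : Finset ℕ) (hB : B ⊆ Finset.range M) (v : ℕ → ℝ)
    (hv : ∀ j ∈ B, v0 ≤ v j) (hvy : ∀ j ∈ B, v j ≤ 1 - ‖z‖)
    (hje : ∀ j ∈ B, ‖rtu M j - e‖ ≤ 1 - ‖z‖)
    (hgv : ∀ j ∈ B, ‖g (((1 - v j : ℝ) : ℂ) * rtu M j)‖ ≤ ε) :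
    B.card * Real.log (2 * ε)⁻¹ ≤
      18 * M * (1 - ‖z‖) * (600 + 10 * Real.log (12 / (δ / 16)) + 2 / (δ / 16)) * Real.log δ⁻¹ := by
  have hM0 : M ≠ 0 := by rintro rfl; norm_num at hM1
  have hM' : (0:ℝ) < M := by positivity
  set y := 1 - ‖z‖ with hy
  have hy0 : 0 < y := by linarith
  set d := δ / 16 with hd
  have hd0 : 0 < d := by positivity
  set s := ε / 2 with hs
  have hs0 : 0 < s := by positivity
  have hsd : s ≤ d / 8 := by rw [hs, hd]; linarith
  set ζ : ℕ → ℂ := fun j => ((1 - v j : ℝ) : ℂ) * rtu M j with hζ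
  have hζn : ∀ j ∈ B, ‖ζ j‖ = 1 - v j := by
    intro j hj
    have := hvy j hj
    simp only [hζ]
    rw [norm_mul, Complex.norm_real, rtu_norm, mul_one,
      Real.norm_of_nonneg (by linarith [norm_nonneg z])]
  have hζ1 : ∀ j ∈ B, ‖ζ j‖ < 1 := fun j hj => by rw [hζn j hj]; linarith [hv j hj]
  have hmz : ∀ j ∈ B, (δ - ε) / 2 ≤ ‖mob (ζ j) z‖ := by
    intro j hj
    have h1 := norm_sub_le_mob hg hg1 (hζ1 j hj) hz.le
    have h2 := norm_sub_norm_le (g z) (g (ζ j))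
    have h3 := hgv j hj
    linarith
  have hvd : ∀ j ∈ B, v j ≤ 1 - d := by
    intro j hj
    by_contra! hc
    have h1 : ‖mob (ζ j) z‖ ≤ 2 * d * (16 / 15) := by
      have h2 := one_sub_conj_mul_norm (a := ζ j) hz.le
      rw [hζn j hj] at h2
      rw [mob, norm_div, div_le_iff₀ (by linarith)]
      have h3 := norm_sub_le z (ζ j)
      rw [hζn j hj] at h3
      have h4 := hvy j hj
      have hd16 : d ≤ 1 / 16 := by rw [hd]; linarith
      have : 15 / 16 ≤ ‖1 - conj (ζ j) * z‖ := by linarith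
      have h5 := mul_le_mul_of_nonneg_left this hd0.le
      linarith
    have := hmz j hj
    have : δ = 16 * d := by rw [hd]; ring
    linarith
  set C0 := 600 + 10 * Real.log (12 / d) + 2 / d with hC0
  have hd16 : d ≤ 1 / 16 := by rw [hd]; linarith
  have hC0p : 0 < C0 := by
    have : 0 ≤ Real.log (12 / d) := Real.log_nonneg (by rw [le_div_iff₀ hd0]; linarith)
    positivity
  have hs1 : s ≤ 1 / 128 := by linarith
  have hU : ∀ x, ‖x‖ < 1 → (∀ j ∈ B, s ≤ ‖mob (ζ j) x‖) → (∃ j ∈ B, ‖mob (ζ j) x‖ = s) →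
      ∑ j ∈ B, 1 / (M * v j) * Real.log ‖mob (ζ j) x‖⁻¹ ≤ C0 := by
    rintro x hx hx1 ⟨j0, hj0, hj0s⟩
    have h1 := norm_sub_le_of_mob (hζ1 j0 hj0) hx hj0s.le
    rw [hζn j0 hj0, sub_sub_cancel] at h1
    have hv1 := hv j0 hj0
    have hv2 := hvd j0 hj0
    have h2 : ‖x - ζ j0‖ ≤ 3 * s * v j0 := by
      nlinarith [norm_nonneg (x - ζ j0), mul_pos hs0 (lt_of_lt_of_le hv0 hv1)]
    have h3 := norm_sub_norm_le x (ζ j0)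
    have h4 := norm_sub_norm_le (ζ j0) x
    rw [norm_sub_rev] at h4
    rw [hζn j0 hj0] at h3 h4
    have h5 : 3 * s * v j0 ≤ v j0 / 2 := by
      linarith [mul_le_mul_of_nonneg_right hsd (hv0.le.trans hv1),
        mul_le_mul_of_nonneg_right hd16 (hv0.le.trans hv1)]
    have h6 : 3 * s * v j0 ≤ d / 2 := by nlinarith
    have h7 : v0 / 2 ≤ 1 - ‖x‖ := by linarith
    refine green_potential_le hM0 hd0 hs0 (by linarith) B hB v
      (fun j hj => lt_of_lt_of_le hv0 (hv j hj)) hvd hx (by linarith) ?_ ?_ hx1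
    · rw [div_le_iff₀ hM']; nlinarith
    · nlinarith
  set A := Real.log (2 * ε)⁻¹ with hA
  have hA0 : 0 < A := Real.log_pos (by rw [lt_inv_comm₀ one_pos (by positivity)]; linarith)
  set U := ∑ j ∈ B, 1 / (M * v j) * Real.log ‖mob (ζ j) z‖⁻¹ with hUdef
  have hmzpos : ∀ j ∈ B, 0 < ‖mob (ζ j) z‖ := fun j hj => by have := hmz j hj; linarith
  have hgz0 : 0 < ‖g z‖ := by linarith
  have hlogδ : 0 ≤ Real.log δ⁻¹ := Real.log_nonneg ((one_le_inv₀ hδ).2 hδ1)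
  -- the key inequality for each power
  have key : ∀ P : ℕ, (A / C0 * U) * P - ∑ j ∈ B, Real.log ‖mob (ζ j) z‖⁻¹ ≤
      P * Real.log δ⁻¹ := by
    intro P
    set p : ℕ → ℕ := fun j => ⌊1 / (M * v j) * P * A / C0⌋₊ with hp
    have hpn : ∀ j ∈ B, 0 ≤ 1 / (M * v j) * P * A / C0 := fun j hj => by
      have := lt_of_lt_of_le hv0 (hv j hj); positivity
    have hmp := green_max_principle hg hg1 B ζ hζ1 hs0 P p (fun x hx hx1 hx2 => by
      have hUx := hU x hx hx1 hx2
      obtain ⟨j0, hj0, hj0s⟩ := hx2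
      have hgx : ‖g x‖ ≤ 2 * ε := by
        have h1 := norm_sub_le_mob hg hg1 (hζ1 j0 hj0) hx.le
        have h2 := norm_sub_norm_le (g x) (g (ζ j0))
        have h3 := hgv j0 hj0
        rw [hj0s] at h1
        simp only [hs] at h1
        linarith
      have hpos : ∀ j ∈ B, 0 < ‖mob (ζ j) x‖ := fun j hj => lt_of_lt_of_le hs0 (hx1 j hj)
      calc ‖g x‖ ^ P ≤ (2 * ε) ^ P := by gcongr
        _ = Real.exp (-(P * A)) := by
          rw [hA, Real.log_inv, mul_neg, neg_neg, mul_comm (P : ℝ), Real.exp_mul,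
            Real.exp_log (by positivity), Real.rpow_natCast]
        _ ≤ Real.exp (∑ j ∈ B, p j * Real.log ‖mob (ζ j) x‖) := by
          rw [Real.exp_le_exp, neg_le, ← Finset.sum_neg_distrib]
          calc _ ≤ ∑ j ∈ B, (P * A / C0) * (1 / (M * v j) * Real.log ‖mob (ζ j) x‖⁻¹) := by
                refine Finset.sum_le_sum fun j hj => ?_
                rw [← mul_neg, ← Real.log_inv]
                have h1 : 0 ≤ Real.log ‖mob (ζ j) x‖⁻¹ := Real.log_nonneg
                  ((one_le_inv₀ (hpos j hj)).2 (mob_norm_lt (hζ1 j hj) hx).le)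
                have h2 : (p j : ℝ) ≤ 1 / (M * v j) * P * A / C0 := Nat.floor_le (hpn j hj)
                calc _ ≤ (1 / (M * v j) * P * A / C0) * Real.log ‖mob (ζ j) x‖⁻¹ := by gcongr
                  _ = _ := by ring
            _ ≤ (P * A / C0) * C0 := by
                rw [← Finset.mul_sum]; gcongr
            _ = P * A := by field_simp
        _ = _ := by
          rw [Real.exp_sum]
          refine Finset.prod_congr rfl fun j hj => ?_
          rw [mul_comm, Real.exp_mul, Real.exp_log (hpos j hj), Real.rpow_natCast])
      hz (fun j hj => by have := hmz j hj; linarith)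
    have h1 := Real.log_le_log (by positivity) hmp
    rw [Real.log_pow, Real.log_prod (fun j hj => (pow_pos (hmzpos j hj) _).ne')] at h1
    have h2 : Real.log δ ≤ Real.log ‖g z‖ := Real.log_le_log hδ hgz
    have h3 : ∑ j ∈ B, (p j : ℝ) * Real.log ‖mob (ζ j) z‖⁻¹ ≤ P * Real.log δ⁻¹ := by
      simp only [Real.log_pow] at h1
      simp only [Real.log_inv, mul_neg, Finset.sum_neg_distrib]
      have : (P:ℝ) * Real.log δ ≤ P * Real.log ‖g z‖ := by gcongr
      linarith
    refine le_trans ?_ h3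
    rw [hUdef, Finset.mul_sum, Finset.sum_mul, ← Finset.sum_sub_distrib]
    refine Finset.sum_le_sum fun j hj => ?_
    have h4 : 1 / (M * v j) * P * A / C0 - 1 ≤ p j := by
      have := Nat.lt_floor_add_one (1 / (M * v j) * P * A / C0)
      simp only [hp]; linarith
    have h5 : 0 ≤ Real.log ‖mob (ζ j) z‖⁻¹ := Real.log_nonneg
      ((one_le_inv₀ (hmzpos j hj)).2 (mob_norm_lt (hζ1 j hj) hz).le)
    calc _ = (1 / (M * v j) * P * A / C0 - 1) * Real.log ‖mob (ζ j) z‖⁻¹ := by ring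
      _ ≤ _ := by gcongr
  have hUle : A / C0 * U ≤ Real.log δ⁻¹ := by
    by_contra! hc
    obtain ⟨P, hP⟩ := exists_nat_gt ((∑ j ∈ B, Real.log ‖mob (ζ j) z‖⁻¹) /
      (A / C0 * U - Real.log δ⁻¹))
    rw [div_lt_iff₀ (by linarith)] at hP
    have := key P
    nlinarith
  have hUge : B.card * (1 / (18 * M * y)) ≤ U := by
    rw [hUdef, ← nsmul_eq_mul, ← Finset.sum_const]
    refine Finset.sum_le_sum fun j hj => ?_
    have hvj := lt_of_lt_of_le hv0 (hv j hj)
    have hvyj := hvy j hj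
    have h0 := one_sub_conj_mul_ne (hζ1 j hj) hz.le
    have h1 := one_sub_mob_sq h0
    have h2 := log_inv_ge_half (hmzpos j hj)
    have h3 : ‖1 - conj (ζ j) * z‖ ≤ 3 * y := by
      have e1 : 1 - conj (ζ j) * z = ((1 - (1 - v j) * ‖z‖ : ℝ) : ℂ) +
          (((1 - v j) * ‖z‖ : ℝ) : ℂ) * (conj (rtu M j) * (rtu M j - e)) := by
        simp only [hζ, map_mul, Complex.conj_ofReal, mul_sub, rtu_conj_mul]
        conv_lhs => rw [hze]
        push_cast; ring
      have hv1 : 0 ≤ 1 - v j := by linarith [hvd j hj]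
      have hn : 0 ≤ (1 - v j) * ‖z‖ := by positivity
      have hn1 : (1 - v j) * ‖z‖ ≤ 1 := by nlinarith [norm_nonneg z]
      rw [e1]
      refine (norm_add_le _ _).trans ?_
      rw [norm_mul, norm_mul, RCLike.norm_conj, rtu_norm, one_mul, Complex.norm_real,
        Complex.norm_real, Real.norm_of_nonneg hn, Real.norm_of_nonneg (by linarith)]
      have := hje j hj
      have : (1 - v j) * ‖z‖ * ‖rtu M j - e‖ ≤ 1 * y := by gcongr
      have : (1 - v j) * ‖z‖ = 1 - v j - (1 - v j) * y := by rw [hy]; ring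
      nlinarith
    have h0' := norm_pos_iff.2 h0
    have h4 : v j * y / (9 * y ^ 2) ≤ 1 - ‖mob (ζ j) z‖ ^ 2 := by
      rw [h1, hζn j hj]
      have e1 : v j ≤ 1 - (1 - v j) ^ 2 := by nlinarith [hvd j hj]
      have e2 : y ≤ 1 - ‖z‖ ^ 2 := by rw [hy]; nlinarith [norm_nonneg z]
      have e3 : ‖1 - conj (ζ j) * z‖ ^ 2 ≤ 9 * y ^ 2 := by
        calc _ ≤ (3 * y) ^ 2 := by gcongr
          _ = _ := by ring
      refine div_le_div₀ (mul_nonneg (by linarith) (by linarith)) ?_ (by positivity) e3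
      exact mul_le_mul e1 e2 hy0.le (by linarith)
    calc 1 / (18 * M * y) = 1 / (M * v j) * (1 / 2 * (v j * y / (9 * y ^ 2))) := by
          field_simp; norm_num
      _ ≤ _ := by
        gcongr
        linarith
  have h1 : A / C0 * (B.card * (1 / (18 * M * y))) ≤ Real.log δ⁻¹ := le_trans (by gcongr) hUle
  have h2 : B.card * A = A / C0 * (B.card * (1 / (18 * M * y))) * (18 * M * y * C0) :=
    hall_aux_one hM'.ne' hy0.ne' hC0p.ne'
  rw [h2]
  calc _ ≤ Real.log δ⁻¹ * (18 * M * y * C0) := by gcongr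
    _ = _ := by ring

set_option maxHeartbeats 1000000 in
lemma hall_lemma {δ θ : ℝ} (hδ : 0 < δ) (hδ1 : δ ≤ 1) (hθ : 0 < θ) (hθ1 : θ ≤ 1) :
    ∃ ε, 0 < ε ∧ ε ≤ δ / 64 ∧ ∀ v0 : ℝ, 0 < v0 → ∃ M1 : ℕ, ∀ M ≥ M1, ∀ g : ℂ → ℂ, AnaCl g →
      (∀ x, ‖x‖ ≤ 1 → ‖g x‖ ≤ 1) → ∀ z e : ℂ, ‖z‖ < 1 → δ ≤ ‖g z‖ → v0 ≤ 1 - ‖z‖ → ‖e‖ = 1 →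
      z = ‖z‖ * e → ∃ S : Finset ℕ, S ⊆ Finset.range M ∧ M * θ * (1 - ‖z‖) / 200 ≤ S.card ∧
        ∀ j ∈ S, ‖rtu M j - e‖ ≤ θ * (1 - ‖z‖) ∧
          ∀ v : ℝ, v0 ≤ v → v ≤ 1 - ‖z‖ → ε ≤ ‖g (((1 - v : ℝ) : ℂ) * rtu M j)‖ := by
  classical
  set C0 := 600 + 10 * Real.log (12 / (δ / 16)) + 2 / (δ / 16) with hC0
  have hlogδ : 0 ≤ Real.log δ⁻¹ := Real.log_nonneg ((one_le_inv₀ hδ).2 hδ1)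
  have hC0p : 0 < C0 := by
    have : 0 ≤ Real.log (12 / (δ / 16)) :=
      Real.log_nonneg (by rw [le_div_iff₀ (by positivity)]; linarith)
    positivity
  set T := 3600 * C0 * Real.log δ⁻¹ / θ + 1 with hT
  have hTp : 0 < T := by positivity
  refine ⟨min (δ / 64) (Real.exp (-T) / 2), by positivity, min_le_left _ _, fun v0 hv0 => ?_⟩
  set ε := min (δ / 64) (Real.exp (-T) / 2) with hε
  have hε0 : 0 < ε := by positivity
  have hA : T ≤ Real.log (2 * ε)⁻¹ := by
    have : ε ≤ Real.exp (-T) / 2 := min_le_right _ _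
    rw [Real.log_inv, le_neg]
    calc _ ≤ Real.log (Real.exp (-T)) := Real.log_le_log (by positivity) (by linarith)
      _ = _ := Real.log_exp _
  obtain ⟨M1, hM1⟩ := exists_nat_ge ((2 + |2 * Real.log (ε / 2)⁻¹| + 100 / θ) / v0)
  refine ⟨M1, fun M hM g hg hg1 z e hz hgz hvz he hze => ?_⟩
  have hMv : 2 + |2 * Real.log (ε / 2)⁻¹| + 100 / θ ≤ M * v0 := by
    rw [div_le_iff₀ hv0] at hM1
    have : (M1 : ℝ) ≤ M := by exact_mod_cast hM
    nlinarith
  have habs := abs_nonneg (2 * Real.log (ε / 2)⁻¹)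
  have habs' := le_abs_self (2 * Real.log (ε / 2)⁻¹)
  have hθ' : 0 < 100 / θ := by positivity
  set y := 1 - ‖z‖ with hy
  have hy0 : 0 < y := by linarith
  have hy1 : y ≤ 1 := by linarith [norm_nonneg z]
  set J := (Finset.range M).filter (fun j => ‖rtu M j - e‖ ≤ θ * y) with hJ
  have hJc : M * (θ * y) / 100 ≤ J.card := by
    refine rtu_count_ge he (by nlinarith) ?_ J fun j hj hj' => ?_
    · have h1 : 100 / θ ≤ M * v0 := by linarith
      rw [div_le_iff₀ hθ] at h1
      have : (M:ℝ) * v0 ≤ M * y := by gcongr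
      nlinarith
    · exact Finset.mem_filter.2 ⟨Finset.mem_range.2 hj, hj'⟩
  set Bad := J.filter (fun j => ∃ v : ℝ, v0 ≤ v ∧ v ≤ y ∧
    ‖g (((1 - v : ℝ) : ℂ) * rtu M j)‖ < ε) with hBad
  have hex : ∀ j, ∃ v : ℝ, j ∈ Bad → v0 ≤ v ∧ v ≤ y ∧
      ‖g (((1 - v : ℝ) : ℂ) * rtu M j)‖ < ε := by
    intro j
    by_cases h : j ∈ Bad
    · obtain ⟨v, hv⟩ := (Finset.mem_filter.1 h).2
      exact ⟨v, fun _ => hv⟩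
    · exact ⟨0, fun h' => absurd h' h⟩
  choose v hv using hex
  have hBadJ : Bad ⊆ J := Finset.filter_subset _ _
  have hcore := hall_core hδ hδ1 hε0 (min_le_left _ _) hv0 (M := M) (by linarith) (by linarith)
    hg hg1 hz hgz hze Bad (hBadJ.trans (Finset.filter_subset _ _)) v
    (fun j hj => (hv j hj).1) (fun j hj => (hv j hj).2.1)
    (fun j hj => ((Finset.mem_filter.1 (hBadJ hj)).2).trans (by nlinarith))
    (fun j hj => (hv j hj).2.2.le)
  rw [← hy, ← hC0] at hcore
  have hM0 : (0:ℝ) ≤ M := by positivity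
  have hBc : (Bad.card : ℝ) ≤ M * (θ * y) / 200 := by
    have h1 : Bad.card * T ≤ 18 * M * y * C0 * Real.log δ⁻¹ :=
      (mul_le_mul_of_nonneg_left hA (Nat.cast_nonneg _)).trans hcore
    have h2 : 18 * M * y * C0 * Real.log δ⁻¹ = (M * (θ * y) / 200) * (T - 1) := by
      rw [hT]; exact hall_aux_two hθ.ne'
    have h3 : 0 ≤ M * (θ * y) / 200 := by positivity
    have h4 : Bad.card * T ≤ (M * (θ * y) / 200) * T := by
      rw [h2] at h1; linarith
    exact le_of_mul_le_mul_right h4 hTp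
  refine ⟨J \ Bad, Finset.sdiff_subset.trans (Finset.filter_subset _ _), ?_, fun j hj => ?_⟩
  · rw [Finset.cast_card_sdiff hBadJ]
    linarith
  · obtain ⟨hj1, hj2⟩ := Finset.mem_sdiff.1 hj
    refine ⟨(Finset.mem_filter.1 hj1).2, fun w hw1 hw2 => ?_⟩
    by_contra! hc
    exact hj2 (Finset.mem_filter.2 ⟨hj1, w, hw1, hw2, hc⟩)

end

section

open Complex Metric Set
open scoped ComplexConjugate

lemma norm_pow_sub_pow_le_of_le_one {a b : ℂ} (ha : ‖a‖ ≤ 1) (hb : ‖b‖ ≤ 1) (N : ℕ) :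
    ‖a ^ N - b ^ N‖ ≤ N * ‖a - b‖ := by
  induction N with
  | zero => simp
  | succ n ih =>
    have : a ^ (n + 1) - b ^ (n + 1) = a ^ n * (a - b) + (a ^ n - b ^ n) * b := by ring
    rw [this]
    refine (norm_add_le _ _).trans ?_
    rw [norm_mul, norm_mul, norm_pow]
    have h1 := pow_le_one₀ (norm_nonneg a) ha (n := n)
    push_cast
    nlinarith [norm_nonneg (a - b), norm_nonneg (a ^ n - b ^ n),
      mul_le_mul_of_nonneg_right h1 (norm_nonneg (a - b)),
      mul_le_mul_of_nonneg_left hb (norm_nonneg (a ^ n - b ^ n))]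

lemma slit_one_sub_of_lt {w : ℂ} (h : ‖w‖ < 1) : 1 - w ∈ slitPlane := by
  rw [sub_eq_add_neg]
  exact Complex.mem_slitPlane_of_norm_lt_one (by rwa [norm_neg])

/-- A thin neighbourhood of a Lipschitz curve does not fill a disc. -/
lemma exists_value_far {F : ℂ → ℂ} {K R η : ℝ} (hη : 0 < η) (hηK : η ≤ K) (hR : 0 < R)
    (hF : ∀ z w, ‖z‖ = 1 → ‖w‖ = 1 → ‖F z - F w‖ ≤ K * ‖z - w‖) (h : 3200 * K * η < R ^ 2) :
    ∃ μ : ℂ, ‖μ - R‖ ≤ R / 2 ∧ ∀ z, ‖z‖ = 1 → η ≤ ‖F z - μ‖ := by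
  have hK : 0 < K := by linarith
  by_contra! hc
  set J := ⌈100 * K / η⌉₊ with hJ
  have hJ1 : 100 * K / η ≤ J := Nat.le_ceil _
  have hKη : 1 ≤ K / η := by rw [le_div_iff₀ hη]; linarith
  have e1 : 100 * K / η = 100 * (K / η) := by ring
  have hJ2 : (J:ℝ) ≤ 200 * (K / η) := by
    have := Nat.ceil_lt_add_one (show 0 ≤ 100 * K / η by positivity)
    rw [← hJ, e1] at this
    linarith
  rw [e1] at hJ1
  have hJ0 : (0:ℝ) < J := by linarith
  have hcov : closedBall (R : ℂ) (R / 2) ⊆ ⋃ j ∈ Finset.range J, ball (F (rtu J j)) (2 * η) := by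
    intro μ hμ
    rw [mem_closedBall, dist_eq_norm] at hμ
    obtain ⟨z, hz, hzμ⟩ := hc μ hμ
    have : ∃ j < J, ‖rtu J j - z‖ ≤ 100 / J := by
      by_contra! hno
      have := rtu_count_ge hz (τ := 100 / J) (M := J) (by rw [div_le_one hJ0]; linarith)
        (by rw [mul_div_cancel₀ _ hJ0.ne']) ∅ (fun j hj hj' => absurd hj' (not_le.2 (hno j hj)))
      rw [mul_div_cancel₀ _ hJ0.ne'] at this
      norm_num at this
    obtain ⟨j, hj, hjz⟩ := this
    simp only [mem_iUnion, mem_ball, dist_eq_norm]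
    refine ⟨j, Finset.mem_range.2 hj, ?_⟩
    have h1 := hF z (rtu J j) hz (rtu_norm J j)
    have h2 : K * ‖z - rtu J j‖ ≤ η := by
      rw [norm_sub_rev]
      calc _ ≤ K * (100 / J) := by gcongr
        _ ≤ η := by
          rw [mul_div_assoc', div_le_iff₀ hJ0]
          have : 100 * (K / η) * η = 100 * K := by field_simp
          nlinarith
    have h3 := norm_add_le (μ - F z) (F z - F (rtu J j))
    rw [sub_add_sub_cancel, norm_sub_rev μ (F z)] at h3
    linarith
  have hvol := (MeasureTheory.measure_mono hcov (μ := MeasureTheory.volume)).trans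
    (MeasureTheory.measure_biUnion_finset_le _ _)
  simp only [Complex.volume_ball, Complex.volume_closedBall, Finset.sum_const, Finset.card_range,
    nsmul_eq_mul] at hvol
  have hpi : (0:ℝ) < Real.pi := Real.pi_pos
  have e2 : ENNReal.ofReal (R / 2) ^ 2 * (NNReal.pi : ENNReal) =
      ENNReal.ofReal ((R / 2) ^ 2 * Real.pi) := by
    rw [ENNReal.ofReal_mul (by positivity), ENNReal.ofReal_pow (by positivity)]
    congr 1
    rw [← NNReal.coe_real_pi, ENNReal.ofReal_coe_nnreal]
  have e3 : (J : ENNReal) * (ENNReal.ofReal (2 * η) ^ 2 * (NNReal.pi : ENNReal)) =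
      ENNReal.ofReal (J * ((2 * η) ^ 2 * Real.pi)) := by
    rw [ENNReal.ofReal_mul (Nat.cast_nonneg J), ENNReal.ofReal_mul (sq_nonneg _),
      ENNReal.ofReal_pow (by positivity) 2, ENNReal.ofReal_natCast]
    congr 2
    rw [← NNReal.coe_real_pi, ENNReal.ofReal_coe_nnreal]
  rw [e2, e3, ENNReal.ofReal_le_ofReal_iff (by positivity)] at hvol
  have h4 : (J:ℝ) * η ^ 2 ≤ 200 * K * η := by
    calc (J:ℝ) * η ^ 2 ≤ 200 * (K / η) * η ^ 2 := by gcongr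
      _ = _ := by field_simp
  have h5 : (R / 2) ^ 2 * Real.pi ≤ (800 * K * η) * Real.pi := by
    refine hvol.trans ?_
    rw [← mul_assoc]
    refine mul_le_mul_of_nonneg_right ?_ hpi.le
    linarith
  have := le_of_mul_le_mul_right h5 hpi
  linarith

/-- Inner-outer factorization of a product of linear factors without zeros on the circle. -/
lemma multiset_inner_outer (s : Multiset ℂ) (hs : ∀ a ∈ s, ‖a‖ ≠ 1) :
    ∃ (m : ℕ) (zs : Fin m → ℂ) (L : ℂ → ℂ), m ≤ s.card ∧ (∀ k, ‖zs k‖ < 1 ∧ zs k ∈ s) ∧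
      AnaCl L ∧ ∀ z, ‖z‖ ≤ 1 → (s.map (fun a => z - a)).prod = exp (L z) * ∏ k, mob (zs k) z := by
  induction s using Multiset.induction_on with
  | empty => exact ⟨0, Fin.elim0, fun _ => 0, by simp, fun k => k.elim0,
      fun z _ => analyticAt_const, by simp⟩
  | cons a s ih =>
    obtain ⟨m, zs, L, hm, hzs, hL, hprod⟩ := ih fun b hb => hs b (Multiset.mem_cons_of_mem hb)
    have ha := hs a (Multiset.mem_cons_self a s)
    rcases lt_or_gt_of_ne ha with h | h
    · refine ⟨m + 1, Fin.snoc zs a, fun z => L z + log (1 - conj a * z), by simpa using hm, ?_, ?_,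
        ?_⟩
      · intro k
        refine Fin.lastCases ?_ (fun i => ?_) k
        · simpa using h
        · simpa using ⟨(hzs i).1, Or.inr (hzs i).2⟩
      · intro z hz
        have hz' : ‖z‖ ≤ 1 := by simpa using hz
        refine (hL z hz).add (AnalyticAt.clog (by fun_prop) ?_)
        refine slit_one_sub_of_lt ?_
        rw [norm_mul, RCLike.norm_conj]
        nlinarith [norm_nonneg z, norm_nonneg a]
      · intro z hz
        have h0 := one_sub_conj_mul_ne h hz
        rw [Multiset.map_cons, Multiset.prod_cons, hprod z hz, Fin.prod_univ_castSucc]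
        simp only [Fin.snoc_castSucc, Fin.snoc_last]
        have h1 : mob a z * (1 - conj a * z) = z - a := div_mul_cancel₀ _ h0
        rw [exp_add, exp_log h0]
        linear_combination (-(cexp (L z) * ∏ k, mob (zs k) z)) * h1
    · have ha0 : a ≠ 0 := by rintro rfl; norm_num at h
      refine ⟨m, zs, fun z => L z + (log (-a) + log (1 - z / a)), ?_, ?_, ?_, ?_⟩
      · rw [Multiset.card_cons]; omega
      · exact fun k => ⟨(hzs k).1, Multiset.mem_cons_of_mem (hzs k).2⟩
      · intro z hz
        have hz' : ‖z‖ ≤ 1 := by simpa using hz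
        refine (hL z hz).add (analyticAt_const.add (AnalyticAt.clog (by fun_prop) ?_))
        refine slit_one_sub_of_lt ?_
        rw [norm_div, div_lt_one (by linarith)]; linarith
      · intro z hz
        have h1 : 1 - z / a ≠ 0 := by
          rw [sub_ne_zero]
          intro h1
          rw [eq_div_iff ha0, one_mul] at h1
          rw [h1] at h; linarith
        rw [Multiset.map_cons, Multiset.prod_cons, hprod z hz, exp_add, exp_add, exp_log h1,
          exp_log (neg_ne_zero.2 ha0)]
        field_simp
        ring

lemma polynomial_inner_outer (p : Polynomial ℂ) (hp : ∀ z, ‖z‖ = 1 → p.eval z ≠ 0) :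
    ∃ (m : ℕ) (zs : Fin m → ℂ) (L : ℂ → ℂ), m ≤ p.natDegree ∧
      (∀ k, ‖zs k‖ < 1 ∧ p.eval (zs k) = 0) ∧
      AnaCl L ∧ ∀ z, ‖z‖ ≤ 1 → p.eval z = exp (L z) * ∏ k, mob (zs k) z := by
  have hp0 : p ≠ 0 := by rintro rfl; exact hp 1 (by simp) (by simp)
  obtain ⟨m, zs, L, hm, hzs, hL, hprod⟩ := multiset_inner_outer p.roots (fun a ha h =>
    hp a h ((Polynomial.mem_roots hp0).1 ha))
  refine ⟨m, zs, fun z => log p.leadingCoeff + L z, hm.trans (Polynomial.card_roots' p),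
    fun k => ⟨(hzs k).1, (Polynomial.mem_roots hp0).1 (hzs k).2⟩,
    fun z hz => analyticAt_const.add (hL z hz), fun z hz => ?_⟩
  conv_lhs => rw [(IsAlgClosed.splits p).eq_prod_roots]
  rw [Polynomial.eval_mul, Polynomial.eval_C, Polynomial.eval_multiset_prod, Multiset.map_map,
    exp_add, exp_log (Polynomial.leadingCoeff_ne_zero.2 hp0), mul_assoc, ← hprod z hz]
  congr 3
  ext a; simp


lemma rtu_prod_ne {M i : ℕ} (hi : i < M) :
    ∏ j ∈ (Finset.range M).erase i, ‖rtu M i - rtu M j‖ = M := by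
  have hM : M ≠ 0 := by omega
  have h := rtu_prod_eq hM
  rw [eq_comm, ← Finset.mul_prod_erase _ _ (Finset.mem_range.2 hi)] at h
  have h1 := congrArg (fun p => Polynomial.eval (rtu M i) (Polynomial.derivative p)) h
  simp only [Polynomial.derivative_mul, Polynomial.derivative_sub, Polynomial.derivative_X,
    Polynomial.derivative_C, Polynomial.derivative_X_pow, Polynomial.derivative_one, sub_zero,
    one_mul, Polynomial.eval_add, Polynomial.eval_mul, Polynomial.eval_prod, Polynomial.eval_sub,
    Polynomial.eval_X, Polynomial.eval_C, sub_self, zero_mul, add_zero, Polynomial.eval_pow] at h1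
  have h2 := congrArg norm h1
  rw [norm_prod] at h2
  simpa [rtu_norm] using h2

lemma prod_sub_rtu {N : ℕ} (hN : N ≠ 0) {l : ℂ} (hl : l ≠ 0) (x : ℂ) :
    ∏ i : Fin N, (x - l * rtu N i) = x ^ N - l ^ N := by
  have h := congrArg (Polynomial.eval (x / l)) (rtu_prod_eq hN)
  simp only [Polynomial.eval_prod, Polynomial.eval_sub, Polynomial.eval_X, Polynomial.eval_C,
    Polynomial.eval_pow, Polynomial.eval_one] at h
  rw [Finset.prod_range] at h
  have h1 : ∀ i : Fin N, x - l * rtu N i = l * (x / l - rtu N i) := fun i => by field_simp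
  simp_rw [h1]
  rw [Finset.prod_mul_distrib, ← h]
  simp only [Finset.prod_const, Finset.card_univ, Fintype.card_fin, div_pow]
  field_simp

/-- Counting estimate for the zeros of `f ^ N - l ^ N`. -/
lemma sources_count {p : ℂ → ℂ} {N : ℕ} (hN : N ≠ 0) (hp : ∀ z, ‖z‖ ≤ 1 → ‖p z‖ ≤ 1)
    {l : ℂ} {r : ℝ} (hr : 0 < r) (hr1 : r ≤ 1 / 2) (hl : r / 2 ≤ ‖l‖) (hl1 : ‖l‖ ≤ 1)
    (m : Fin N → ℕ) (hm : ∀ i, m i ≤ N) (zs : ∀ i, Fin (m i) → ℂ) (hzs : ∀ i k, ‖zs i k‖ < 1)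
    (L : Fin N → ℂ → ℂ) (hL : ∀ i, AnaCl (L i))
    (hfac : ∀ (i : Fin N) z, ‖z‖ ≤ 1 → p z - l * rtu N i = exp (L i z) * ∏ k, mob (zs i k) z)
    {w : ℂ} (hw : ‖w‖ < 1) :
    ∑ i, ∑ k, (1 - ‖mob (zs i k) w‖ ^ 2) ≤ (1 + 2 * Real.log (8 / r)) * (N : ℝ) := by
  classical
  have hln : ∀ i : Fin N, ‖l * rtu N i‖ = ‖l‖ := fun i => by rw [norm_mul, rtu_norm, mul_one]
  have hbl : ∀ i : Fin N, ‖p w - l * rtu N i‖ ≤ 2 * ∏ k, ‖mob (zs i k) w‖ := by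
    intro i
    have h1 : (L i w).re ≤ Real.log 2 := by
      refine max_principle_re (hL i) (fun z hz => ?_) hw.le
      rw [Real.le_log_iff_exp_le two_pos, ← Complex.norm_exp]
      have h2 := congrArg norm (hfac i z hz.le)
      rw [norm_mul, norm_prod, Finset.prod_eq_one fun k _ => mob_norm_one (hzs i k) hz,
        mul_one] at h2
      rw [← h2]
      refine (norm_sub_le _ _).trans ?_
      rw [hln]
      linarith [hp z hz.le]
    rw [hfac i w hw.le, norm_mul, norm_prod, Complex.norm_exp]
    rw [Real.le_log_iff_exp_le two_pos] at h1
    gcongr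
  have hNpos : 0 < N := Nat.pos_of_ne_zero hN
  obtain ⟨i0, -, hi0⟩ := Finset.exists_min_image (Finset.univ : Finset (Fin N))
    (fun i => ‖p w - l * rtu N i‖) ⟨⟨0, hNpos⟩, Finset.mem_univ _⟩
  have hl0 : 0 < ‖l‖ := by linarith
  have hfar : ∀ i : Fin N, ‖l‖ * ‖rtu N i0 - rtu N i‖ ≤ 2 * ‖p w - l * rtu N i‖ := by
    intro i
    rw [← norm_mul]
    have h1 := norm_sub_le (p w - l * rtu N i) (p w - l * rtu N i0)
    have h2 := hi0 i (Finset.mem_univ _)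
    have h3 : l * (rtu N i0 - rtu N i) = p w - l * rtu N i - (p w - l * rtu N i0) := by ring
    rw [h3]; linarith
  have hpr : ∏ i ∈ Finset.univ.erase i0, ‖rtu N i0 - rtu N i‖ = N := by
    rw [← rtu_prod_ne i0.2]
    refine Finset.prod_bij (fun i _ => (i : ℕ)) ?_ ?_ ?_ ?_
    · intro i hi
      simp only [Finset.mem_erase, Finset.mem_univ, and_true, Finset.mem_range] at hi ⊢
      exact ⟨fun h => hi (Fin.ext h), i.2⟩
    · intro i _ j _ h; exact Fin.ext h
    · intro b hb
      simp only [Finset.mem_erase, Finset.mem_range] at hb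
      exact ⟨⟨b, hb.2⟩, by simpa [Fin.ext_iff] using hb.1, rfl⟩
    · intros; rfl
  have hne : ∀ i ∈ Finset.univ.erase i0, 0 < ‖rtu N i0 - rtu N i‖ := by
    intro i hi
    by_contra! hc
    have h0 : ‖rtu N i0 - rtu N i‖ = 0 := le_antisymm hc (norm_nonneg _)
    rw [Finset.prod_eq_zero hi h0] at hpr
    exact hN (by exact_mod_cast hpr.symm)
  have hgrp : ∀ i ∈ Finset.univ.erase i0, ∑ k, (1 - ‖mob (zs i k) w‖ ^ 2) ≤
      2 * (Real.log (8 / r) - Real.log ‖rtu N i0 - rtu N i‖) := by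
    intro i hi
    have h1 := hne i hi
    have h2 : 0 < ∏ k, ‖mob (zs i k) w‖ := by
      have := hfar i; have := hbl i
      have : 0 < ‖l‖ * ‖rtu N i0 - rtu N i‖ := by positivity
      linarith
    have h3 : ∀ k, 0 < ‖mob (zs i k) w‖ := by
      intro k
      rcases (norm_nonneg (mob (zs i k) w)).eq_or_lt with h | h
      · rw [Finset.prod_eq_zero (Finset.mem_univ k) h.symm] at h2; exact absurd h2 (lt_irrefl _)
      · exact h
    have h4 : ∑ k, (1 - ‖mob (zs i k) w‖ ^ 2) ≤ -(2 * Real.log (∏ k, ‖mob (zs i k) w‖)) := by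
      rw [Real.log_prod (fun k _ => (h3 k).ne'), Finset.mul_sum, ← Finset.sum_neg_distrib]
      refine Finset.sum_le_sum fun k _ => ?_
      have := log_inv_ge_half (h3 k)
      rw [Real.log_inv] at this
      linarith
    have h5 : r / 8 * ‖rtu N i0 - rtu N i‖ ≤ ∏ k, ‖mob (zs i k) w‖ := by
      have := hfar i; have := hbl i
      nlinarith
    have h6 := Real.log_le_log (by positivity) h5
    rw [Real.log_mul (by positivity) h1.ne'] at h6
    have h7 : Real.log (r / 8) = - Real.log (8 / r) := by rw [← Real.log_inv, inv_div]
    linarith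
  have h80 : 0 ≤ Real.log (8 / r) := Real.log_nonneg (by rw [le_div_iff₀ hr]; linarith)
  rw [← Finset.add_sum_erase _ _ (Finset.mem_univ i0)]
  have hA : ∑ k, (1 - ‖mob (zs i0 k) w‖ ^ 2) ≤ (N : ℝ) := by
    calc _ ≤ ∑ k : Fin (m i0), (1:ℝ) :=
          Finset.sum_le_sum fun k _ => by nlinarith [norm_nonneg (mob (zs i0 k) w)]
      _ = m i0 := by simp
      _ ≤ N := by exact_mod_cast hm i0
  have hB := Finset.sum_le_sum hgrp
  rw [← Finset.mul_sum, Finset.sum_sub_distrib, ← Real.log_prod (fun i hi => (hne i hi).ne'), hpr,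
    Finset.sum_const, Finset.card_erase_of_mem (Finset.mem_univ _), Finset.card_univ,
    Fintype.card_fin, nsmul_eq_mul] at hB
  have hlogN : 0 ≤ Real.log N := Real.log_nonneg (by exact_mod_cast hNpos)
  have hcN : ((N - 1 : ℕ) : ℝ) ≤ N := by exact_mod_cast Nat.sub_le _ _
  have : ((N - 1 : ℕ) : ℝ) * Real.log (8 / r) ≤ N * Real.log (8 / r) := by gcongr
  linarith

/-- Approximation of the modulus of `f` by finitely many Blaschke factors. -/
lemma exists_sources {r : ℝ} (hr : 0 < r) (hr1 : r ≤ 1 / 2) :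
    ∃ C : ℝ, 0 < C ∧ ∀ f : Polynomial ℂ, (∀ z, ‖z‖ ≤ 1 → ‖f.eval z‖ ≤ 1) →
      ∃ (N : ℕ) (μ : ℂ) (ι : Type) (_ : Fintype ι) (zs : ι → ℂ) (L : ℂ → ℂ), N ≠ 0 ∧
        ‖μ - (r ^ N : ℝ)‖ ≤ r ^ N / 2 ∧ (∀ k, ‖zs k‖ < 1 ∧ f.eval (zs k) ^ N = μ) ∧ AnaCl L ∧
        (∀ z, ‖z‖ ≤ 1 → f.eval z ^ N - μ = exp (L z) * ∏ k, mob (zs k) z) ∧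
        (∀ z, ‖z‖ ≤ 1 → |(L z).re| ≤ C * N) ∧
        ∀ w, ‖w‖ < 1 → ∑ k, (1 - ‖mob (zs k) w‖ ^ 2) ≤ C * N := by
  have hr2 : 0 < r ^ 2 / 2 := by positivity
  have hlr : 0 ≤ -Real.log (r ^ 2 / 2) := by
    have := Real.log_nonpos hr2.le (by nlinarith)
    linarith
  have h80 : 0 ≤ Real.log (8 / r) := Real.log_nonneg (by rw [le_div_iff₀ hr]; linarith)
  refine ⟨1 + 2 * Real.log (8 / r) + -Real.log (r ^ 2 / 2), by positivity, fun f hf => ?_⟩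
  -- Lipschitz constant
  obtain ⟨K, hK1, hK⟩ : ∃ K : ℝ, 1 ≤ K ∧ ∀ z w, ‖z‖ ≤ 1 → ‖w‖ ≤ 1 →
      ‖f.eval z - f.eval w‖ ≤ K * ‖z - w‖ := by
    obtain ⟨K, hK⟩ := (isCompact_closedBall (0:ℂ) 1).exists_bound_of_continuousOn
      (f := fun z => f.derivative.eval z) (by fun_prop)
    refine ⟨max K 1, le_max_right _ _, fun z w hz hw => ?_⟩
    refine (convex_closedBall (0:ℂ) 1).norm_image_sub_le_of_norm_hasDerivWithin_le
      (f := fun z => f.eval z) (f' := fun z => f.derivative.eval z)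
      (fun x _ => (f.hasDerivAt x).hasDerivWithinAt) (fun x hx => (hK x hx).trans (le_max_left _ _))
      (by simpa using hw) (by simpa using hz)
  obtain ⟨N, hNdeg, hN⟩ : ∃ N : ℕ, f.natDegree + 1 ≤ N ∧ 3200 * K * N < 2 ^ N := by
    have h1 := tendsto_pow_const_div_const_pow_of_one_lt 1 (show (1:ℝ) < 2 by norm_num)
    have h2 := h1.eventually (gt_mem_nhds (show (0:ℝ) < 1 / (3200 * K) by positivity))
    obtain ⟨N, hN1, hN2⟩ := (h2.and (Filter.eventually_ge_atTop (f.natDegree + 1))).exists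
    refine ⟨N, hN2, ?_⟩
    rw [pow_one, div_lt_div_iff₀ (by positivity) (by positivity)] at hN1
    linarith
  have hN0 : N ≠ 0 := by omega
  have hN1 : (1:ℝ) ≤ N := by exact_mod_cast Nat.one_le_iff_ne_zero.2 hN0
  have hη : (r ^ 2 / 2) ^ N ≤ N * K := by
    have : (r ^ 2 / 2) ^ N ≤ 1 := pow_le_one₀ hr2.le (by nlinarith)
    nlinarith
  obtain ⟨μ, hμ, hfar⟩ := exists_value_far (F := fun z => f.eval z ^ N) (K := N * K)
    (R := r ^ N) (η := (r ^ 2 / 2) ^ N) (by positivity) hη (by positivity)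
    (fun z w hz hw => by
      refine (norm_pow_sub_pow_le_of_le_one (hf z hz.le) (hf w hw.le) N).trans ?_
      rw [mul_assoc]
      gcongr
      exact hK z w hz.le hw.le) (by
      rw [div_pow, mul_div_assoc', div_lt_iff₀ (by positivity), ← pow_mul, ← pow_mul, mul_comm N 2]
      have : 0 < r ^ (2 * N) := by positivity
      nlinarith)
  have hrN : 0 < r ^ N := by positivity
  have hμ1 : r ^ N / 2 ≤ ‖μ‖ := by
    have := norm_sub_norm_le ((r ^ N : ℝ) : ℂ) μ
    rw [Complex.norm_real, Real.norm_of_nonneg hrN.le, norm_sub_rev] at this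
    linarith
  have hμ2 : ‖μ‖ ≤ 3 / 2 * r ^ N := by
    have := norm_sub_norm_le μ ((r ^ N : ℝ) : ℂ)
    rw [Complex.norm_real, Real.norm_of_nonneg hrN.le] at this
    linarith
  have hμ0 : μ ≠ 0 := norm_pos_iff.1 (by linarith)
  obtain ⟨l, hl⟩ := IsAlgClosed.exists_pow_nat_eq μ (Nat.pos_of_ne_zero hN0)
  have hl0 : l ≠ 0 := by rintro rfl; rw [zero_pow hN0] at hl; exact hμ0 hl.symm
  have hln : ‖l‖ ^ N = ‖μ‖ := by rw [← norm_pow, hl]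
  have hl1 : r / 2 ≤ ‖l‖ := by
    refine le_of_pow_le_pow_left₀ hN0 (norm_nonneg l) ?_
    rw [hln, div_pow]
    refine le_trans ?_ hμ1
    gcongr
    exact le_self_pow₀ (by norm_num) hN0
  have hl2 : ‖l‖ ≤ 1 := by
    refine le_of_pow_le_pow_left₀ hN0 zero_le_one ?_
    rw [hln, one_pow]
    refine hμ2.trans ?_
    have : r ^ N ≤ r := pow_le_of_le_one hr.le (by linarith) hN0
    linarith
  have hprod := fun x => prod_sub_rtu hN0 hl0 x
  rw [hl] at hprod
  have hne : ∀ (i : Fin N) z, ‖z‖ = 1 → (f - Polynomial.C (l * rtu N i)).eval z ≠ 0 := by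
    intro i z hz h0
    have h1 := hprod (f.eval z)
    have h2 := hfar z hz
    rw [Finset.prod_eq_zero (Finset.mem_univ i) (by simpa using h0)] at h1
    simp only [← h1, norm_zero] at h2
    have : 0 < (r ^ 2 / 2) ^ N := by positivity
    linarith
  choose m zs L hm hzs hL hfac using fun i => polynomial_inner_outer _ (hne i)
  have hfac' : ∀ (i : Fin N) z, ‖z‖ ≤ 1 → f.eval z - l * rtu N i = exp (L i z) * ∏ k, mob (zs i k) z := by
    intro i z hz
    rw [← hfac i z hz]; simp
  have hF : ∀ z, ‖z‖ ≤ 1 → f.eval z ^ N - μ =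
      exp (∑ i, L i z) * ∏ k : (Σ i : Fin N, Fin (m i)), mob (zs k.1 k.2) z := by
    intro z hz
    rw [← hprod, exp_sum, Fintype.prod_sigma, ← Finset.prod_mul_distrib]
    exact Finset.prod_congr rfl fun i _ => hfac' i z hz
  have hLs : AnaCl (fun z => ∑ i, L i z) := by
    intro z hz
    exact Finset.analyticAt_fun_sum _ fun i _ => hL i z hz
  refine ⟨N, μ, Σ i : Fin N, Fin (m i), inferInstance, fun k => zs k.1 k.2, fun z => ∑ i, L i z,
    hN0, by simpa using hμ, ?_, hLs, hF, ?_, ?_⟩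
  · rintro ⟨i, k⟩
    refine ⟨(hzs i k).1, ?_⟩
    have h1 := (hzs i k).2
    rw [Polynomial.eval_sub, Polynomial.eval_C, sub_eq_zero] at h1
    show f.eval (zs i k) ^ N = μ
    rw [h1, mul_pow, rtu_pow hN0, mul_one, hl]
  · have hT : ∀ z, ‖z‖ = 1 → Real.exp (∑ i, L i z).re = ‖f.eval z ^ N - μ‖ := by
      intro z hz
      rw [hF z hz.le, norm_mul, norm_prod, Finset.prod_eq_one fun k _ => mob_norm_one (hzs _ _).1 hz,
        mul_one, Complex.norm_exp]
    intro z hz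
    rw [abs_le]
    constructor
    · have := max_principle_re (L := fun z => -∑ i, L i z) (C := N * -Real.log (r ^ 2 / 2))
        (fun z hz => (hLs z hz).neg) (fun w hw => by
          rw [Complex.neg_re, mul_neg, neg_le_neg_iff, ← Real.log_pow,
            Real.log_le_iff_le_exp (by positivity), hT w hw]
          exact hfar w hw) hz
      rw [Complex.neg_re] at this
      nlinarith
    · have := max_principle_re hLs (C := 1) (fun w hw => by
          have h1 : (∑ i, L i w).re ≤ Real.log 2 := by
            rw [Real.le_log_iff_exp_le two_pos, hT w hw]
            refine (norm_sub_le _ _).trans ?_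
            rw [norm_pow]
            have := pow_le_one₀ (norm_nonneg _) (hf w hw.le) (n := N)
            have : ‖μ‖ ≤ 1 := by rw [← hln]; exact pow_le_one₀ (norm_nonneg _) hl2
            linarith
          have := Real.log_two_lt_d9
          linarith) hz
      nlinarith
  · intro w hw
    rw [Fintype.sum_sigma]
    refine (sources_count hN0 hf hr hr1 hl1 hl2 m (fun i => (hm i).trans ?_) zs
      (fun i k => (hzs i k).1) L hL hfac' hw).trans ?_
    · rw [Polynomial.natDegree_sub_C]; omega
    · exact mul_le_mul_of_nonneg_right (by linarith) (by linarith)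

end

section

open Complex Metric Set
open scoped ComplexConjugate

lemma norm_eq_one_sub {e : ℂ} (he : ‖e‖ = 1) {v : ℝ} (hv : v ≤ 1) :
    ‖((1 - v : ℝ) : ℂ) * e‖ = 1 - v := by
  rw [norm_mul, he, mul_one, Complex.norm_real, Real.norm_of_nonneg (by linarith)]

lemma norm_one_sub_conj_ofReal_mul {e w : ℂ} (he : ‖e‖ = 1) (t : ℝ) :
    ‖1 - conj ((t : ℂ) * e) * w‖ = ‖e - t * w‖ := by
  have h : e * conj e = 1 := by
    rw [Complex.mul_conj, Complex.normSq_eq_norm_sq, he]; simp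
  have : e - t * w = e * (1 - conj ((t : ℂ) * e) * w) := by
    rw [map_mul, Complex.conj_ofReal]
    linear_combination ((t : ℂ) * w) * h
  rw [this, norm_mul, he, one_mul]

lemma one_sub_mob_sq_le {e w : ℂ} (he : ‖e‖ = 1) (hw : ‖w‖ < 1) {v : ℝ} (hv : 0 < v)
    (hv1 : v ≤ 1) : 1 - ‖mob (((1 - v : ℝ) : ℂ) * e) w‖ ^ 2 ≤
      36 * (1 - ‖w‖) * (v / (‖e - w‖ + v) ^ 2) := by
  have hn := norm_eq_one_sub he hv1
  have hne := one_sub_conj_mul_ne (a := ((1 - v : ℝ) : ℂ) * e) (by rw [hn]; linarith) hw.le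
  rw [one_sub_mob_sq hne, hn]
  have h1 : v ≤ ‖1 - conj (((1 - v : ℝ) : ℂ) * e) * w‖ := by
    have := one_sub_conj_mul_norm (a := ((1 - v : ℝ) : ℂ) * e) hw.le
    rw [hn] at this; linarith
  have h2 : ‖e - w‖ - v ≤ ‖1 - conj (((1 - v : ℝ) : ℂ) * e) * w‖ := by
    rw [norm_one_sub_conj_ofReal_mul he]
    have e1 : e - w = e - ((1 - v : ℝ) : ℂ) * w - ((v : ℝ) : ℂ) * w := by push_cast; ring
    have e2 := norm_sub_le (e - ((1 - v : ℝ) : ℂ) * w) ((v : ℂ) * w)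
    rw [← e1, norm_mul, Complex.norm_real, Real.norm_of_nonneg hv.le] at e2
    nlinarith
  have hX := norm_nonneg (e - w)
  have h3 : (‖e - w‖ + v) / 3 ≤ ‖1 - conj (((1 - v : ℝ) : ℂ) * e) * w‖ := by linarith
  have h0 : 0 < ‖e - w‖ + v := by linarith
  calc _ ≤ (1 - (1 - v) ^ 2) * (1 - ‖w‖ ^ 2) / ((‖e - w‖ + v) / 3) ^ 2 := by
        have : 0 ≤ (1 - (1 - v) ^ 2) * (1 - ‖w‖ ^ 2) :=
          mul_nonneg (by nlinarith) (by nlinarith [norm_nonneg w])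
        gcongr
    _ ≤ (2 * v) * (2 * (1 - ‖w‖)) / ((‖e - w‖ + v) / 3) ^ 2 := by
        have : 0 ≤ (1 - ‖w‖ ^ 2) := by nlinarith [norm_nonneg w]
        gcongr
        · nlinarith
        · nlinarith [norm_nonneg w]
    _ = _ := by field_simp; ring

lemma geometric_telescope {X s y : ℝ} (hX : 0 ≤ X) (hs : 0 < s) (hs1 : s < 1) (hy : 0 < y) (n : ℕ) :
    ∑ i ∈ Finset.range n, s * (y * (1 - s) ^ (i + 1) / (X + y * (1 - s) ^ (i + 1)) ^ 2) ≤
      1 / (X + y * (1 - s) ^ n) - 1 / (X + y) := by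
  induction n with
  | zero => simp
  | succ n ih =>
    rw [Finset.sum_range_succ]
    have hp : 0 < y * (1 - s) ^ n := by
      have : 0 < 1 - s := by linarith
      positivity
    have hps : y * (1 - s) ^ (n + 1) = (1 - s) * (y * (1 - s) ^ n) := by ring
    rw [hps]
    set p := y * (1 - s) ^ n
    have h1s : 0 < 1 - s := by linarith
    have hb : 0 < X + (1 - s) * p := by positivity
    have key : s * ((1 - s) * p / (X + (1 - s) * p) ^ 2) ≤
        1 / (X + (1 - s) * p) - 1 / (X + p) := by
      have : 1 / (X + (1 - s) * p) - 1 / (X + p) = s * p / ((X + (1 - s) * p) * (X + p)) := by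
        field_simp; ring
      rw [this, mul_div_assoc', div_le_div_iff₀ (by positivity) (by positivity)]
      have : 0 ≤ s * p * (X + (1 - s) * p) := by positivity
      nlinarith [mul_nonneg this (mul_nonneg hs.le hX)]
    linarith

lemma radial_sum_le {e w : ℂ} (he : ‖e‖ = 1) (hw : ‖w‖ < 1) {s y vs : ℝ} (hs : 0 < s)
    (hs1 : s < 1) (hy : 0 < y) (hy1 : y ≤ 1) (n : ℕ) (hv0 : 0 < vs) (hvs : vs ≤ y * (1 - s) ^ n) :
    ∑ i ∈ Finset.range n,
      s * (1 - ‖mob (((1 - y * (1 - s) ^ (i + 1) : ℝ) : ℂ) * e) w‖ ^ 2) ≤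
      36 * (1 - ‖w‖) * (y / ((‖e - w‖ + vs) * (‖e - w‖ + y))) := by
  have h1s : 0 < 1 - s := by linarith
  have hX := norm_nonneg (e - w)
  have hw0 : 0 ≤ 1 - ‖w‖ := by linarith
  calc _ ≤ ∑ i ∈ Finset.range n, 36 * (1 - ‖w‖) *
        (s * (y * (1 - s) ^ (i + 1) / (‖e - w‖ + y * (1 - s) ^ (i + 1)) ^ 2)) := by
        refine Finset.sum_le_sum fun i _ => ?_
        have := one_sub_mob_sq_le he hw (v := y * (1 - s) ^ (i + 1)) (by positivity)
          (mul_le_one₀ hy1 (by positivity) (pow_le_one₀ h1s.le (by linarith)))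
        calc _ ≤ s * _ := mul_le_mul_of_nonneg_left this hs.le
          _ = _ := by ring
    _ ≤ 36 * (1 - ‖w‖) * (1 / (‖e - w‖ + y * (1 - s) ^ n) - 1 / (‖e - w‖ + y)) := by
        rw [← Finset.mul_sum]
        exact mul_le_mul_of_nonneg_left (geometric_telescope hX hs hs1 hy n) (by positivity)
    _ ≤ _ := by
        refine mul_le_mul_of_nonneg_left ?_ (by positivity)
        have h1 : 1 / (‖e - w‖ + y * (1 - s) ^ n) ≤ 1 / (‖e - w‖ + vs) := by gcongr
        have h2 : y / ((‖e - w‖ + vs) * (‖e - w‖ + y)) =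
            1 / (‖e - w‖ + vs) - 1 / (‖e - w‖ + y) + vs / ((‖e - w‖ + vs) * (‖e - w‖ + y)) := by
          field_simp; ring
        have h3 : 0 ≤ vs / ((‖e - w‖ + vs) * (‖e - w‖ + y)) := by positivity
        linarith

lemma lateral_le {z a w : ℂ} (hz : ‖z‖ < 1) (hw : ‖w‖ < 1) (ha : ‖a‖ < 1)
    (h : ‖a - z‖ ≤ 1 / 4 * (1 - ‖z‖)) :
    1 - ‖mob a w‖ ^ 2 ≤ 5 * (1 - ‖mob z w‖ ^ 2) := by
  have hna := one_sub_conj_mul_ne ha hw.le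
  have hnz := one_sub_conj_mul_ne hz hw.le
  rw [one_sub_mob_sq hna, one_sub_mob_sq hnz]
  have h1 := one_sub_conj_mul_norm (a := z) hw.le
  have h2 : 3 / 4 * ‖1 - conj z * w‖ ≤ ‖1 - conj a * w‖ := by
    have e1 : 1 - conj z * w = 1 - conj a * w + conj (a - z) * w := by rw [map_sub]; ring
    have e2 := norm_add_le (1 - conj a * w) (conj (a - z) * w)
    rw [← e1, norm_mul, RCLike.norm_conj] at e2
    nlinarith [norm_nonneg (a - z), norm_nonneg w]
  have hp : 0 < ‖1 - conj z * w‖ := norm_pos_iff.2 hnz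
  have h3 : 1 - ‖a‖ ≤ 5 / 4 * (1 - ‖z‖) := by
    have := norm_sub_norm_le z a
    rw [norm_sub_rev] at this; linarith
  have hwp : 0 ≤ 1 - ‖w‖ ^ 2 := by nlinarith [norm_nonneg w]
  have h4 : 1 - ‖a‖ ^ 2 ≤ 5 / 2 * (1 - ‖z‖ ^ 2) := by
    nlinarith [norm_nonneg a, norm_nonneg z]
  have hzp : 0 ≤ 1 - ‖z‖ ^ 2 := by nlinarith [norm_nonneg z]
  calc _ ≤ (5 / 2 * (1 - ‖z‖ ^ 2)) * (1 - ‖w‖ ^ 2) / (3 / 4 * ‖1 - conj z * w‖) ^ 2 := by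
        gcongr
    _ = 40 / 9 * ((1 - ‖z‖ ^ 2) * (1 - ‖w‖ ^ 2) / ‖1 - conj z * w‖ ^ 2) := by
        field_simp; ring
    _ ≤ _ := by
        have : 0 ≤ (1 - ‖z‖ ^ 2) * (1 - ‖w‖ ^ 2) / ‖1 - conj z * w‖ ^ 2 := by positivity
        linarith

/-- Node `i` of the path from `z` to the circle: first sideways, then radially towards `e'`. -/
noncomputable def path (z e e' : ℂ) (s : ℝ) (n₁ i : ℕ) : ℂ :=
  if i ≤ n₁ then (‖z‖ : ℂ) * (((1 - i / n₁ : ℝ) : ℂ) * e + ((i / n₁ : ℝ) : ℂ) * e')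
  else ((1 - (1 - ‖z‖) * (1 - s) ^ (i - n₁) : ℝ) : ℂ) * e'

lemma path_zero {z e e' : ℂ} {s : ℝ} {n₁ : ℕ} (hz : z = ‖z‖ * e) : path z e e' s n₁ 0 = z := by
  simp [path, ← hz]

lemma path_radial {z e e' : ℂ} {s : ℝ} {n₁ : ℕ} (hn : n₁ ≠ 0) (i : ℕ) :
    path z e e' s n₁ (n₁ + i) = ((1 - (1 - ‖z‖) * (1 - s) ^ i : ℝ) : ℂ) * e' := by
  unfold path
  rcases Nat.eq_zero_or_pos i with rfl | hi
  · have : (n₁ : ℝ) ≠ 0 := by exact_mod_cast hn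
    rw [if_pos (by simp), add_zero, div_self this]
    simp
  · rw [if_neg (by omega), Nat.add_sub_cancel_left]

lemma path_lateral_sub {z e e' : ℂ} {s : ℝ} {n₁ i : ℕ} (hi : i ≤ n₁) (hz : z = ‖z‖ * e) :
    path z e e' s n₁ i - z = ((i / n₁ : ℝ) : ℂ) * (‖z‖ * (e' - e)) := by
  rw [path, if_pos hi]
  nth_rewrite 2 [hz]
  push_cast; ring

lemma path_lateral_norm_le {z e e' : ℂ} {s : ℝ} {n₁ i : ℕ} (hi : i ≤ n₁)
    (he : ‖e‖ = 1) (he' : ‖e'‖ = 1) : ‖path z e e' s n₁ i‖ ≤ ‖z‖ := by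
  have h1 : (i / n₁ : ℝ) ≤ 1 := div_le_one_of_le₀ (by exact_mod_cast hi) (by positivity)
  rw [path, if_pos hi, norm_mul, Complex.norm_real, norm_norm]
  refine mul_le_of_le_one_right (norm_nonneg z) ((norm_add_le _ _).trans ?_)
  rw [norm_mul, norm_mul, he, he', Complex.norm_real, Complex.norm_real,
    Real.norm_of_nonneg (by linarith), Real.norm_of_nonneg (by positivity)]
  linarith

lemma path_lateral_dist {z e e' : ℂ} {s θ : ℝ} {n₁ i : ℕ} (hi : i ≤ n₁) (hz : z = ‖z‖ * e)
    (hz1 : ‖z‖ ≤ 1) (h : ‖e' - e‖ ≤ θ * (1 - ‖z‖)) :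
    ‖path z e e' s n₁ i - z‖ ≤ θ * (1 - ‖z‖) := by
  have h1 : (i / n₁ : ℝ) ≤ 1 := div_le_one_of_le₀ (by exact_mod_cast hi) (by positivity)
  have h0 : 0 ≤ (i / n₁ : ℝ) := by positivity
  rw [path_lateral_sub hi hz, norm_mul, norm_mul, Complex.norm_real, Complex.norm_real,
    Real.norm_of_nonneg h0, norm_norm]
  calc _ ≤ 1 * (1 * ‖e' - e‖) := by gcongr
    _ ≤ _ := by linarith

lemma path_step {z e e' : ℂ} {s σ θ : ℝ} {n₁ i : ℕ} (hn : n₁ ≠ 0) (hz : z = ‖z‖ * e)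
    (hz1 : ‖z‖ < 1) (he : ‖e‖ = 1) (he' : ‖e'‖ = 1) (h : ‖e' - e‖ ≤ θ * (1 - ‖z‖))
    (hθ : θ ≤ σ * n₁) (hs : 0 < s) (hs2 : s ≤ 1 / 2) (hσ : σ = 2 * s) :
    ‖path z e e' s n₁ i - path z e e' s n₁ (i + 1)‖ ≤ σ * (1 - ‖path z e e' s n₁ (i + 1)‖) := by
  have hn' : (0:ℝ) < n₁ := by positivity
  rcases lt_or_ge i n₁ with hi | hi
  · have h1 := path_lateral_norm_le (z := z) (s := s) (i := i + 1) hi he he'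
    have h2 : path z e e' s n₁ i - path z e e' s n₁ (i + 1) =
        -(((1 / n₁ : ℝ) : ℂ) * (‖z‖ * (e' - e))) := by
      rw [← sub_sub_sub_cancel_right _ _ z, path_lateral_sub hi.le hz, path_lateral_sub hi hz]
      push_cast; ring
    rw [h2, norm_neg, norm_mul, norm_mul, Complex.norm_real, Complex.norm_real,
      Real.norm_of_nonneg (by positivity), norm_norm]
    calc _ ≤ 1 / (n₁:ℝ) * (1 * (σ * n₁ * (1 - ‖z‖))) := by
          gcongr
          exact h.trans (mul_le_mul_of_nonneg_right hθ (by linarith))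
      _ = σ * (1 - ‖z‖) := by field_simp
      _ ≤ _ := by
          have : 0 ≤ σ := by rw [hσ]; positivity
          gcongr
  · obtain ⟨k, rfl⟩ := Nat.exists_eq_add_of_le hi
    have hp : 0 < (1 - ‖z‖) * (1 - s) ^ k := by
      have : 0 < 1 - ‖z‖ := by linarith
      have : 0 < 1 - s := by linarith
      positivity
    have hp1 : (1 - ‖z‖) * (1 - s) ^ (k + 1) ≤ 1 :=
      mul_le_one₀ (by linarith [norm_nonneg z])
        (pow_nonneg (by linarith) _) (pow_le_one₀ (by linarith) (by linarith))
    rw [add_assoc, path_radial hn, path_radial hn, norm_eq_one_sub he' hp1, ← sub_mul, norm_mul, he',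
      mul_one, ← Complex.ofReal_sub, Complex.norm_real]
    have e1 : 1 - (1 - ‖z‖) * (1 - s) ^ k - (1 - (1 - ‖z‖) * (1 - s) ^ (k + 1)) =
        -(s * ((1 - ‖z‖) * (1 - s) ^ k)) := by ring
    rw [e1, norm_neg, Real.norm_of_nonneg (by positivity), hσ, pow_succ]
    nlinarith [mul_pos hs hp]

/-- The Carleson estimate for the nodes of a single path. -/
lemma path_sum_le {z e e' w : ℂ} {s σ vs : ℝ} {n₁ n : ℕ} (hn : n₁ ≠ 0) (hz : z = ‖z‖ * e)
    (hz1 : ‖z‖ < 1) (he : ‖e‖ = 1) (he' : ‖e'‖ = 1) (h : ‖e' - e‖ ≤ 1 / 4 * (1 - ‖z‖))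
    (hθ : σ * n₁ ≤ 2) (hs : 0 < s) (hs2 : s ≤ 1 / 2) (hσ : σ = 2 * s) (hv0 : 0 < vs)
    (hvs : vs ≤ (1 - ‖z‖) * (1 - s) ^ n) (hw : ‖w‖ < 1) :
    ∑ i ∈ Finset.range (n₁ + n), σ * (1 - ‖mob (path z e e' s n₁ (i + 1)) w‖ ^ 2) ≤
      10 * (1 - ‖mob z w‖ ^ 2) + 72 * (1 - ‖w‖) *
        ((1 - ‖z‖) / ((‖e' - w‖ + vs) * (‖e' - w‖ + (1 - ‖z‖)))) := by
  rw [Finset.sum_range_add]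
  have hσ0 : 0 ≤ σ := by rw [hσ]; positivity
  have hm : 0 ≤ 1 - ‖mob z w‖ ^ 2 := by
    have := mob_norm_le hz1 hw.le
    nlinarith [norm_nonneg (mob z w)]
  refine add_le_add ?_ ?_
  · calc _ ≤ ∑ i ∈ Finset.range n₁, σ * (5 * (1 - ‖mob z w‖ ^ 2)) := by
          refine Finset.sum_le_sum fun i hi => mul_le_mul_of_nonneg_left ?_ hσ0
          have hi' : i + 1 ≤ n₁ := Finset.mem_range.1 hi
          exact lateral_le hz1 hw ((path_lateral_norm_le hi' he he').trans_lt hz1)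
            (path_lateral_dist hi' hz hz1.le h)
      _ = (σ * n₁) * (5 * (1 - ‖mob z w‖ ^ 2)) := by
          rw [Finset.sum_const, Finset.card_range, nsmul_eq_mul]; ring
      _ ≤ 2 * (5 * (1 - ‖mob z w‖ ^ 2)) := by gcongr
      _ = _ := by ring
  · have := radial_sum_le he' hw hs (by linarith) (show 0 < 1 - ‖z‖ by linarith)
      (by linarith [norm_nonneg z]) n hv0 hvs
    calc _ = 2 * ∑ i ∈ Finset.range n, s *
          (1 - ‖mob (((1 - (1 - ‖z‖) * (1 - s) ^ (i + 1) : ℝ) : ℂ) * e') w‖ ^ 2) := by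
          rw [Finset.mul_sum]
          refine Finset.sum_congr rfl fun i _ => ?_
          rw [add_assoc, path_radial hn, hσ]; ring
      _ ≤ _ := by linarith

end

section

open Complex Metric Set
open scoped ComplexConjugate

lemma mob_one_sub_sq_ge {z e e' w : ℂ} (hz : z = ‖z‖ * e) (hz1 : ‖z‖ < 1) (he : ‖e‖ = 1)
    (h : ‖e' - e‖ ≤ 1 / 4 * (1 - ‖z‖)) (hw : ‖w‖ < 1) {B : ℝ}
    (hB : ‖e' - w‖ + 5 / 4 * (1 - ‖z‖) ≤ B) :
    (1 - ‖z‖) * (1 - ‖w‖) / B ^ 2 ≤ 1 - ‖mob z w‖ ^ 2 := by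
  have hne := one_sub_conj_mul_ne hz1 hw.le
  rw [one_sub_mob_sq hne]
  have h1 : ‖1 - conj z * w‖ ≤ B := by
    refine le_trans ?_ hB
    have e1 := norm_one_sub_conj_ofReal_mul (w := w) he ‖z‖
    rw [← hz] at e1
    rw [e1]
    have e2 : e - ‖z‖ * w = (e' - w) - (e' - e) + ((1 - ‖z‖ : ℝ) : ℂ) * w := by push_cast; ring
    rw [e2]
    refine (norm_add_le _ _).trans ?_
    have e3 := norm_sub_le (e' - w) (e' - e)
    rw [norm_mul, Complex.norm_real, Real.norm_of_nonneg (by linarith)]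
    nlinarith [norm_nonneg w]
  have hp := norm_pos_iff.2 hne
  have h2 : 0 ≤ 1 - ‖w‖ := by linarith
  have h3 : 0 ≤ 1 - ‖z‖ := by linarith
  have h4 : 1 - ‖z‖ ≤ 1 - ‖z‖ ^ 2 := by nlinarith [norm_nonneg z]
  have h5 : 1 - ‖w‖ ≤ 1 - ‖w‖ ^ 2 := by nlinarith [norm_nonneg w]
  calc _ ≤ (1 - ‖z‖) * (1 - ‖w‖) / ‖1 - conj z * w‖ ^ 2 := by gcongr
    _ ≤ _ := by gcongr; exact h3.trans h4

lemma sum_inv_height_le {ι : Type*} (A : Finset ι) {z e : ι → ℂ} {D : ℝ} {e' : ℂ}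
    (he' : ‖e'‖ = 1) (hD : ∀ w, ‖w‖ < 1 → ∑ k ∈ A, (1 - ‖mob (z k) w‖ ^ 2) ≤ D)
    (hz : ∀ k, z k = ‖z k‖ * e k) (hz1 : ∀ k, ‖z k‖ < 1) (he : ∀ k, ‖e k‖ = 1)
    (h : ∀ k ∈ A, ‖e' - e k‖ ≤ 1 / 4 * (1 - ‖z k‖)) {X : ℝ} (hX : 0 < X) (hD0 : 0 ≤ D)
    (hA : ∀ k ∈ A, X ≤ 1 - ‖z k‖) : ∑ k ∈ A, 1 / (1 - ‖z k‖) ≤ 8 * D / X := by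
  rcases A.eq_empty_or_nonempty with rfl | ⟨k0, hk0⟩
  · simp; positivity
  have hX1 : X ≤ 1 := (hA k0 hk0).trans (by linarith [norm_nonneg (z k0)])
  have hn := norm_eq_one_sub he' (v := X / 2) (by linarith)
  have hw : ‖((1 - X / 2 : ℝ) : ℂ) * e'‖ < 1 := by rw [hn]; linarith
  have h1 := hD _ hw
  have h2 : ∀ k ∈ A, X / 8 * (1 / (1 - ‖z k‖)) ≤
      1 - ‖mob (z k) (((1 - X / 2 : ℝ) : ℂ) * e')‖ ^ 2 := by
    intro k hk
    have hy : 0 < 1 - ‖z k‖ := by linarith [hz1 k]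
    have hd : ‖e' - ((1 - X / 2 : ℝ) : ℂ) * e'‖ = X / 2 := by
      have : e' - ((1 - X / 2 : ℝ) : ℂ) * e' = ((X / 2 : ℝ) : ℂ) * e' := by push_cast; ring
      rw [this, norm_mul, he', mul_one, Complex.norm_real, Real.norm_of_nonneg (by linarith)]
    refine le_trans (le_of_eq ?_) (mob_one_sub_sq_ge (hz k) (hz1 k) (he k) (h k hk) hw
      (B := 2 * (1 - ‖z k‖)) (by rw [hd]; linarith [hA k hk]))
    rw [hn]
    field_simp; ring
  have h3 := (Finset.sum_le_sum h2).trans h1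
  rw [← Finset.mul_sum] at h3
  rw [le_div_iff₀ hX]
  linarith

/-- The double sum over all paths in the Carleson estimate. -/
lemma carleson_double_sum {ι : Type*} [Fintype ι] {z e : ι → ℂ} {S : ι → Finset ℕ} {M : ℕ}
    {N C θ vs : ℝ} (hN : 0 < N) (hC0 : 0 ≤ C) (hθ : 0 < θ)
    (hC : ∀ w, ‖w‖ < 1 → ∑ k, (1 - ‖mob (z k) w‖ ^ 2) ≤ C * N)
    (hz : ∀ k, z k = ‖z k‖ * e k) (hz1 : ∀ k, ‖z k‖ < 1) (he : ∀ k, ‖e k‖ = 1)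
    (hS : ∀ k, S k ⊆ Finset.range M) (hcard : ∀ k, M * θ * (1 - ‖z k‖) / 200 ≤ (S k).card)
    (hnear : ∀ k, ∀ j ∈ S k, ‖rtu M j - e k‖ ≤ 1 / 4 * (1 - ‖z k‖))
    (hM : M ≠ 0) (hv0 : 0 < vs) (hv1 : vs ≤ 1) (hMv : 1 / (M : ℝ) ≤ vs)
    (hvs : ∀ k, vs ≤ 1 - ‖z k‖) {w : ℂ} (hw : ‖w‖ < 1) :
    ∑ k, ∑ j ∈ S k, 1 / (N * (S k).card) * ((1 - ‖w‖) *
        ((1 - ‖z k‖) / ((‖rtu M j - w‖ + vs) * (‖rtu M j - w‖ + (1 - ‖z k‖))))) ≤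
      C * (9 + 6400 / θ) := by
  classical
  have hM' : (0:ℝ) < M := by positivity
  have hy : ∀ k, 0 < 1 - ‖z k‖ := fun k => by linarith [hz1 k]
  have hc0 : ∀ k, (0:ℝ) < (S k).card := fun k => lt_of_lt_of_le
    (by have := hy k; positivity) (hcard k)
  have hw0 : 0 < 1 - ‖w‖ := by linarith
  have hm0 : ∀ k, 0 ≤ 1 - ‖mob (z k) w‖ ^ 2 := fun k => by
    have := mob_norm_le (hz1 k) hw.le
    nlinarith [norm_nonneg (mob (z k) w)]
  have hX : ∀ j, 0 < ‖rtu M j - w‖ + vs := fun j => by positivity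
  have hpt : ∀ k, ∀ j ∈ S k, (1 - ‖w‖) *
        ((1 - ‖z k‖) / ((‖rtu M j - w‖ + vs) * (‖rtu M j - w‖ + (1 - ‖z k‖)))) ≤
      9 * (1 - ‖mob (z k) w‖ ^ 2) +
        if ‖rtu M j - w‖ + vs ≤ 1 - ‖z k‖ then (1 - ‖w‖) / (‖rtu M j - w‖ + vs) else 0 := by
    intro k j hj
    have hy := hy k
    have hX := hX j
    have hX0 := norm_nonneg (rtu M j - w)
    split_ifs with hc
    · have h1 : (1 - ‖z k‖) / ((‖rtu M j - w‖ + vs) * (‖rtu M j - w‖ + (1 - ‖z k‖))) ≤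
          1 / (‖rtu M j - w‖ + vs) := by
        rw [div_le_div_iff₀ (by positivity) hX]
        nlinarith
      have h2 := mul_le_mul_of_nonneg_left h1 hw0.le
      rw [mul_one_div] at h2
      linarith [hm0 k]
    · push Not at hc
      have h1 := mob_one_sub_sq_ge (hz k) (hz1 k) (he k) (hnear k j hj) hw
        (B := 3 * (‖rtu M j - w‖ + vs)) (by linarith)
      have h2 : (1 - ‖z k‖) / ((‖rtu M j - w‖ + vs) * (‖rtu M j - w‖ + (1 - ‖z k‖))) ≤
          (1 - ‖z k‖) / ((‖rtu M j - w‖ + vs) * (‖rtu M j - w‖ + vs)) := by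
        gcongr
        exact hvs k
      rw [add_zero]
      calc _ ≤ (1 - ‖w‖) * ((1 - ‖z k‖) / ((‖rtu M j - w‖ + vs) * (‖rtu M j - w‖ + vs))) := by
            gcongr
        _ = 9 * ((1 - ‖z k‖) * (1 - ‖w‖) / (3 * (‖rtu M j - w‖ + vs)) ^ 2) := by
            field_simp; norm_num
        _ ≤ _ := by gcongr
  have hwt : ∀ k, 1 / (N * (S k).card) ≤ 200 / (N * M * θ) * (1 / (1 - ‖z k‖)) := by
    intro k
    have hy := hy k
    have hc := hc0 k
    calc 1 / (N * (S k).card) ≤ 1 / (N * (M * θ * (1 - ‖z k‖) / 200)) := by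
          have := hcard k
          gcongr
      _ = _ := by field_simp
  have hin : ∀ j ∈ Finset.range M, ∑ k ∈ Finset.univ.filter (fun k => j ∈ S k ∧
      ‖rtu M j - w‖ + vs ≤ 1 - ‖z k‖), 1 / (1 - ‖z k‖) ≤
        8 * (C * N) / (‖rtu M j - w‖ + vs) := by
    intro j _
    refine sum_inv_height_le _ (rtu_norm M j) (fun w' hw' => ?_) hz hz1 he
      (fun k hk => hnear k j (Finset.mem_filter.1 hk).2.1) (hX j) (by positivity)
      (fun k hk => (Finset.mem_filter.1 hk).2.2)
    refine le_trans (Finset.sum_le_sum_of_subset_of_nonneg (Finset.subset_univ _)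
      fun k _ _ => ?_) (hC w' hw')
    have := mob_norm_le (hz1 k) hw'.le
    nlinarith [norm_nonneg (mob (z k) w')]
  have hsq : ∑ j ∈ Finset.range M, (1 - ‖w‖) / (‖rtu M j - w‖ + vs) ^ 2 ≤ 4 * (M : ℝ) := by
    have hn : ‖((1 - vs : ℝ) : ℂ) * w‖ = (1 - vs) * ‖w‖ := by
      rw [norm_mul, Complex.norm_real, Real.norm_of_nonneg (by linarith)]
    have h1 : vs ≤ 1 - ‖((1 - vs : ℝ) : ℂ) * w‖ := by
      rw [hn]; nlinarith [norm_nonneg w]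
    have h2 : 1 - ‖w‖ ≤ 1 - ‖((1 - vs : ℝ) : ℂ) * w‖ := by
      rw [hn]; nlinarith [norm_nonneg w]
    have h3 := rtu_sum_inv_sq hM (hMv.trans h1)
    calc _ ≤ ∑ j ∈ Finset.range M, (1 - ‖w‖) * (1 / ‖rtu M j - ((1 - vs : ℝ) : ℂ) * w‖ ^ 2) := by
          refine Finset.sum_le_sum fun j _ => ?_
          rw [mul_one_div]
          have hp := rtu_sub_ne (M := M) (j := j) (w := ((1 - vs : ℝ) : ℂ) * w) (by linarith)
          have : ‖rtu M j - ((1 - vs : ℝ) : ℂ) * w‖ ≤ ‖rtu M j - w‖ + vs := by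
            have e1 : rtu M j - ((1 - vs : ℝ) : ℂ) * w = (rtu M j - w) + ((vs : ℝ) : ℂ) * w := by
              push_cast; ring
            rw [e1]
            refine (norm_add_le _ _).trans ?_
            rw [norm_mul, Complex.norm_real, Real.norm_of_nonneg hv0.le]
            nlinarith
          gcongr
      _ ≤ (1 - ‖w‖) * (4 * M / (1 - ‖((1 - vs : ℝ) : ℂ) * w‖)) := by
          rw [← Finset.mul_sum]; gcongr
      _ ≤ (1 - ‖w‖) * (4 * M / (1 - ‖w‖)) := by gcongr
      _ = 4 * M := by field_simp
  have hcN : ∀ m c : ℝ, 0 < c → 9 * m / N = c * (1 / (N * c) * (9 * m)) := by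
    intro m c hc
    field_simp
  calc _ ≤ ∑ k, ∑ j ∈ S k, 1 / (N * (S k).card) * (9 * (1 - ‖mob (z k) w‖ ^ 2) +
        if ‖rtu M j - w‖ + vs ≤ 1 - ‖z k‖ then (1 - ‖w‖) / (‖rtu M j - w‖ + vs) else 0) := by
        refine Finset.sum_le_sum fun k _ => Finset.sum_le_sum fun j hj => ?_
        exact mul_le_mul_of_nonneg_left (hpt k j hj) (one_div_nonneg.2 (mul_pos hN (hc0 k)).le)
    _ = (∑ k, 9 * (1 - ‖mob (z k) w‖ ^ 2) / N) + ∑ k, ∑ j ∈ S k, 1 / (N * (S k).card) *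
        (if ‖rtu M j - w‖ + vs ≤ 1 - ‖z k‖ then (1 - ‖w‖) / (‖rtu M j - w‖ + vs) else 0) := by
        simp_rw [mul_add, Finset.sum_add_distrib]
        congr 1
        refine Finset.sum_congr rfl fun k _ => ?_
        rw [Finset.sum_const, nsmul_eq_mul]
        exact (hcN _ _ (hc0 k)).symm
    _ ≤ 9 * C + ∑ k, ∑ j ∈ Finset.range M, if j ∈ S k ∧ ‖rtu M j - w‖ + vs ≤ 1 - ‖z k‖ then
        200 / (N * M * θ) * (1 / (1 - ‖z k‖)) * ((1 - ‖w‖) / (‖rtu M j - w‖ + vs)) else 0 := by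
        refine add_le_add ?_ (Finset.sum_le_sum fun k _ => ?_)
        · rw [← Finset.sum_div, ← Finset.mul_sum, div_le_iff₀ hN]
          linarith [hC w hw]
        · have e1 : ∀ j, (if j ∈ S k ∧ ‖rtu M j - w‖ + vs ≤ 1 - ‖z k‖ then
              200 / (N * M * θ) * (1 / (1 - ‖z k‖)) * ((1 - ‖w‖) / (‖rtu M j - w‖ + vs)) else 0) =
              if j ∈ S k then (if ‖rtu M j - w‖ + vs ≤ 1 - ‖z k‖ then
              200 / (N * M * θ) * (1 / (1 - ‖z k‖)) * ((1 - ‖w‖) / (‖rtu M j - w‖ + vs)) else 0)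
              else 0 := fun j => by rw [ite_and]
          simp_rw [e1]
          rw [← Finset.sum_filter, Finset.filter_mem_eq_inter,
            Finset.inter_eq_right.2 (hS k)]
          refine Finset.sum_le_sum fun j _ => ?_
          split_ifs
          · exact mul_le_mul_of_nonneg_right (hwt k) (div_nonneg hw0.le (hX j).le)
          · rw [mul_zero]
    _ ≤ 9 * C + ∑ j ∈ Finset.range M, 1600 * C / (M * θ) *
        ((1 - ‖w‖) / (‖rtu M j - w‖ + vs) ^ 2) := by
        rw [Finset.sum_comm]
        refine add_le_add le_rfl (Finset.sum_le_sum fun j hj => ?_)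
        have hX := hX j
        rw [← Finset.sum_filter, ← Finset.sum_mul, ← Finset.mul_sum]
        calc _ ≤ 200 / (N * M * θ) * (8 * (C * N) / (‖rtu M j - w‖ + vs)) *
              ((1 - ‖w‖) / (‖rtu M j - w‖ + vs)) := by
              have := hin j hj
              gcongr
          _ = _ := by field_simp; ring
    _ ≤ 9 * C + 1600 * C / (M * θ) * (4 * M) := by
        rw [← Finset.mul_sum]; gcongr
    _ = _ := by field_simp; ring

end

section

open Complex Metric Set
open scoped ComplexConjugate

lemma mob_norm_le_of_dist {a z : ℂ} {θ : ℝ} (ha : ‖a‖ < 1) (hz : ‖z‖ ≤ 1)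
    (h : ‖z - a‖ ≤ θ * (1 - ‖a‖)) : ‖mob a z‖ ≤ θ := by
  have h1 := one_sub_conj_mul_norm (a := a) hz
  have h2 : 0 < 1 - ‖a‖ := by linarith
  rw [mob, norm_div, div_le_iff₀ (h2.trans_le h1)]
  have h3 : 0 ≤ θ := by
    by_contra hc
    have := mul_neg_of_neg_of_pos (not_le.1 hc) h2
    linarith [norm_nonneg (z - a)]
  exact h.trans (mul_le_mul_of_nonneg_left h1 h3)

lemma exists_pos_le_of_fintype {ι : Type*} [Fintype ι] (f : ι → ℝ) (hf : ∀ k, 0 < f k) :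
    ∃ v, 0 < v ∧ v ≤ 1 ∧ ∀ k, v ≤ f k := by
  have h0 : 0 ≤ ∑ k, (f k)⁻¹ := Finset.sum_nonneg fun k _ => (inv_pos.2 (hf k)).le
  refine ⟨(1 + ∑ k, (f k)⁻¹)⁻¹, by positivity, inv_le_one_of_one_le₀ (by linarith), fun k => ?_⟩
  refine inv_le_of_inv_le₀ (hf k) ?_
  have := Finset.single_le_sum (f := fun k => (f k)⁻¹) (fun k _ => (inv_pos.2 (hf k)).le)
    (Finset.mem_univ k)
  linarith

lemma path_end_norm {z e e' : ℂ} {s : ℝ} {n₁ : ℕ} (hn : n₁ ≠ 0) (hz1 : ‖z‖ ≤ 1) (he' : ‖e'‖ = 1)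
    (hs : 0 ≤ s) (hs1 : s ≤ 1) (i : ℕ) :
    1 - ‖path z e e' s n₁ (n₁ + i)‖ = (1 - ‖z‖) * (1 - s) ^ i := by
  rw [path_radial hn, norm_eq_one_sub he']
  · ring
  · have h1 : (1 - s) ^ i ≤ 1 := pow_le_one₀ (by linarith) (by linarith)
    have h2 : 0 ≤ (1 - s) ^ i := pow_nonneg (by linarith) i
    nlinarith [norm_nonneg z]

/-- Along a path every node keeps `‖g‖` bounded below. -/
lemma path_norm_ge {g : ℂ → ℂ} (hg : AnaCl g) (hg1 : ∀ z, ‖z‖ ≤ 1 → ‖g z‖ ≤ 1) {z e e' : ℂ}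
    {s θ ε δ vs : ℝ} {n₁ n : ℕ} (hn : n₁ ≠ 0) (hz : z = ‖z‖ * e) (hz1 : ‖z‖ < 1) (he : ‖e‖ = 1)
    (he' : ‖e'‖ = 1) (h : ‖e' - e‖ ≤ θ * (1 - ‖z‖)) (hs : 0 ≤ s) (hs1 : s ≤ 1)
    (hδ : δ ≤ ‖g z‖) (hε : ε + 2 * θ ≤ δ) (hvs : vs ≤ (1 - ‖z‖) * (1 - s) ^ n)
    (hlow : ∀ v : ℝ, vs ≤ v → v ≤ 1 - ‖z‖ → ε ≤ ‖g (((1 - v : ℝ) : ℂ) * e')‖)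
    {i : ℕ} (hi : i ≤ n₁ + n) : ε ≤ ‖g (path z e e' s n₁ i)‖ := by
  have hy : 0 ≤ 1 - ‖z‖ := by linarith
  rcases le_total i n₁ with hi' | hi'
  · have h1 := path_lateral_dist (s := s) hi' hz hz1.le h
    have h2 := (path_lateral_norm_le (z := z) (s := s) hi' he he').trans hz1.le
    have h3 := norm_sub_le_mob hg hg1 hz1 h2
    have h4 := mob_norm_le_of_dist hz1 h2 h1
    have h5 := norm_sub_norm_le (g z) (g z - g (path z e e' s n₁ i))
    rw [sub_sub_cancel] at h5
    rw [norm_sub_rev] at h3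
    linarith
  · obtain ⟨k, rfl⟩ := Nat.exists_eq_add_of_le hi'
    rw [path_radial hn]
    have h1 : (1 - s) ^ n ≤ (1 - s) ^ k :=
      pow_le_pow_of_le_one (by linarith) (by linarith) (by omega)
    refine hlow _ (hvs.trans (mul_le_mul_of_nonneg_left h1 hy)) ?_
    exact mul_le_of_le_one_right hy (pow_le_one₀ (by linarith) (by linarith))

lemma path_norm_lt {z e e' : ℂ} {s : ℝ} {n₁ : ℕ} (hn : n₁ ≠ 0) (hz1 : ‖z‖ < 1) (he : ‖e‖ = 1)
    (he' : ‖e'‖ = 1) (hs : 0 ≤ s) (hs1 : s < 1) (i : ℕ) : ‖path z e e' s n₁ i‖ < 1 := by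
  rcases le_total i n₁ with hi' | hi'
  · exact (path_lateral_norm_le hi' he he').trans_lt hz1
  · obtain ⟨k, rfl⟩ := Nat.exists_eq_add_of_le hi'
    have h1 := path_end_norm (e := e) hn hz1.le he' hs hs1.le k
    have h2 : 0 < (1 - ‖z‖) * (1 - s) ^ k := mul_pos (by linarith) (pow_pos (by linarith) k)
    linarith

lemma exists_direction (z : ℂ) : ∃ e : ℂ, ‖e‖ = 1 ∧ z = ‖z‖ * e := by
  rcases eq_or_ne z 0 with rfl | h
  · exact ⟨1, by simp, by simp⟩
  · have : (‖z‖ : ℂ) ≠ 0 := by simpa using h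
    exact ⟨z / ‖z‖, by simp [h], by field_simp⟩

lemma exists_step_constants {ε θ C1 : ℝ} (hε : 0 < ε) (hθ : 0 < θ) (hθ1 : θ ≤ 1) :
    ∃ σ s : ℝ, ∃ n₁ : ℕ, 0 < σ ∧ 2 * σ + 4 * Real.exp (2 * C1) * σ / ε ≤ 1 / 4 ∧ σ = 2 * s ∧
      0 < s ∧ s ≤ 1 / 2 ∧ n₁ ≠ 0 ∧ θ ≤ σ * n₁ ∧ σ * n₁ ≤ 2 := by
  have hp : 0 < 2 + 4 * Real.exp (2 * C1) / ε := by positivity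
  have hp2 : 2 ≤ 2 + 4 * Real.exp (2 * C1) / ε := by
    have : 0 ≤ 4 * Real.exp (2 * C1) / ε := by positivity
    linarith
  set A := 2 + 4 * Real.exp (2 * C1) / ε with hA
  have hσ : 0 < 1 / (4 * A) := by positivity
  have hσ1 : 1 / (4 * A) ≤ 1 / 8 := one_div_le_one_div_of_le (by norm_num) (by linarith)
  have e1 : 2 * (1 / (4 * A)) + 4 * Real.exp (2 * C1) * (1 / (4 * A)) / ε = A * (1 / (4 * A)) := by
    rw [hA]; ring
  set σ := 1 / (4 * A) with hσd
  have e2 : A * σ = 1 / 4 := by rw [hσd]; field_simp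
  have hq : 0 < θ / σ := by positivity
  refine ⟨σ, σ / 2, ⌈θ / σ⌉₊, hσ, by rw [e1, e2], by ring, by linarith, by linarith,
    (Nat.ceil_pos.2 hq).ne', ?_, ?_⟩
  · have := Nat.le_ceil (θ / σ)
    rwa [div_le_iff₀' hσ] at this
  · have := (Nat.ceil_lt_add_one hq.le).le
    calc _ ≤ σ * (θ / σ + 1) := by gcongr
      _ = θ + σ := by field_simp
      _ ≤ 2 := by linarith

lemma card_mul_weight {c N x : ℝ} (hc : c ≠ 0) : c * (1 / (N * c) * x) = 1 / N * x := by
  field_simp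

lemma weight_sum_eq {c N t ε : ℝ} : c * (1 / N * (t / ε)) = (c * t) / (ε * N) := by
  field_simp

theorem exists_potential {δ C : ℝ} (hδ : 0 < δ) (hδ1 : δ ≤ 1) (hC0 : 0 < C) :
    ∃ C2 ε : ℝ, 0 < C2 ∧ 0 < ε ∧ ε ≤ 1 ∧ ∀ (g : ℂ → ℂ), AnaCl g → (∀ z, ‖z‖ ≤ 1 → ‖g z‖ ≤ 1) →
      ∀ K : ℝ, (∀ z w, ‖z‖ ≤ 1 → ‖w‖ ≤ 1 → ‖g z - g w‖ ≤ K * ‖z - w‖) →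
      ∀ (N : ℕ) (ι : Type) [Fintype ι] (zs : ι → ℂ), N ≠ 0 → (∀ k, ‖zs k‖ < 1) →
      (∀ k, δ ≤ ‖g (zs k)‖) → (∀ w, ‖w‖ < 1 → ∑ k, (1 - ‖mob (zs k) w‖ ^ 2) ≤ C * N) →
      ∃ Λ : ℂ → ℂ, AnaCl Λ ∧ (∀ z, ‖z‖ ≤ 1 → |(Λ z).re| ≤ C2) ∧
        ∃ ξ : ℂ → ℂ, (∀ x, ‖x‖ < 1 → ‖g x‖ < ε → AnalyticAt ℂ ξ x) ∧
          ∀ x, ‖x‖ < 1 → ‖g x‖ < ε → ‖ξ x‖ ≤ C2 * ‖g x‖ ∧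
            (Λ x - ξ x).re = 1 / (N : ℝ) * ∑ k, Real.log ‖mob (zs k) x‖ := by
  classical
  set θ := δ / 4 with hθd
  have hθ : 0 < θ := by positivity
  have hθ4 : θ ≤ 1 / 4 := by linarith
  obtain ⟨ε, hε, hεδ, hall⟩ := hall_lemma hδ hδ1 hθ (by linarith)
  set C1 := C * (10 + 72 * (9 + 6400 / θ)) with hC1
  obtain ⟨σ, s, n₁, hσ, hσ4, hσs, hs, hs2, hn₁, hθσ, hσ2⟩ :=
    exists_step_constants (C1 := C1) hε hθ (by linarith)
  have hX := Real.exp_pos (2 * C1)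
  set X := Real.exp (2 * C1) with hXd
  refine ⟨(2 / ε * X + 1) + (8 / ε ^ 2 * X + 4 / ε ^ 2 * 1), ε ^ 2 / 16, by positivity,
    by positivity, by nlinarith, ?_⟩
  intro g hg hg1 K0 hK0 N ι _ zs hN hzs hgz hsum
  have hN' : (0:ℝ) < N := by positivity
  set K := max K0 1 with hKd
  have hKp : 0 < K := lt_of_lt_of_le one_pos (le_max_right _ _)
  have hK : ∀ z w, ‖z‖ ≤ 1 → ‖w‖ ≤ 1 → ‖g z - g w‖ ≤ K * ‖z - w‖ := fun z w hz hw =>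
    (hK0 z w hz hw).trans (mul_le_mul_of_nonneg_right (le_max_left _ _) (norm_nonneg _))
  obtain ⟨t, ht0, ht1, ht⟩ := exists_pos_le_of_fintype
    ![ε / (8 * K), 1 / 2, ε * N / (8 * K * (Fintype.card ι + 1))] (by
      intro k; fin_cases k <;> simp <;> positivity)
  have hta := ht 0
  have htb := ht 1
  have htc := ht 2
  simp only [Matrix.cons_val] at hta htb htc
  obtain ⟨n, hn⟩ := exists_pow_lt_of_lt_one ht0 (show 1 - s < 1 by linarith)
  have hsn : 0 < (1 - s) ^ n := pow_pos (by linarith) n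
  have hsn1 : (1 - s) ^ n ≤ 1 := pow_le_one₀ (by linarith) (by linarith)
  have hy : ∀ k, 0 < 1 - ‖zs k‖ := fun k => by linarith [hzs k]
  obtain ⟨vs, hv0, hv1, hvs⟩ := exists_pos_le_of_fintype (fun k => (1 - ‖zs k‖) * (1 - s) ^ n)
    (fun k => mul_pos (hy k) hsn)
  have hvsy : ∀ k, vs ≤ 1 - ‖zs k‖ := fun k =>
    (hvs k).trans (mul_le_of_le_one_right (hy k).le hsn1)
  choose e he hze using fun k => exists_direction (zs k)
  obtain ⟨M1, hM1⟩ := hall vs hv0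
  set M := max M1 ⌈1 / vs⌉₊ with hMd
  have hMv : 1 / (M : ℝ) ≤ vs := by
    have h1 : 1 / vs ≤ (M : ℝ) :=
      (Nat.le_ceil _).trans (by exact_mod_cast le_max_right M1 ⌈1 / vs⌉₊)
    rw [div_le_iff₀ hv0] at h1
    rw [div_le_iff₀ (by
      have : 0 < 1 / vs := by positivity
      exact lt_of_lt_of_le this ((Nat.le_ceil _).trans
        (by exact_mod_cast le_max_right M1 ⌈1 / vs⌉₊)))]
    linarith
  have hM0 : M ≠ 0 := by
    have : 0 < ⌈1 / vs⌉₊ := Nat.ceil_pos.2 (by positivity)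
    have := le_max_right M1 ⌈1 / vs⌉₊
    omega
  have hM' : (0:ℝ) < M := by positivity
  choose S hSr hcard hnear using fun k => hM1 M (le_max_left _ _) g hg hg1 (zs k) (e k) (hzs k)
    (hgz k) (hvsy k) (he k) (hze k)
  have hc0 : ∀ k, (0:ℝ) < (S k).card := fun k =>
    lt_of_lt_of_le (by have := hy k; positivity) (hcard k)
  have hr1 : ∀ j, ‖rtu M j‖ = 1 := fun j => rtu_norm M j
  have hs1 : s ≤ 1 := by linarith
  have hfin : ∀ k, ∀ j, 1 - ‖path (zs k) (e k) (rtu M j) s n₁ (n₁ + n)‖ ≤ t := fun k j => by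
    rw [path_end_norm hn₁ (hzs k).le (hr1 j) hs.le hs1]
    calc _ ≤ 1 * (1 - s) ^ n := by gcongr; linarith [norm_nonneg (zs k)]
      _ ≤ t := by linarith
  have hsig : ∀ F : (k : ι) → ℕ → ℝ,
      ∑ p : (k : ι) × {j // j ∈ S k}, F p.1 p.2 = ∑ k, ∑ j ∈ S k, F k j := fun F => by
    rw [Fintype.sum_sigma]
    exact Finset.sum_congr rfl fun k _ => Finset.sum_coe_sort (S k) (F k)
  have hwt : ∀ k (c : ℝ), ∑ j ∈ S k, 1 / (N * (S k).card : ℝ) * c = 1 / N * c := fun k c => by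
    rw [Finset.sum_const, nsmul_eq_mul]
    exact card_mul_weight (hc0 k).ne'
  have hwp : ∀ k, 0 ≤ 1 / (N * (S k).card : ℝ) := fun k =>
    one_div_nonneg.2 (mul_nonneg hN'.le (hc0 k).le)
  have hK8 : 0 ≤ 8 * K := by linarith
  obtain ⟨Λ, hΛ, hΛb, ξ, hξ, hξb⟩ := chains_lemma hg hg1 (W := 1) (C1 := C1) hKp hK hε (by linarith)
    hσ.le hσ4
    (ι := (k : ι) × {j // j ∈ S k}) (n₁ + n) (fun p i => path (zs p.1) (e p.1) (rtu M p.2) s n₁ i)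
    (fun p => 1 / (N * (S p.1).card : ℝ)) (fun p => hwp p.1)
    (fun p i _ => path_norm_lt hn₁ (hzs _) (he _) (hr1 _) hs.le (by linarith) i)
    (fun p i hi => path_norm_ge hg hg1 hn₁ (hze _) (hzs _) (he _) (hr1 _)
      (hnear _ _ p.2.2).1 hs.le hs1 (hgz _) (by linarith) (hvs _) (hnear _ _ p.2.2).2 hi)
    (fun p i _ => path_step hn₁ (hze _) (hzs _) (he _) (hr1 _) (hnear _ _ p.2.2).1 hθσ hs hs2 hσs)
    (fun p => by
      have h1 := (hfin p.1 p.2).trans hta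
      rwa [le_div_iff₀' (by positivity)] at h1)
    (fun p => by linarith [hfin p.1 p.2])
    (by
      refine le_trans (Finset.sum_le_sum (g := fun p : (k : ι) × {j // j ∈ S k} =>
        1 / (N * (S p.1).card : ℝ) * (8 * K * t / ε)) fun p _ => ?_) ?_
      · exact mul_le_mul_of_nonneg_left (div_le_div_of_nonneg_right
          (mul_le_mul_of_nonneg_left (hfin p.1 p.2) hK8) hε.le) (hwp p.1)
      · rw [hsig fun k _ => 1 / (N * (S k).card : ℝ) * (8 * K * t / ε)]
        simp only [hwt]
        rw [Finset.sum_const, Finset.card_univ, nsmul_eq_mul]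
        rw [le_div_iff₀ (by positivity)] at htc
        have e1 : (Fintype.card ι : ℝ) * (1 / N * (8 * K * t / ε)) =
            (Fintype.card ι * (8 * K * t)) / (ε * N) := weight_sum_eq
        rw [e1, div_le_one (by positivity)]
        have : 0 ≤ t * (8 * K) := by positivity
        nlinarith)
    (by
      intro x hx
      have hxx : 0 ≤ 1 - ‖x‖ := by linarith
      refine le_trans (Finset.sum_le_sum (g := fun p : (k : ι) × {j // j ∈ S k} =>
        1 / (N * (S p.1).card : ℝ) * (10 * (1 - ‖mob (zs p.1) x‖ ^ 2)) + 72 *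
        (1 / (N * (S p.1).card : ℝ) * ((1 - ‖x‖) * ((1 - ‖zs p.1‖) /
          ((‖rtu M p.2 - x‖ + vs) * (‖rtu M p.2 - x‖ + (1 - ‖zs p.1‖))))))) fun p _ => ?_) ?_
      · have h1 := path_sum_le (w := x) hn₁ (hze p.1) (hzs p.1) (he p.1) (hr1 p.2)
          ((hnear _ _ p.2.2).1.trans (mul_le_mul_of_nonneg_right hθ4 (hy p.1).le)) hσ2 hs hs2 hσs
          hv0 (hvs p.1) hx
        have h2 := mul_le_mul_of_nonneg_left h1 (hwp p.1)
        rw [Finset.mul_sum] at h2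
        refine le_trans (le_of_eq ?_) (h2.trans (le_of_eq ?_))
        · exact Finset.sum_congr rfl fun i _ => by ring
        · ring
      · rw [Finset.sum_add_distrib, ← Finset.mul_sum,
          hsig fun k _ => 1 / (N * (S k).card : ℝ) * (10 * (1 - ‖mob (zs k) x‖ ^ 2)),
          hsig fun k j => 1 / (N * (S k).card : ℝ) * ((1 - ‖x‖) * ((1 - ‖zs k‖) /
          ((‖rtu M j - x‖ + vs) * (‖rtu M j - x‖ + (1 - ‖zs k‖)))))]
        simp only [hwt]
        rw [← Finset.mul_sum, ← Finset.mul_sum]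
        have h1 := carleson_double_sum hN' hC0.le hθ hsum hze hzs he hSr hcard
          (fun k j hj => ((hnear k j hj).1.trans (mul_le_mul_of_nonneg_right hθ4 (hy k).le)))
          hM0 hv0 hv1 hMv hvsy hx
        have h2 : 1 / (N : ℝ) * (10 * ∑ k, (1 - ‖mob (zs k) x‖ ^ 2)) ≤ C * 10 := by
          have := hsum x hx
          rw [one_div, inv_mul_le_iff₀ hN']
          linarith
        have e1 : C1 = C * 10 + 72 * (C * (9 + 6400 / θ)) := by rw [hC1]; ring
        rw [e1]
        exact add_le_add h2 (mul_le_mul_of_nonneg_left h1 (by norm_num)))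
  refine ⟨Λ, hΛ, fun z hz => (hΛb z hz).trans (le_add_of_nonneg_right (by positivity)), ξ, hξ,
    fun x hx hgx => ⟨(hξb x hx hgx).1.trans ?_, ?_⟩⟩
  · exact mul_le_mul_of_nonneg_right (le_add_of_nonneg_left (by positivity)) (norm_nonneg _)
  · rw [(hξb x hx hgx).2]
    simp only [path_zero (hze _)]
    rw [hsig fun k _ => 1 / (N * (S k).card : ℝ) * Real.log ‖mob (zs k) x‖]
    simp only [hwt]
    rw [Finset.mul_sum]

end

section

open Complex Metric Set
open scoped ComplexConjugate Topology

lemma polynomial_anaCl (p : Polynomial ℂ) : AnaCl (fun z => p.eval z) := fun z _ => by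
  have : Differentiable ℂ (fun z => p.eval z) := p.differentiable
  exact this.analyticAt z

lemma polynomial_lipschitz (p : Polynomial ℂ) :
    ∃ K : ℝ, ∀ z w : ℂ, ‖z‖ ≤ 1 → ‖w‖ ≤ 1 → ‖p.eval z - p.eval w‖ ≤ K * ‖z - w‖ := by
  obtain ⟨K, hK⟩ := (isCompact_closedBall (0:ℂ) 1).exists_bound_of_continuousOn
    (f := fun z => (Polynomial.derivative p).eval z) (Polynomial.continuous _).continuousOn
  refine ⟨K, fun z w hz hw => Convex.norm_image_sub_le_of_norm_deriv_le (𝕜 := ℂ)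
    (f := fun z => p.eval z) (s := closedBall (0:ℂ) 1) (fun x _ => p.differentiableAt)
    (fun x hx => by rw [Polynomial.deriv]; exact hK x hx)
    (convex_closedBall 0 1) (by simpa using hw) (by simpa using hz)⟩

lemma norm_exp_sub_one_le_mul_exp (z : ℂ) : ‖exp z - 1‖ ≤ ‖z‖ * Real.exp ‖z‖ := by
  simpa using Complex.norm_exp_sub_sum_le_norm_mul_exp z 1

lemma norm_log_one_sub_sub_le {a b : ℂ} (ha : ‖a‖ ≤ 1 / 2) (hb : ‖b‖ ≤ 1 / 2) :
    ‖log (1 - a) - log (1 - b)‖ ≤ 2 * ‖a - b‖ := by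
  refine Convex.norm_image_sub_le_of_norm_deriv_le (𝕜 := ℂ) (f := fun w => log (1 - w))
    (s := closedBall (0:ℂ) (1 / 2)) (fun x hx => ?_) (fun x hx => ?_)
    (convex_closedBall 0 _) (by simpa using hb) (by simpa using ha)
  · have hx' : ‖x‖ ≤ 1 / 2 := by simpa using hx
    exact ((hasDerivAt_id x).const_sub 1).clog (slit_one_sub hx') |>.differentiableAt
  · have hx' : ‖x‖ ≤ 1 / 2 := by simpa using hx
    have h2 : HasDerivAt (fun w => log (1 - w)) (-1 / (1 - x)) x :=
      ((hasDerivAt_id x).const_sub 1).clog (slit_one_sub hx')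
    rw [h2.deriv, norm_div, norm_neg,
      norm_one]
    have h1 := norm_sub_norm_le (1:ℂ) x
    rw [norm_one] at h1
    rw [div_le_iff₀ (by linarith)]
    linarith

/-- Comparison of `f⁻ᴺ` with `uᴺ`. -/
lemma pow_correction {μ p u q : ℂ} {N : ℕ} {M0 : ℝ} (hM : 1 ≤ M0) (hN : N ≠ 0)
    (hμ : ‖μ‖ ≤ 3 / 2 * (1 / (8 * M0)) ^ N) (hp : ‖p‖ ≤ 2 * M0) (hu : ‖u‖ ≤ M0)
    (h : ‖p - u‖ ≤ 2 * M0 ^ 2 * ‖q‖) :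
    ‖μ * p ^ N‖ ≤ 1 / 2 ∧ ‖μ * u ^ N‖ ≤ 1 / 2 ∧
      ‖1 / (N : ℂ) * (log (1 - μ * p ^ N) - log (1 - μ * u ^ N))‖ ≤ M0 * ‖q‖ := by
  have hM0 : 0 < M0 := by linarith
  have h4 : (1 / 4 : ℝ) ^ N ≤ 1 / 4 := by
    simpa using pow_le_pow_of_le_one (by norm_num : (0:ℝ) ≤ 1 / 4) (by norm_num)
      (Nat.one_le_iff_ne_zero.2 hN)
  have hr : (1 / (8 * M0)) ^ N * (2 * M0) ^ N = (1 / 4) ^ N := by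
    rw [← mul_pow]; congr 1; field_simp; norm_num
  have key : ‖μ‖ * (2 * M0) ^ N ≤ 3 / 8 := by
    calc _ ≤ 3 / 2 * (1 / (8 * M0)) ^ N * (2 * M0) ^ N := by gcongr
      _ = 3 / 2 * (1 / 4) ^ N := by rw [mul_assoc, hr]
      _ ≤ _ := by linarith
  have h1 : ‖μ * p ^ N‖ ≤ 1 / 2 := by
    rw [norm_mul, norm_pow]
    have : ‖μ‖ * ‖p‖ ^ N ≤ ‖μ‖ * (2 * M0) ^ N := by gcongr
    linarith
  have h2 : ‖μ * u ^ N‖ ≤ 1 / 2 := by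
    rw [norm_mul, norm_pow]
    have : ‖μ‖ * ‖u‖ ^ N ≤ ‖μ‖ * (2 * M0) ^ N := by gcongr; linarith
    linarith
  refine ⟨h1, h2, ?_⟩
  have hN' : (0:ℝ) < N := by positivity
  have h3 := norm_log_one_sub_sub_le h1 h2
  have hB : 0 < 2 * M0 := by linarith
  have hBc : ((2 * M0 : ℝ) : ℂ) ≠ 0 := by exact_mod_cast hB.ne'
  have h5 : ‖p ^ N - u ^ N‖ ≤ (2 * M0) ^ N * (N * (‖p - u‖ / (2 * M0))) := by
    have h6 := norm_pow_sub_pow_le_of_le_one (a := p / ((2 * M0 : ℝ) : ℂ))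
      (b := u / ((2 * M0 : ℝ) : ℂ))
      (by rw [norm_div, Complex.norm_real, Real.norm_of_nonneg hB.le]; exact (div_le_one hB).2 hp)
      (by rw [norm_div, Complex.norm_real, Real.norm_of_nonneg hB.le]
          exact (div_le_one hB).2 (by linarith)) N
    rw [← sub_div, div_pow, div_pow, ← sub_div, norm_div, norm_div, norm_pow, Complex.norm_real,
      Real.norm_of_nonneg hB.le, div_le_iff₀ (by positivity)] at h6
    linarith
  rw [norm_mul, norm_div, norm_one, Complex.norm_natCast, one_div, inv_mul_le_iff₀ hN']
  calc _ ≤ 2 * ‖μ * p ^ N - μ * u ^ N‖ := h3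
    _ = 2 * (‖μ‖ * ‖p ^ N - u ^ N‖) := by rw [← mul_sub, norm_mul]
    _ ≤ 2 * (‖μ‖ * ((2 * M0) ^ N * (N * ((2 * M0 ^ 2 * ‖q‖) / (2 * M0))))) := by
        gcongr
        exact h5.trans (by gcongr)
    _ = 2 * (‖μ‖ * (2 * M0) ^ N) * (N * (M0 * ‖q‖)) := by field_simp
    _ ≤ 2 * (3 / 8) * (N * (M0 * ‖q‖)) := by gcongr
    _ ≤ _ := by
        have : 0 ≤ N * (M0 * ‖q‖) := by positivity
        linarith

lemma norm_exp_eq_of_factor {F f L S q : ℂ} {N : ℕ} {ι : Type*} [Fintype ι] {b : ι → ℂ}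
    (hN : N ≠ 0) (hf : f ≠ 0) (hF : F = exp L * ∏ k, b k) (hF' : F = f ^ N * (1 - q))
    (hq : 1 - q ≠ 0) (hS : S.re = 1 / (N : ℝ) * ∑ k, Real.log ‖b k‖) :
    ‖exp (1 / (N : ℂ) * L + S - 1 / (N : ℂ) * log (1 - q))‖ = ‖f‖ := by
  have hN' : (N : ℝ) ≠ 0 := by exact_mod_cast hN
  have hF0 : F ≠ 0 := by rw [hF']; exact mul_ne_zero (pow_ne_zero _ hf) hq
  have hb : ∀ k, b k ≠ 0 := fun k hk => hF0 (by
    rw [hF, Finset.prod_eq_zero (Finset.mem_univ k) hk, mul_zero])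
  have h1 : Real.log ‖F‖ = L.re + ∑ k, Real.log ‖b k‖ := by
    rw [hF, norm_mul, norm_prod, Real.log_mul (norm_ne_zero_iff.2 (exp_ne_zero _))
      (Finset.prod_ne_zero_iff.2 fun k _ => norm_ne_zero_iff.2 (hb k)), Complex.norm_exp,
      Real.log_exp, Real.log_prod fun k _ => norm_ne_zero_iff.2 (hb k)]
  have h2 : Real.log ‖F‖ = N * Real.log ‖f‖ + Real.log ‖1 - q‖ := by
    rw [hF', norm_mul, norm_pow, Real.log_mul (pow_ne_zero _ (norm_ne_zero_iff.2 hf))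
      (norm_ne_zero_iff.2 hq), Real.log_pow]
  have e1 : (1 / (N : ℂ)) = ((1 / (N : ℝ) : ℝ) : ℂ) := by push_cast; rfl
  have h3 : (1 / (N : ℂ) * L + S - 1 / (N : ℂ) * log (1 - q)).re = Real.log ‖f‖ := by
    rw [e1, Complex.sub_re, Complex.add_re, Complex.re_ofReal_mul, Complex.re_ofReal_mul, hS,
      Complex.log_re]
    field_simp
    linarith
  rw [Complex.norm_exp, h3, Real.exp_log (norm_pos_iff.2 hf)]

theorem exists_phase {M0 : ℝ} (hM : 1 ≤ M0) :
    ∃ C ε : ℝ, 0 < C ∧ 0 < ε ∧ ε ≤ 1 ∧ ∀ f g : Polynomial ℂ,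
      (∀ z, ‖z‖ ≤ 1 → ‖f.eval z‖ ≤ 1) → (∀ z, ‖z‖ ≤ 1 → ‖g.eval z‖ ≤ 1) →
      ∀ u v : ℂ → ℂ, DifferentiableOn ℂ u (ball 0 1) → (∀ z, ‖z‖ < 1 → ‖u z‖ ≤ M0) →
        (∀ z, ‖z‖ < 1 → ‖v z‖ ≤ M0) →
        (∀ z, ‖z‖ < 1 → u z * f.eval z + v z * g.eval z = 1) →
        ∃ (H : ℂ → ℂ) (c : ℂ → ℝ), DifferentiableOn ℂ H (ball 0 1) ∧
          (∀ x, ‖x‖ < 1 → |(H x).re| ≤ C) ∧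
          ∀ x, ‖x‖ < 1 → ‖g.eval x‖ < ε → |c x| ≤ Real.pi ∧ (∀ᶠ y in 𝓝 x, c y = c x) ∧
            ‖exp (H x - I * c x) - f.eval x‖ ≤ C * ‖g.eval x‖ := by
  have hM0 : 0 < M0 := by linarith
  have hr : 1 / (8 * M0) ≤ 1 / 2 := by
    rw [div_le_div_iff₀ (by positivity) (by norm_num)]; linarith
  obtain ⟨C, hC, hsrc⟩ := exists_sources (r := 1 / (8 * M0)) (by positivity) hr
  obtain ⟨C2, ε, hC2, hε, hε1, hpot⟩ := exists_potential (δ := 1 / (2 * M0)) (by positivity)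
    (by rw [div_le_one (by positivity)]; linarith) hC
  refine ⟨(C + C2 + 1) + (C2 + M0) * Real.exp (C2 + M0), min ε (1 / (2 * M0)), by positivity,
    by positivity, (min_le_left _ _).trans hε1, ?_⟩
  intro f g hf hg u v hu hub hvb huv
  obtain ⟨N, μ, ι, _, zs, L, hN, hμ, hzs, hL, hFL, hLb, hsum⟩ := hsrc f hf
  have hN' : (0:ℝ) < N := by positivity
  have hr0 : (0:ℝ) < 1 / (8 * M0) := by positivity
  have hμ' : ‖μ‖ ≤ 3 / 2 * (1 / (8 * M0)) ^ N := by
    have h1 := norm_le_norm_add_norm_sub' μ ((1 / (8 * M0)) ^ N : ℝ)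
    rw [Complex.norm_real, Real.norm_of_nonneg (by positivity)] at h1
    linarith
  have hlow : ∀ z, ‖z‖ < 1 → 1 ≤ M0 * ‖f.eval z‖ + M0 * ‖g.eval z‖ := fun z hz => by
    have h1 := norm_add_le (u z * f.eval z) (v z * g.eval z)
    rw [huv z hz, norm_one, norm_mul, norm_mul] at h1
    have h2 := mul_le_mul_of_nonneg_right (hub z hz) (norm_nonneg (f.eval z))
    have h3 := mul_le_mul_of_nonneg_right (hvb z hz) (norm_nonneg (g.eval z))
    linarith
  have hgz : ∀ k, 1 / (2 * M0) ≤ ‖g.eval (zs k)‖ := fun k => by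
    have h1 : ‖f.eval (zs k)‖ ≤ 3 / 2 * (1 / (8 * M0)) := by
      refine le_of_pow_le_pow_left₀ hN (by positivity) ?_
      rw [← norm_pow, (hzs k).2, mul_pow]
      refine hμ'.trans (mul_le_mul_of_nonneg_right ?_ (by positivity))
      simpa using pow_le_pow_right₀ (by norm_num : (1:ℝ) ≤ 3 / 2) (Nat.one_le_iff_ne_zero.2 hN)
    have h2 := hlow _ (hzs k).1
    have h3 : M0 * ‖f.eval (zs k)‖ ≤ 3 / 16 := by
      calc _ ≤ M0 * (3 / 2 * (1 / (8 * M0))) := by gcongr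
        _ = 3 / 16 := by field_simp; norm_num
    rw [div_le_iff₀ (by positivity)]
    linarith
  obtain ⟨K, hK⟩ := polynomial_lipschitz g
  obtain ⟨Λ, hΛ, hΛb, ξ, hξ, hξb⟩ := hpot (fun z => g.eval z) (polynomial_anaCl g) hg K hK N ι zs hN
    (fun k => (hzs k).1) hgz hsum
  have hcor1 : ∀ x, ‖x‖ < 1 → ‖μ * u x ^ N‖ ≤ 1 / 2 := fun x hx =>
    (pow_correction (p := u x) (q := 0) hM hN hμ' ((hub x hx).trans (by linarith)) (hub x hx)
      (by simp)).2.1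
  have huan : ∀ x, ‖x‖ < 1 → AnalyticAt ℂ u x := fun x hx =>
    hu.analyticAt (isOpen_ball.mem_nhds (by simpa using hx))
  have hlogu : ∀ x, ‖x‖ < 1 → AnalyticAt ℂ (fun x => log (1 - μ * u x ^ N)) x := fun x hx =>
    (analyticAt_const.sub (analyticAt_const.mul ((huan x hx).pow N))).clog
      (slit_one_sub (hcor1 x hx))
  set H : ℂ → ℂ := fun x => 1 / (N : ℂ) * L x + Λ x - 1 / (N : ℂ) * log (1 - μ * u x ^ N) with hH
  have hHan : ∀ x, ‖x‖ < 1 → AnalyticAt ℂ H x := fun x hx => by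
    have hx' : x ∈ closedBall (0:ℂ) 1 := by simpa using hx.le
    exact ((analyticAt_const.mul (hL x hx')).add (hΛ x hx')).sub
      (analyticAt_const.mul (hlogu x hx))
  set ξ2 : ℂ → ℂ := fun x => ξ x + 1 / (N : ℂ) * (log (1 - μ * (f.eval x)⁻¹ ^ N) -
    log (1 - μ * u x ^ N)) with hξ2
  set κ : ℂ → ℂ := fun x => exp (H x - ξ2 x) / f.eval x with hκ
  have hcor : ∀ x, ‖x‖ < 1 → ‖g.eval x‖ < min ε (1 / (2 * M0)) → f.eval x ≠ 0 ∧
      ‖μ * (f.eval x)⁻¹ ^ N‖ ≤ 1 / 2 ∧ ‖ξ2 x‖ ≤ (C2 + M0) * ‖g.eval x‖ := fun x hx hgx => by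
    have h1 := hgx.trans_le (min_le_right _ _)
    rw [lt_div_iff₀ (by positivity)] at h1
    have h2 : 1 / 2 ≤ M0 * ‖f.eval x‖ := by linarith [hlow x hx]
    have h3 : 0 < ‖f.eval x‖ := by
      by_contra hc
      nlinarith
    have hf0 : f.eval x ≠ 0 := norm_pos_iff.1 h3
    have h4 : ‖(f.eval x)⁻¹‖ ≤ 2 * M0 := by
      rw [norm_inv, inv_le_iff_one_le_mul₀ h3]; linarith
    have h5 : (f.eval x)⁻¹ - u x = v x * g.eval x * (f.eval x)⁻¹ := by
      have := huv x hx
      field_simp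
      linear_combination -this
    obtain ⟨h6, -, h7⟩ := pow_correction (q := g.eval x) hM hN hμ' h4 (hub x hx) (by
      rw [h5, norm_mul, norm_mul]
      calc _ ≤ M0 * ‖g.eval x‖ * (2 * M0) := by
            gcongr
            exact hvb x hx
        _ = _ := by ring)
    refine ⟨hf0, h6, (norm_add_le _ _).trans ?_⟩
    have := (hξb x hx (hgx.trans_le (min_le_left _ _))).1
    linarith
  have hκn : ∀ x, ‖x‖ < 1 → ‖g.eval x‖ < min ε (1 / (2 * M0)) → ‖κ x‖ = 1 := fun x hx hgx => by
    obtain ⟨hf0, h1, -⟩ := hcor x hx hgx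
    have h2 := norm_exp_eq_of_factor (F := f.eval x ^ N - μ) (q := μ * (f.eval x)⁻¹ ^ N)
      (S := Λ x - ξ x) hN hf0 (hFL x hx.le)
      (by rw [mul_sub, mul_one, mul_left_comm, ← mul_pow, mul_inv_cancel₀ hf0, one_pow, mul_one])
      (slitPlane_ne_zero (slit_one_sub h1)) (hξb x hx (hgx.trans_le (min_le_left _ _))).2
    have h3 : H x - ξ2 x = 1 / (N : ℂ) * L x + (Λ x - ξ x) -
        1 / (N : ℂ) * log (1 - μ * (f.eval x)⁻¹ ^ N) := by
      simp only [hH, hξ2]; ring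
    rw [hκ]
    dsimp only
    rw [norm_div, h3, h2, div_self (norm_ne_zero_iff.2 hf0)]
  have hopen : ∀ x, ‖x‖ < 1 → ‖g.eval x‖ < min ε (1 / (2 * M0)) →
      ∀ᶠ y in 𝓝 x, ‖y‖ < 1 ∧ ‖g.eval y‖ < min ε (1 / (2 * M0)) := fun x hx hgx =>
    (continuous_norm.continuousAt.eventually_lt continuousAt_const hx).and
      ((g.continuous.norm).continuousAt.eventually_lt continuousAt_const hgx)
  have hκd : ∀ x, ‖x‖ < 1 → ‖g.eval x‖ < min ε (1 / (2 * M0)) → DifferentiableAt ℂ κ x :=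
    fun x hx hgx => by
    obtain ⟨hf0, h1, -⟩ := hcor x hx hgx
    have hfa : AnalyticAt ℂ (fun x => f.eval x) x := polynomial_anaCl f x (by simpa using hx.le)
    have h2 : AnalyticAt ℂ (fun x => log (1 - μ * (f.eval x)⁻¹ ^ N)) x :=
      (analyticAt_const.sub (analyticAt_const.mul ((hfa.inv hf0).pow N))).clog (slit_one_sub h1)
    have h3 : AnalyticAt ℂ ξ2 x := (hξ x hx (hgx.trans_le (min_le_left _ _))).add
      (analyticAt_const.mul (h2.sub (hlogu x hx)))
    exact (((hHan x hx).sub h3).cexp.div hfa hf0).differentiableAt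
  refine ⟨H, fun x => arg (κ x), fun x hx =>
    (hHan x (by simpa using hx)).differentiableAt.differentiableWithinAt, fun x hx => ?_,
    fun x hx hgx => ⟨abs_arg_le_pi _, ?_, ?_⟩⟩
  · have h1 := hLb x hx.le
    have h2 := hΛb x hx.le
    have h3 := (Complex.abs_re_le_norm _).trans (norm_log_one_sub_le (hcor1 x hx))
    have h4 := hcor1 x hx
    have e1 : (1 / (N : ℂ)) = ((1 / (N : ℝ) : ℝ) : ℂ) := by push_cast; rfl
    have h5 : (H x).re = 1 / (N : ℝ) * (L x).re + (Λ x).re -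
        1 / (N : ℝ) * (log (1 - μ * u x ^ N)).re := by
      simp only [hH, e1, Complex.sub_re, Complex.add_re, Complex.re_ofReal_mul]
    have h6 : |1 / (N : ℝ) * (L x).re| ≤ C := by
      rw [abs_mul, abs_of_pos (by positivity : 0 < 1 / (N : ℝ)), one_div, inv_mul_le_iff₀ hN']
      linarith
    have h7 : |1 / (N : ℝ) * (log (1 - μ * u x ^ N)).re| ≤ 1 := by
      have : (1:ℝ) ≤ N := by exact_mod_cast Nat.one_le_iff_ne_zero.2 hN
      rw [abs_mul, abs_of_pos (by positivity : 0 < 1 / (N : ℝ)), one_div, inv_mul_le_iff₀ hN']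
      linarith
    have h8 : 0 ≤ (C2 + M0) * Real.exp (C2 + M0) := by positivity
    rw [h5]
    rw [abs_le] at *
    constructor <;> linarith
  · have h1 := Complex.eventually_eq_of_isLocalMax_norm (f := κ) (c := x)
      ((hopen x hx hgx).mono fun y hy => hκd y hy.1 hy.2)
      ((hopen x hx hgx).mono fun y hy => by
        simp only [Function.comp, hκn y hy.1 hy.2, hκn x hx hgx, le_refl])
    exact h1.mono fun y hy => congrArg arg hy
  · obtain ⟨hf0, h1, h2⟩ := hcor x hx hgx
    have h3 : exp (I * arg (κ x)) = κ x := by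
      have := Complex.norm_mul_exp_arg_mul_I (κ x)
      rw [hκn x hx hgx, ofReal_one, one_mul] at this
      rw [mul_comm, this]
    have h4 : exp (H x - I * arg (κ x)) = f.eval x * exp (ξ2 x) := by
      rw [Complex.exp_sub, h3, div_eq_iff (norm_ne_zero_iff.1 (by rw [hκn x hx hgx]; exact one_ne_zero)),
        hκ]
      dsimp only
      rw [mul_div_assoc', mul_assoc, ← Complex.exp_add, add_sub_cancel, mul_div_cancel_left₀ _ hf0]
    have h5 : ‖g.eval x‖ ≤ 1 := hg x hx.le
    have h6 : ‖ξ2 x‖ ≤ C2 + M0 := h2.trans (mul_le_of_le_one_right (by positivity) h5)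
    rw [h4, ← mul_sub_one, norm_mul]
    calc _ ≤ 1 * (((C2 + M0) * ‖g.eval x‖) * Real.exp (C2 + M0)) := by
          refine mul_le_mul (hf x hx.le) ((norm_exp_sub_one_le_mul_exp _).trans ?_)
            (norm_nonneg _) zero_le_one
          exact mul_le_mul h2 (Real.exp_le_exp.2 h6) (Real.exp_pos _).le (by positivity)
      _ = (C2 + M0) * Real.exp (C2 + M0) * ‖g.eval x‖ := by ring
      _ ≤ _ := mul_le_mul_of_nonneg_right (le_add_of_nonneg_left (by positivity)) (norm_nonneg _)

end

section

open Complex Metric Set MeasureTheory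
open scoped ComplexConjugate Topology

/-- The real-linear map `h ↦ a * h + b * conj h`. -/
noncomputable def wirt (a b : ℂ) : ℂ →L[ℝ] ℂ :=
  a • ContinuousLinearMap.id ℝ ℂ + b • (conjCLE : ℂ →L[ℝ] ℂ)

lemma wirt_apply (a b h : ℂ) : wirt a b h = a * h + b * conj h := by
  simp [wirt]

lemma _root_.HasDerivAt.hasWirt {q : ℂ → ℂ} {q' z : ℂ} (h : HasDerivAt q q' z) :
    HasFDerivAt q (wirt q' 0) z := by
  refine (h.hasFDerivAt.restrictScalars ℝ).congr_fderiv ?_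
  apply ContinuousLinearMap.ext
  intro x
  simp [wirt_apply, mul_comm]

lemma hasWirt_conj {Z : ℂ → ℂ} {a b z : ℂ} (h : HasFDerivAt Z (wirt a b) z) :
    HasFDerivAt (fun z => conj (Z z)) (wirt (conj b) (conj a)) z := by
  refine ((conjCLE : ℂ →L[ℝ] ℂ).hasFDerivAt.comp z h).congr_fderiv ?_
  apply ContinuousLinearMap.ext
  intro x
  simp [wirt_apply, add_comm]

lemma hasWirt_mul {Z W : ℂ → ℂ} {a b c d z : ℂ} (h : HasFDerivAt Z (wirt a b) z)
    (h' : HasFDerivAt W (wirt c d) z) :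
    HasFDerivAt (fun z => Z z * W z) (wirt (a * W z + Z z * c) (b * W z + Z z * d)) z := by
  refine (h.mul h').congr_fderiv ?_
  apply ContinuousLinearMap.ext
  intro x
  simp [wirt_apply]
  ring

lemma hasWirt_sub {Z W : ℂ → ℂ} {a b c d z : ℂ} (h : HasFDerivAt Z (wirt a b) z)
    (h' : HasFDerivAt W (wirt c d) z) :
    HasFDerivAt (fun z => Z z - W z) (wirt (a - c) (b - d)) z := by
  refine (h.sub h').congr_fderiv ?_
  apply ContinuousLinearMap.ext
  intro x
  simp [wirt_apply]
  ring

noncomputable def polar (x : ℝ × ℝ) : ℂ := x.1 * exp (x.2 * I)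

abbrev polarRect : Set (ℝ × ℝ) := Icc (0, 0) (1, 2 * Real.pi)

lemma continuous_polar : Continuous polar := by unfold polar; fun_prop

lemma norm_polar (x : ℝ × ℝ) : ‖polar x‖ = |x.1| := by
  rw [polar, norm_mul, Complex.norm_exp_ofReal_mul_I, mul_one, Complex.norm_real, Real.norm_eq_abs]

lemma polar_mem {x : ℝ × ℝ} (hx : x ∈ polarRect) : polar x ∈ closedBall (0:ℂ) 1 := by
  rw [mem_closedBall_zero_iff, norm_polar, abs_of_nonneg hx.1.1]
  exact hx.2.1

lemma polar_injOn : InjOn polar (Ioo (0:ℝ) 1 ×ˢ Ioo (0:ℝ) (2 * Real.pi)) := by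
  rintro ⟨r, t⟩ ⟨hr, ht⟩ ⟨r', t'⟩ ⟨hr', ht'⟩ h
  simp only [mem_Ioo] at hr ht hr' ht'
  have h1 := congrArg norm h
  rw [norm_polar, norm_polar, abs_of_pos hr.1, abs_of_pos hr'.1] at h1

  subst h1
  have h2 : exp (t * I) = exp (t' * I) :=
    mul_left_cancel₀ (by exact_mod_cast hr.1.ne' : (r:ℂ) ≠ 0) h
  obtain ⟨n, hn⟩ := Complex.exp_eq_exp_iff_exists_int.1 h2
  have h3 : (t : ℂ) = ((t' + n * (2 * Real.pi) : ℝ) : ℂ) := by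
    have : (t : ℂ) * I = ((t' + n * (2 * Real.pi) : ℝ) : ℂ) * I := by
      rw [hn]; push_cast; ring
    exact mul_right_cancel₀ I_ne_zero this
  have h4 : t = t' + n * (2 * Real.pi) := by exact_mod_cast h3
  have hπ := Real.pi_pos
  have h5 : n = 0 := by
    have a1 : (n : ℝ) < 1 := by
      by_contra hc
      nlinarith
    have a2 : (-1 : ℝ) < n := by
      by_contra hc
      nlinarith
    have a1' : n < 1 := by exact_mod_cast a1
    have a2' : -1 < n := by exact_mod_cast a2
    omega
  rw [h5] at h4
  simp at h4
  rw [h4]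

lemma hasFDerivAt_polar (x : ℝ × ℝ) : ∃ E : ℝ × ℝ →L[ℝ] ℂ, HasFDerivAt polar E x ∧
    E (1, 0) = exp (x.2 * I) ∧ E (0, 1) = x.1 * (exp (x.2 * I) * I) := by
  have h1 : HasFDerivAt (fun x : ℝ × ℝ => (x.1 : ℂ))
      (ofRealCLM.comp (ContinuousLinearMap.fst ℝ ℝ ℝ)) x :=
    ofRealCLM.hasFDerivAt.comp x hasFDerivAt_fst
  have h2 : HasFDerivAt (fun x : ℝ × ℝ => (x.2 : ℂ))
      (ofRealCLM.comp (ContinuousLinearMap.snd ℝ ℝ ℝ)) x :=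
    ofRealCLM.hasFDerivAt.comp x hasFDerivAt_snd
  refine ⟨_, h1.mul ((h2.mul_const I).cexp), ?_, ?_⟩ <;> simp

lemma hasFDerivAt_exp_snd (x : ℝ × ℝ) : ∃ E : ℝ × ℝ →L[ℝ] ℂ,
    HasFDerivAt (fun x : ℝ × ℝ => I * exp (x.2 * I)) E x ∧ E (0, 1) = -exp (x.2 * I) := by
  have h2 : HasFDerivAt (fun x : ℝ × ℝ => (x.2 : ℂ))
      (ofRealCLM.comp (ContinuousLinearMap.snd ℝ ℝ ℝ)) x :=
    ofRealCLM.hasFDerivAt.comp x hasFDerivAt_snd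
  refine ⟨_, ((h2.mul_const I).cexp).const_mul I, ?_⟩
  simp
  linear_combination exp (x.2 * I) * I_mul_I

lemma integrableOn_polar {F : ℂ → ℂ} (hF : ContinuousOn F (closedBall 0 1)) :
    IntegrableOn (fun x : ℝ × ℝ => (x.1 : ℂ) * F (polar x)) polarRect :=
  ContinuousOn.integrableOn_compact isCompact_Icc
    ((by fun_prop : Continuous fun x : ℝ × ℝ => (x.1 : ℂ)).continuousOn.mul
      (hF.comp continuous_polar.continuousOn fun _ hx => polar_mem hx))

/-- The Cauchy–Green formula on the unit disk, in polar coordinates. -/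
theorem green_dbar {Z a b : ℂ → ℂ} {s : Set ℂ} (hs : s.Countable)
    (hZ : ContinuousOn Z (closedBall 0 1)) (hb : ContinuousOn b (closedBall 0 1))
    (hd : ∀ z, ‖z‖ < 1 → z ∉ s → HasFDerivAt Z (wirt (a z) (b z)) z) :
    2 * ∫ x in polarRect, (x.1 : ℂ) * b (polar x) =
      ∫ t in (0:ℝ)..2 * Real.pi, exp (t * I) * Z (exp (t * I)) := by
  choose E hE hE1 hE2 using hasFDerivAt_polar
  choose J hJ hJ2 using hasFDerivAt_exp_snd
  have hZc : ContinuousOn (fun x => Z (polar x)) polarRect :=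
    hZ.comp continuous_polar.continuousOn fun _ hx => polar_mem hx
  have hπ := Real.pi_pos
  set s' : Set (ℝ × ℝ) := (Ioo (0:ℝ) 1 ×ˢ Ioo (0:ℝ) (2 * Real.pi)) ∩ polar ⁻¹' s with hs'
  have hs'c : s'.Countable :=
    MapsTo.countable_of_injOn (f := polar) (t := s) (fun x hx => hx.2)
      (polar_injOn.mono inter_subset_left) hs
  have hdom : ∀ x ∈ Ioo (0:ℝ) 1 ×ˢ Ioo (0:ℝ) (2 * Real.pi) \ s',
      HasFDerivAt (fun x => Z (polar x)) ((wirt (a (polar x)) (b (polar x))).comp (E x)) x := by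
    rintro x ⟨hx, hxs⟩
    refine (hd _ ?_ fun h => hxs ⟨hx, h⟩).comp x (hE x)
    rw [norm_polar, abs_of_pos hx.1.1]
    exact hx.1.2
  have hdiv : ∀ x : ℝ × ℝ, (polar x • (wirt (a (polar x)) (b (polar x))).comp (E x) +
        Z (polar x) • E x) (1, 0) +
      ((I * exp (x.2 * I)) • (wirt (a (polar x)) (b (polar x))).comp (E x) +
        Z (polar x) • J x) (0, 1) = 2 * ((x.1 : ℂ) * b (polar x)) := by
    intro x
    have e1 : conj (exp (x.2 * I)) * exp (x.2 * I) = 1 := by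
      rw [mul_comm, Complex.mul_conj, Complex.normSq_eq_norm_sq, Complex.norm_exp_ofReal_mul_I]
      simp
    simp only [add_apply, smul_apply,
      ContinuousLinearMap.comp_apply, hE1, hE2, hJ2, wirt_apply, smul_eq_mul, map_mul, conj_ofReal,
      conj_I]
    rw [polar]
    linear_combination (x.1 * b (x.1 * exp (x.2 * I)) * (1 - I ^ 2)) * e1 +
      (a (x.1 * exp (x.2 * I)) * x.1 * exp (x.2 * I) ^ 2 -
        x.1 * b (x.1 * exp (x.2 * I))) * I_sq
  have main := integral_divergence_prod_Icc_of_hasFDerivAt_off_countable_of_le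
    (fun x => polar x * Z (polar x)) (fun x => I * exp (x.2 * I) * Z (polar x))
    (fun x => polar x • (wirt (a (polar x)) (b (polar x))).comp (E x) + Z (polar x) • E x)
    (fun x => (I * exp (x.2 * I)) • (wirt (a (polar x)) (b (polar x))).comp (E x) +
        Z (polar x) • J x) (0, 0) (1, 2 * Real.pi) ⟨by norm_num, by simpa using hπ.le⟩ s' hs'c
    (continuous_polar.continuousOn.mul hZc)
    ((by fun_prop : Continuous fun x : ℝ × ℝ => I * exp (x.2 * I)).continuousOn.mul hZc)
    (fun x hx => (hE x).mul (hdom x hx)) (fun x hx => (hJ x).mul (hdom x hx))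
    (by simp only [hdiv]; exact (integrableOn_polar hb).const_mul 2)
  simp only [hdiv] at main
  rw [integral_const_mul] at main
  rw [main]
  have e2 : exp (2 * (Real.pi : ℂ) * I) = 1 := exp_two_pi_mul_I
  simp [polar, e2]

/-- The conjugate formula for functions vanishing on the unit circle. -/
lemma green_d_zero {Z a b : ℂ → ℂ} (hZ : ContinuousOn Z (closedBall 0 1))
    (ha : ContinuousOn a (closedBall 0 1))
    (hd : ∀ z, ‖z‖ < 1 → HasFDerivAt Z (wirt (a z) (b z)) z) (h0 : ∀ z, ‖z‖ = 1 → Z z = 0) :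
    ∫ x in polarRect, (x.1 : ℂ) * a (polar x) = 0 := by
  have h1 := green_dbar (Z := fun z => conj (Z z)) (a := fun z => conj (b z))
    (b := fun z => conj (a z)) countable_empty (continuous_conj.comp_continuousOn hZ)
    (continuous_conj.comp_continuousOn ha) (fun z hz _ => hasWirt_conj (hd z hz))
  have h2 : ∀ t : ℝ, Z (exp (t * I)) = 0 := fun t => h0 _ (norm_exp_ofReal_mul_I t)
  simp only [h2, map_zero, mul_zero, intervalIntegral.integral_zero, mul_eq_zero] at h1
  have h3 := h1.resolve_left two_ne_zero
  have h4 : ∫ x in polarRect, conj ((x.1 : ℂ) * a (polar x)) = 0 := by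
    simpa using h3
  rw [integral_conj] at h4
  simpa using h4

end

section

open Complex Metric Set MeasureTheory
open scoped ComplexConjugate Topology

lemma polynomial_hasWirt (q : Polynomial ℂ) (z : ℂ) :
    HasFDerivAt (fun z => q.eval z) (wirt ((Polynomial.derivative q).eval z) 0) z :=
  (q.hasDerivAt z).hasWirt

lemma integrableOn_polar_real {F : ℂ → ℝ} (hF : ContinuousOn F (closedBall 0 1)) :
    IntegrableOn (fun x : ℝ × ℝ => x.1 * F (polar x)) polarRect :=
  ContinuousOn.integrableOn_compact isCompact_Icc
    (continuous_fst.continuousOn.mul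
      (hF.comp continuous_polar.continuousOn fun _ hx => polar_mem hx))

/-- The mean square of a function over the unit circle, up to normalization. -/
noncomputable def circleSq (q : ℂ → ℂ) : ℝ := ∫ t in (0:ℝ)..2 * Real.pi, ‖q (exp (t * I))‖ ^ 2

lemma conj_mul_self_eq (w : ℂ) : conj w * w = ((‖w‖ ^ 2 : ℝ) : ℂ) := by
  rw [mul_comm, Complex.mul_conj, Complex.normSq_eq_norm_sq]

lemma one_sub_hasWirt (z : ℂ) :
    HasFDerivAt (fun z : ℂ => 1 - conj z * z) (wirt (-conj z) (-z)) z := by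
  have h1 := hasWirt_mul (hasWirt_conj (hasDerivAt_id z).hasWirt) (hasDerivAt_id z).hasWirt
  have h2 := hasWirt_sub (hasDerivAt_const z (1:ℂ)).hasWirt h1
  simpa using h2

/-- A Littlewood–Paley identity. -/
lemma littlewood_paley (q : Polynomial ℂ) :
    ∫ x in polarRect, x.1 * (‖q.eval (polar x)‖ ^ 2 +
      (1 - ‖polar x‖ ^ 2) * ‖(Polynomial.derivative q).eval (polar x)‖ ^ 2) =
      1 / 2 * circleSq fun z => q.eval z := by
  set q' := Polynomial.derivative q with hq'
  have hqc : Continuous fun z => q.eval z := q.continuous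
  have hqc' : Continuous fun z => q'.eval z := q'.continuous
  have hqc'' : Continuous fun z => (Polynomial.derivative q').eval z :=
    (Polynomial.derivative q').continuous
  have h1 := green_d_zero (Z := fun z => (1 - conj z * z) * (q.eval z * conj (q'.eval z)))
    (a := fun z => -conj z * (q.eval z * conj (q'.eval z)) +
      (1 - conj z * z) * (q'.eval z * conj (q'.eval z) + q.eval z * conj 0))
    (b := fun z => -z * (q.eval z * conj (q'.eval z)) +
      (1 - conj z * z) * (0 * conj (q'.eval z) +
        q.eval z * conj ((Polynomial.derivative q').eval z)))
    (by fun_prop) (by fun_prop) (fun z _ => hasWirt_mul (one_sub_hasWirt z)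
      (hasWirt_mul (polynomial_hasWirt q z) (hasWirt_conj (polynomial_hasWirt q' z))))
    (fun z hz => by rw [conj_mul_self_eq, hz]; simp)
  have h2 := green_dbar (Z := fun z => conj (z * q.eval z) * q.eval z)
    (a := fun z => conj (0 * q.eval z + z * 0) * q.eval z + conj (z * q.eval z) * q'.eval z)
    (b := fun z => conj (1 * q.eval z + z * q'.eval z) * q.eval z + conj (z * q.eval z) * 0)
    countable_empty (by fun_prop) (by fun_prop) (fun z _ _ => hasWirt_mul
      (hasWirt_conj (hasWirt_mul (hasDerivAt_id z).hasWirt (polynomial_hasWirt q z)))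
      (polynomial_hasWirt q z))
  have e1 : ∀ t : ℝ, exp (t * I) * (conj (exp (t * I) * q.eval (exp (t * I))) *
      q.eval (exp (t * I))) = ((‖q.eval (exp (t * I))‖ ^ 2 : ℝ) : ℂ) := fun t => by
    have := conj_mul_self_eq (exp (t * I))
    rw [norm_exp_ofReal_mul_I] at this
    rw [← conj_mul_self_eq, map_mul]
    linear_combination (conj (q.eval (exp (t * I))) * q.eval (exp (t * I))) * this +
      (conj (q.eval (exp (t * I))) * q.eval (exp (t * I))) * (by norm_num : ((1 ^ 2 : ℝ) : ℂ) = 1)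
  simp only [e1] at h2
  rw [intervalIntegral.integral_ofReal] at h2
  have h3 : ∫ x in polarRect, (x.1 : ℂ) * (fun z => conj (q.eval z) * q.eval z +
      (1 - conj z * z) * (q'.eval z * conj (q'.eval z))) (polar x) =
      1 / 2 * (circleSq fun z => q.eval z : ℂ) := by
    have i1 := integrableOn_polar (F := fun z => conj (1 * q.eval z + z * q'.eval z) * q.eval z +
      conj (z * q.eval z) * 0) (by fun_prop)
    have i2 := integrableOn_polar (F := fun z => -conj z * (q.eval z * conj (q'.eval z)) +
        (1 - conj z * z) * (q'.eval z * conj (q'.eval z) + q.eval z * conj 0)) (by fun_prop)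
    have i3 := integral_add i1 i2
    rw [h1, add_zero] at i3
    rw [circleSq, ← h2, ← i3, ← mul_assoc, show (1 / 2 * 2 : ℂ) = 1 by norm_num, one_mul]
    refine integral_congr_ae (Filter.Eventually.of_forall fun x => ?_)
    simp
    ring
  have h4 : ∀ x : ℝ × ℝ, (x.1 : ℂ) * (fun z => conj (q.eval z) * q.eval z +
      (1 - conj z * z) * (q'.eval z * conj (q'.eval z))) (polar x) =
      ((x.1 * (‖q.eval (polar x)‖ ^ 2 + (1 - ‖polar x‖ ^ 2) * ‖q'.eval (polar x)‖ ^ 2) : ℝ) : ℂ) :=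
    fun x => by
    dsimp only
    rw [mul_comm (q'.eval _), conj_mul_self_eq, conj_mul_self_eq, conj_mul_self_eq]
    push_cast
    ring
  simp only [h4] at h3
  have h5 := (integral_ofReal (𝕜 := ℂ) (μ := volume.restrict polarRect) (f := fun x : ℝ × ℝ =>
    x.1 * (‖q.eval (polar x)‖ ^ 2 + (1 - ‖polar x‖ ^ 2) * ‖q'.eval (polar x)‖ ^ 2)))
  have h6 := h5.symm.trans h3
  apply ofReal_injective
  refine h6.trans ?_
  push_cast
  rfl

lemma integral_polar_mono {F G : ℂ → ℝ} (hF : ContinuousOn F (closedBall 0 1))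
    (hG : ContinuousOn G (closedBall 0 1)) (h : ∀ z, ‖z‖ ≤ 1 → F z ≤ G z) :
    ∫ x in polarRect, x.1 * F (polar x) ≤ ∫ x in polarRect, x.1 * G (polar x) := by
  refine setIntegral_mono_on (integrableOn_polar_real hF) (integrableOn_polar_real hG)
    measurableSet_Icc fun x hx => ?_
  exact mul_le_mul_of_nonneg_left (h _ (by simpa using polar_mem hx)) hx.1.1

lemma integral_polar_add {F G : ℂ → ℝ} (hF : ContinuousOn F (closedBall 0 1))
    (hG : ContinuousOn G (closedBall 0 1)) :
    ∫ x in polarRect, x.1 * (F (polar x) + G (polar x)) =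
      (∫ x in polarRect, x.1 * F (polar x)) + ∫ x in polarRect, x.1 * G (polar x) := by
  rw [← integral_add (integrableOn_polar_real hF) (integrableOn_polar_real hG)]
  simp only [mul_add]

lemma integral_polar_mul (c : ℝ) (F : ℂ → ℝ) :
    ∫ x in polarRect, x.1 * (c * F (polar x)) = c * ∫ x in polarRect, x.1 * F (polar x) := by
  rw [← integral_const_mul]
  congr 1
  ext x
  ring

lemma circleSq_mul_le {g p : Polynomial ℂ} (hg : ∀ z : ℂ, ‖z‖ ≤ 1 → ‖g.eval z‖ ≤ 1) :
    circleSq (fun z => (g * p).eval z) ≤ circleSq fun z => p.eval z := by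
  have hgc : Continuous fun z => (g * p).eval z := (g * p).continuous
  have hpc : Continuous fun z => p.eval z := p.continuous
  refine intervalIntegral.integral_mono_on (by positivity)
    (Continuous.intervalIntegrable (by fun_prop) _ _)
    (Continuous.intervalIntegrable (by fun_prop) _ _) fun t _ => ?_
  simp only [Polynomial.eval_mul, norm_mul]
  have := hg (exp (t * I)) (by rw [norm_exp_ofReal_mul_I])
  gcongr
  exact mul_le_of_le_one_left (norm_nonneg _) this

lemma integral_sq_add_deriv_sq_le (p : Polynomial ℂ) :
    ∫ x in polarRect, x.1 * ((1 - ‖polar x‖ ^ 2) * (‖p.eval (polar x)‖ ^ 2 +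
      ‖(Polynomial.derivative p).eval (polar x)‖ ^ 2)) ≤ 1 / 2 * circleSq fun z => p.eval z := by
  rw [← littlewood_paley]
  have hpc : Continuous fun z => p.eval z := p.continuous
  have hpc' : Continuous fun z => (Polynomial.derivative p).eval z :=
    (Polynomial.derivative p).continuous
  refine integral_polar_mono
    (F := fun z => (1 - ‖z‖ ^ 2) * (‖p.eval z‖ ^ 2 + ‖(Polynomial.derivative p).eval z‖ ^ 2))
    (G := fun z => ‖p.eval z‖ ^ 2 + (1 - ‖z‖ ^ 2) * ‖(Polynomial.derivative p).eval z‖ ^ 2)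
    (by fun_prop) (by fun_prop) fun z hz => ?_
  nlinarith [mul_nonneg (sq_nonneg ‖z‖) (sq_nonneg ‖p.eval z‖)]

/-- `|g'|² (1 - |z|²)` is a Carleson measure when `g` is bounded by one. -/
lemma integral_deriv_mul_sq_le {g : Polynomial ℂ} (hg : ∀ z : ℂ, ‖z‖ ≤ 1 → ‖g.eval z‖ ≤ 1)
    (p : Polynomial ℂ) :
    ∫ x in polarRect, x.1 * ((1 - ‖polar x‖ ^ 2) *
      (‖(Polynomial.derivative g).eval (polar x)‖ * ‖p.eval (polar x)‖) ^ 2) ≤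
      2 * circleSq fun z => p.eval z := by
  have hpc : Continuous fun z => p.eval z := p.continuous
  have hpc' : Continuous fun z => (Polynomial.derivative p).eval z :=
    (Polynomial.derivative p).continuous
  have hgc' : Continuous fun z => (Polynomial.derivative g).eval z :=
    (Polynomial.derivative g).continuous
  have hqc : Continuous fun z => (g * p).eval z := (g * p).continuous
  have hqc' : Continuous fun z => (Polynomial.derivative (g * p)).eval z :=
    (Polynomial.derivative (g * p)).continuous
  have h1 := integral_sq_add_deriv_sq_le p
  have h2 := integral_sq_add_deriv_sq_le (g * p)
  have h3 := circleSq_mul_le (p := p) hg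
  have h4 := integral_polar_mono
    (F := fun z => (1 - ‖z‖ ^ 2) * (‖(Polynomial.derivative g).eval z‖ * ‖p.eval z‖) ^ 2)
    (G := fun z => 2 * ((1 - ‖z‖ ^ 2) * (‖p.eval z‖ ^ 2 +
      ‖(Polynomial.derivative p).eval z‖ ^ 2)) + 2 * ((1 - ‖z‖ ^ 2) * (‖(g * p).eval z‖ ^ 2 +
      ‖(Polynomial.derivative (g * p)).eval z‖ ^ 2))) (by fun_prop) (by fun_prop) fun z hz => by
    have h0 : (0:ℝ) ≤ 1 - ‖z‖ ^ 2 := by nlinarith [norm_nonneg z]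
    have h5 : ‖(Polynomial.derivative g).eval z‖ * ‖p.eval z‖ ≤
        ‖(Polynomial.derivative (g * p)).eval z‖ + ‖(Polynomial.derivative p).eval z‖ := by
      rw [← norm_mul]
      have : (Polynomial.derivative g).eval z * p.eval z =
          (Polynomial.derivative (g * p)).eval z - g.eval z * (Polynomial.derivative p).eval z := by
        simp [Polynomial.derivative_mul]
      rw [this]
      refine (norm_sub_le _ _).trans ?_
      rw [norm_mul]
      gcongr
      exact mul_le_of_le_one_left (norm_nonneg _) (hg z hz)
    have h6 : (‖(Polynomial.derivative g).eval z‖ * ‖p.eval z‖) ^ 2 ≤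
        2 * (‖p.eval z‖ ^ 2 + ‖(Polynomial.derivative p).eval z‖ ^ 2) +
        2 * (‖(g * p).eval z‖ ^ 2 + ‖(Polynomial.derivative (g * p)).eval z‖ ^ 2) := by
      have := pow_le_pow_left₀ (by positivity) h5 2
      have := sq_nonneg (‖(Polynomial.derivative (g * p)).eval z‖ -
        ‖(Polynomial.derivative p).eval z‖)
      have := sq_nonneg ‖p.eval z‖
      have := sq_nonneg ‖(g * p).eval z‖
      linarith [add_sq ‖(Polynomial.derivative (g * p)).eval z‖ ‖(Polynomial.derivative p).eval z‖,
        sub_sq ‖(Polynomial.derivative (g * p)).eval z‖ ‖(Polynomial.derivative p).eval z‖]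
    have := mul_le_mul_of_nonneg_left h6 h0
    linarith
  rw [integral_polar_add (F := fun z => 2 * ((1 - ‖z‖ ^ 2) * (‖p.eval z‖ ^ 2 +
      ‖(Polynomial.derivative p).eval z‖ ^ 2)))
      (G := fun z => 2 * ((1 - ‖z‖ ^ 2) * (‖(g * p).eval z‖ ^ 2 +
      ‖(Polynomial.derivative (g * p)).eval z‖ ^ 2))) (by fun_prop) (by fun_prop),
    integral_polar_mul 2 (fun z => (1 - ‖z‖ ^ 2) * (‖p.eval z‖ ^ 2 +
      ‖(Polynomial.derivative p).eval z‖ ^ 2)),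
    integral_polar_mul 2 (fun z => (1 - ‖z‖ ^ 2) * (‖(g * p).eval z‖ ^ 2 +
      ‖(Polynomial.derivative (g * p)).eval z‖ ^ 2))] at h4
  linarith

private lemma wolff_pointwise {A B γ m dm p k p' k' : ℝ} (hA : 0 ≤ A) (hB : 0 ≤ B)
    (hm : m ≤ B * γ) (hdm : dm ≤ A * γ ^ 2)
    (hp : 0 ≤ p) (hk : 0 ≤ k) (hp' : 0 ≤ p') (hk' : 0 ≤ k') :
    m * (p * k) + dm * (p * k) + m * (p * k + (p' * k + p * k')) ≤
      (A + 2 * B) * ((γ * p) ^ 2 + (γ * k) ^ 2 + ((p ^ 2 + p' ^ 2) + (k ^ 2 + k' ^ 2))) := by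
  have h1 : m * (2 * (p * k) + (p' * k + p * k')) ≤
      B * γ * (2 * (p * k) + (p' * k + p * k')) :=
    mul_le_mul_of_nonneg_right hm (by positivity)
  have h2 : dm * (p * k) ≤ A * γ ^ 2 * (p * k) := mul_le_mul_of_nonneg_right hdm (by positivity)
  have h3 : γ * (2 * (p * k) + (p' * k + p * k')) ≤
      2 * ((γ * p) ^ 2 + (γ * k) ^ 2 + ((p ^ 2 + p' ^ 2) + (k ^ 2 + k' ^ 2))) := by
    nlinarith [sq_nonneg (γ * p - k), sq_nonneg (γ * k - p'), sq_nonneg (γ * p - k'),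
      sq_nonneg (γ * p), sq_nonneg (γ * k), sq_nonneg p, sq_nonneg k, sq_nonneg p', sq_nonneg k']
  have h4 : γ ^ 2 * (p * k) ≤
      (γ * p) ^ 2 + (γ * k) ^ 2 + ((p ^ 2 + p' ^ 2) + (k ^ 2 + k' ^ 2)) := by
    nlinarith [sq_nonneg (γ * p - γ * k), sq_nonneg (γ * p), sq_nonneg (γ * k), sq_nonneg p,
      sq_nonneg k, sq_nonneg p', sq_nonneg k']
  have h5 := mul_le_mul_of_nonneg_left h3 hB
  have h6 := mul_le_mul_of_nonneg_left h4 hA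
  linarith

/-- Wolff's estimate for the boundary values of a solution of a `∂̄`-equation. -/
lemma wolff_estimate {g : Polynomial ℂ} (hg : ∀ z : ℂ, ‖z‖ ≤ 1 → ‖g.eval z‖ ≤ 1)
    {D m aD dm bm : ℂ → ℂ} {s : Set ℂ} (hs : s.Countable) {A B : ℝ} (hA : 0 ≤ A) (hB : 0 ≤ B)
    (hD : ContinuousOn D (closedBall 0 1)) (hm : ContinuousOn m (closedBall 0 1))
    (hdm : ContinuousOn dm (closedBall 0 1))
    (hDd : ∀ z : ℂ, ‖z‖ < 1 → z ∉ s → HasFDerivAt D (wirt (aD z) (m z)) z)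
    (hmd : ∀ z : ℂ, ‖z‖ < 1 → HasFDerivAt m (wirt (dm z) (bm z)) z)
    (hmB : ∀ z : ℂ, ‖z‖ ≤ 1 → ‖m z‖ ≤ B * ‖(Polynomial.derivative g).eval z‖)
    (hdA : ∀ z : ℂ, ‖z‖ ≤ 1 → ‖dm z‖ ≤ A * ‖(Polynomial.derivative g).eval z‖ ^ 2)
    (p k : Polynomial ℂ) :
    ‖∫ t in (0:ℝ)..2 * Real.pi, exp (t * I) *
      (D (exp (t * I)) * (p.eval (exp (t * I)) * k.eval (exp (t * I))))‖ ≤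
      5 * (A + 2 * B) * ((circleSq fun z => p.eval z) + circleSq fun z => k.eval z) := by
  set p' := Polynomial.derivative p with hp'
  set k' := Polynomial.derivative k with hk'
  set g' := Polynomial.derivative g with hg'
  have cp : Continuous fun z => p.eval z := p.continuous
  have ck : Continuous fun z => k.eval z := k.continuous
  have cp' : Continuous fun z => p'.eval z := p'.continuous
  have ck' : Continuous fun z => k'.eval z := k'.continuous
  have cg' : Continuous fun z => g'.eval z := g'.continuous
  have hpk : ∀ z : ℂ, HasFDerivAt (fun z => p.eval z * k.eval z)
      (wirt (p'.eval z * k.eval z + p.eval z * k'.eval z) 0) z := fun z => by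
    simpa using hasWirt_mul (polynomial_hasWirt p z) (polynomial_hasWirt k z)
  have h1 := green_dbar (Z := fun z => D z * (p.eval z * k.eval z))
    (b := fun z => m z * (p.eval z * k.eval z) + D z * 0) hs (by fun_prop) (by fun_prop)
    (fun z hz hzs => hasWirt_mul (hDd z hz hzs) (hpk z))
  have h2 := green_d_zero (Z := fun z => (1 - conj z * z) * (m z * (z * (p.eval z * k.eval z))))
    (a := fun z => -conj z * (m z * (z * (p.eval z * k.eval z))) + (1 - conj z * z) *
      (dm z * (z * (p.eval z * k.eval z)) + m z * (1 * (p.eval z * k.eval z) +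
        z * (p'.eval z * k.eval z + p.eval z * k'.eval z)))) (by fun_prop) (by fun_prop)
    (fun z hz => hasWirt_mul (one_sub_hasWirt z) (hasWirt_mul (hmd z hz)
      (hasWirt_mul (hasDerivAt_id z).hasWirt (hpk z))))
    (fun z hz => by rw [conj_mul_self_eq, hz]; simp)
  rw [← h1]
  have i1 := integrableOn_polar (F := fun z => m z * (p.eval z * k.eval z) + D z * 0)
    (by fun_prop)
  have i2 := integrableOn_polar (F := fun z => -conj z * (m z * (z * (p.eval z * k.eval z))) +
    (1 - conj z * z) * (dm z * (z * (p.eval z * k.eval z)) + m z * (1 * (p.eval z * k.eval z) +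
        z * (p'.eval z * k.eval z + p.eval z * k'.eval z)))) (by fun_prop)
  have i3 := integral_add i1 i2
  rw [h2, add_zero] at i3
  rw [← i3, norm_mul, show ‖(2:ℂ)‖ = 2 by simp]
  have j1 := integral_deriv_mul_sq_le hg p
  have j2 := integral_deriv_mul_sq_le hg k
  have j3 := integral_sq_add_deriv_sq_le p
  have j4 := integral_sq_add_deriv_sq_le k
  rw [← hp'] at j3
  rw [← hk'] at j4
  rw [← hg'] at j1 j2
  set G1 : ℂ → ℝ := fun z => (1 - ‖z‖ ^ 2) * (‖g'.eval z‖ * ‖p.eval z‖) ^ 2 with hG1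
  set G2 : ℂ → ℝ := fun z => (1 - ‖z‖ ^ 2) * (‖g'.eval z‖ * ‖k.eval z‖) ^ 2 with hG2
  set G3 : ℂ → ℝ := fun z => (1 - ‖z‖ ^ 2) * (‖p.eval z‖ ^ 2 + ‖p'.eval z‖ ^ 2) with hG3
  set G4 : ℂ → ℝ := fun z => (1 - ‖z‖ ^ 2) * (‖k.eval z‖ ^ 2 + ‖k'.eval z‖ ^ 2) with hG4
  have c1 : ContinuousOn G1 (closedBall 0 1) := by fun_prop
  have c2 : ContinuousOn G2 (closedBall 0 1) := by fun_prop
  have c3 : ContinuousOn G3 (closedBall 0 1) := by fun_prop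
  have c4 : ContinuousOn G4 (closedBall 0 1) := by fun_prop
  have key : ‖∫ x in polarRect, ((x.1 : ℂ) * (m (polar x) * (p.eval (polar x) * k.eval (polar x)) +
      D (polar x) * 0) + (x.1 : ℂ) * (-conj (polar x) * (m (polar x) * (polar x *
      (p.eval (polar x) * k.eval (polar x)))) + (1 - conj (polar x) * polar x) *
      (dm (polar x) * (polar x * (p.eval (polar x) * k.eval (polar x))) + m (polar x) *
      (1 * (p.eval (polar x) * k.eval (polar x)) + polar x * (p'.eval (polar x) * k.eval (polar x) +
      p.eval (polar x) * k'.eval (polar x))))))‖ ≤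
      ∫ x in polarRect, x.1 * ((A + 2 * B) * (fun z => (G1 z + G2 z) + (G3 z + G4 z)) (polar x)) := by
    refine norm_integral_le_of_norm_le (integrableOn_polar_real
      (F := fun z => (A + 2 * B) * (fun z => (G1 z + G2 z) + (G3 z + G4 z)) z) (by fun_prop)) ?_
    refine (ae_restrict_iff' measurableSet_Icc).2 (Filter.Eventually.of_forall fun x hx => ?_)
    have hx1 : ‖polar x‖ ≤ 1 := by simpa using polar_mem hx
    have hr : 0 ≤ x.1 := hx.1.1
    generalize polar x = z at hx1
    have e : (x.1 : ℂ) * (m z * (p.eval z * k.eval z) + D z * 0) + (x.1 : ℂ) * (-conj z * (m z * (z *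
        (p.eval z * k.eval z))) + (1 - conj z * z) * (dm z * (z * (p.eval z * k.eval z)) + m z *
        (1 * (p.eval z * k.eval z) + z * (p'.eval z * k.eval z + p.eval z * k'.eval z)))) =
        (x.1 : ℂ) * ((1 - conj z * z) * (m z * (p.eval z * k.eval z) + z * (dm z * (p.eval z * k.eval z))
        + m z * (p.eval z * k.eval z + z * (p'.eval z * k.eval z + p.eval z * k'.eval z)))) := by
      ring
    have h0 : (0:ℝ) ≤ 1 - ‖z‖ ^ 2 := by nlinarith [norm_nonneg z]
    have e2 : ‖(1 - conj z * z : ℂ)‖ = 1 - ‖z‖ ^ 2 := by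
      rw [conj_mul_self_eq, ← ofReal_one, ← ofReal_sub, norm_real, Real.norm_of_nonneg h0]
    have e3 : ‖m z * (p.eval z * k.eval z) + z * (dm z * (p.eval z * k.eval z))
        + m z * (p.eval z * k.eval z + z * (p'.eval z * k.eval z + p.eval z * k'.eval z))‖ ≤
        ‖m z‖ * (‖p.eval z‖ * ‖k.eval z‖) + ‖dm z‖ * (‖p.eval z‖ * ‖k.eval z‖) +
        ‖m z‖ * (‖p.eval z‖ * ‖k.eval z‖ + (‖p'.eval z‖ * ‖k.eval z‖ + ‖p.eval z‖ * ‖k'.eval z‖)) := by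
      refine (norm_add₃_le).trans ?_
      refine add_le_add (add_le_add (by simp) ?_) ?_
      · rw [norm_mul, norm_mul, norm_mul]
        exact mul_le_of_le_one_left (by positivity) hx1
      · rw [norm_mul]
        refine mul_le_mul_of_nonneg_left ((norm_add_le _ _).trans ?_) (norm_nonneg _)
        rw [norm_mul, norm_mul]
        refine add_le_add le_rfl ((mul_le_of_le_one_left (norm_nonneg _) hx1).trans ?_)
        refine (norm_add_le _ _).trans ?_
        rw [norm_mul, norm_mul]
    have e4 := wolff_pointwise hA hB (hmB z hx1) (hdA z hx1) (norm_nonneg (p.eval z))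
      (norm_nonneg (k.eval z)) (norm_nonneg (p'.eval z)) (norm_nonneg (k'.eval z))
    rw [e, norm_mul, norm_mul, e2, norm_real, Real.norm_of_nonneg hr]
    refine mul_le_mul_of_nonneg_left ((mul_le_mul_of_nonneg_left (e3.trans e4) h0).trans
      (le_of_eq ?_)) hr
    simp only [hG1, hG2, hG3, hG4]
    ring
  rw [integral_polar_mul (A + 2 * B) (fun z => (G1 z + G2 z) + (G3 z + G4 z)),
    integral_polar_add (F := fun z => G1 z + G2 z) (G := fun z => G3 z + G4 z)
      (by fun_prop) (by fun_prop), integral_polar_add c1 c2, integral_polar_add c3 c4] at key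
  have hAB : 0 ≤ A + 2 * B := by positivity
  have key2 := mul_le_mul_of_nonneg_left (add_le_add (add_le_add j1 j2) (add_le_add j3 j4)) hAB
  linarith

end

section

open Complex Metric Set MeasureTheory
open scoped ComplexConjugate Topology

private lemma schur_norm_identity (q x y : ℂ) :
    ‖x - conj q * y‖ ^ 2 - ‖y - q * x‖ ^ 2 = (1 - ‖q‖ ^ 2) * (‖x‖ ^ 2 - ‖y‖ ^ 2) := by
  simp only [← Complex.normSq_eq_norm_sq, Complex.normSq_apply]
  simp
  ring

/-- The lower triangular Toeplitz section of order `M` with symbol `Q` is a contraction. -/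
def ToeplitzContractive (M : ℕ) (Q : PowerSeries ℂ) : Prop :=
  ∀ x : PowerSeries ℂ, ∑ n ∈ Finset.range M, ‖PowerSeries.coeff n (Q * x)‖ ^ 2 ≤
    ∑ n ∈ Finset.range M, ‖PowerSeries.coeff n x‖ ^ 2

lemma toeplitzContractive_schur {M : ℕ} {Q Q1 : PowerSeries ℂ} {q0 : ℂ}
    (hQ : ToeplitzContractive (M + 1) Q) (hq : ‖q0‖ < 1) (hu : IsUnit (1 - PowerSeries.C (conj q0) * Q))
    (h : PowerSeries.X * Q1 * (1 - PowerSeries.C (conj q0) * Q) = Q - PowerSeries.C q0) :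
    ToeplitzContractive M Q1 := by
  intro x
  obtain ⟨U, hU⟩ := hu
  set x' := (PowerSeries.trunc M x : PowerSeries ℂ) with hx'
  set y := (↑U⁻¹ : PowerSeries ℂ) * x' with hy
  have hUy : (1 - PowerSeries.C (conj q0) * Q) * y = x' := by
    rw [← hU, hy, Units.mul_inv_cancel_left]
  have e1 : x' = y - PowerSeries.C (conj q0) * (Q * y) := by rw [← hUy]; ring
  have e2 : PowerSeries.X * (Q1 * x') = Q * y - PowerSeries.C q0 * y := by
    rw [← hUy]
    linear_combination y * h
  have h1 := hQ y
  have h2 : ∑ n ∈ Finset.range (M + 1), ‖PowerSeries.coeff n (PowerSeries.X * (Q1 * x'))‖ ^ 2 ≤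
      ∑ n ∈ Finset.range (M + 1), ‖PowerSeries.coeff n x'‖ ^ 2 := by
    rw [e2, ← sub_nonneg, ← Finset.sum_sub_distrib]
    rw [e1]
    simp only [map_sub, PowerSeries.coeff_C_mul, schur_norm_identity]
    rw [← Finset.mul_sum, Finset.sum_sub_distrib]
    exact mul_nonneg (by nlinarith [norm_nonneg q0]) (by linarith)
  rw [Finset.sum_range_succ', Finset.sum_range_succ] at h2
  simp only [PowerSeries.coeff_succ_X_mul] at h2
  have e3 : PowerSeries.coeff M x' = 0 := by
    simp [hx', PowerSeries.coeff_trunc]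
  have e4 : ∑ n ∈ Finset.range M, ‖PowerSeries.coeff n x'‖ ^ 2 =
      ∑ n ∈ Finset.range M, ‖PowerSeries.coeff n x‖ ^ 2 :=
    Finset.sum_congr rfl fun n hn => by
      simp [hx', PowerSeries.coeff_trunc, Finset.mem_range.1 hn]
  have e5 : ∑ n ∈ Finset.range M, ‖PowerSeries.coeff n (Q1 * x')‖ ^ 2 =
      ∑ n ∈ Finset.range M, ‖PowerSeries.coeff n (Q1 * x)‖ ^ 2 :=
    Finset.sum_congr rfl fun n hn => by
      rw [PowerSeries.coeff_mul, PowerSeries.coeff_mul]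
      congr 2
      refine Finset.sum_congr rfl fun ij hij => ?_
      have := Finset.HasAntidiagonal.mem_antidiagonal.1 hij
      have := Finset.mem_range.1 hn
      simp [hx', PowerSeries.coeff_trunc, show ij.2 < M by omega]
  rw [e3, e4, e5] at h2
  simp only [norm_zero] at h2
  nlinarith [sq_nonneg ‖PowerSeries.coeff 0 (PowerSeries.X * (Q1 * x'))‖]

private lemma trunc_dvd (M : ℕ) (Q : PowerSeries ℂ) :
    PowerSeries.X ^ M ∣ (PowerSeries.trunc M Q : PowerSeries ℂ) - Q := by
  rw [PowerSeries.X_pow_dvd_iff]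
  intro n hn
  simp [PowerSeries.coeff_trunc, hn]

private lemma schur_trunc {M : ℕ} {Q Q1 : PowerSeries ℂ} {q0 : ℂ}
    (h : PowerSeries.X * Q1 * (1 - PowerSeries.C (conj q0) * Q) = Q - PowerSeries.C q0) :
    ∃ R : Polynomial ℂ, PowerSeries.trunc (M + 1) Q *
      (1 + Polynomial.C (conj q0) * (Polynomial.X * PowerSeries.trunc M Q1)) -
      (Polynomial.C q0 + Polynomial.X * PowerSeries.trunc M Q1) = Polynomial.X ^ (M + 1) * R := by
  set T := PowerSeries.trunc (M + 1) Q
  set T1 := PowerSeries.trunc M Q1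
  have key : (Polynomial.X : Polynomial ℂ) ^ (M + 1) ∣ T *
      (1 + Polynomial.C (conj q0) * (Polynomial.X * T1)) - (Polynomial.C q0 + Polynomial.X * T1) := by
    obtain ⟨A, hA⟩ := trunc_dvd (M + 1) Q
    obtain ⟨B, hB⟩ := trunc_dvd M Q1
    have : (PowerSeries.X : PowerSeries ℂ) ^ (M + 1) ∣ ((T *
        (1 + Polynomial.C (conj q0) * (Polynomial.X * T1)) -
        (Polynomial.C q0 + Polynomial.X * T1) : Polynomial ℂ) : PowerSeries ℂ) := by
      refine ⟨A * (1 + PowerSeries.C (conj q0) * (PowerSeries.X * (T1 : PowerSeries ℂ))) +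
        Q * PowerSeries.C (conj q0) * B - B, ?_⟩
      push_cast
      linear_combination (1 + PowerSeries.C (conj q0) * (PowerSeries.X * (T1 : PowerSeries ℂ))) * hA
        + (Q * PowerSeries.C (conj q0) - 1) * PowerSeries.X * hB - h
    rw [PowerSeries.X_pow_dvd_iff] at this
    rw [Polynomial.X_pow_dvd_iff]
    intro d hd
    rw [← Polynomial.coeff_coe]
    exact this d hd
  exact key

/-- The Carathéodory–Fejér theorem, by the Schur algorithm. -/
lemma caratheodory_fejer : ∀ (M : ℕ) (Q : PowerSeries ℂ), ToeplitzContractive M Q →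
    ∃ q w : ℂ → ℂ, DifferentiableOn ℂ q (ball 0 1) ∧ DifferentiableOn ℂ w (ball 0 1) ∧
      (∀ z, ‖z‖ < 1 → ‖q z‖ ≤ 1) ∧
      ∀ z, ‖z‖ < 1 → q z = (PowerSeries.trunc M Q).eval z + z ^ M * w z
  | 0, Q, _ => ⟨0, 0, by fun_prop, by fun_prop, by simp, by simp⟩
  | M + 1, Q, hQ => by
    set q0 := PowerSeries.constantCoeff Q with hq0
    have h1 := hQ 1
    rw [mul_one, Finset.sum_range_succ', Finset.sum_range_succ' _ M] at h1
    simp only [PowerSeries.coeff_one] at h1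
    simp at h1
    rw [← hq0] at h1
    by_cases hq : ‖q0‖ < 1
    · have hc : PowerSeries.constantCoeff (1 - PowerSeries.C (conj q0) * Q) ≠ 0 := by
        simp only [map_sub, map_one, map_mul, PowerSeries.constantCoeff_C, ← hq0]
        rw [conj_mul_self_eq, ← ofReal_one, ← ofReal_sub, ofReal_ne_zero]
        nlinarith [norm_nonneg q0]
      have hu : IsUnit (1 - PowerSeries.C (conj q0) * Q) := by
        rw [PowerSeries.isUnit_iff_constantCoeff]
        exact hc.isUnit
      have hdvd : PowerSeries.X ∣ (Q - PowerSeries.C q0) := by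
        rw [PowerSeries.X_dvd_iff]
        simp [hq0]
      obtain ⟨V, hV⟩ := hdvd
      obtain ⟨U, hU⟩ := hu
      have h : PowerSeries.X * (V * (↑U⁻¹ : PowerSeries ℂ)) * (1 - PowerSeries.C (conj q0) * Q) =
          Q - PowerSeries.C q0 := by
        rw [← hU, hV, mul_assoc, Units.inv_mul_cancel_right]
      set Q1 := V * (↑U⁻¹ : PowerSeries ℂ)
      obtain ⟨s, w, hs, hw, hs1, hsw⟩ := caratheodory_fejer M Q1
        (toeplitzContractive_schur hQ hq ⟨U, hU⟩ h)
      obtain ⟨R, hR⟩ := schur_trunc (M := M) h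
      set T := PowerSeries.trunc (M + 1) Q
      set T1 := PowerSeries.trunc M Q1
      have hzs : ∀ z, ‖z‖ < 1 → ‖z * s z‖ ≤ 1 := fun z hz => by
        rw [norm_mul]
        exact mul_le_one₀ hz.le (norm_nonneg _) (hs1 z hz)
      have hden : ∀ z, ‖z‖ < 1 → 1 + conj q0 * (z * s z) ≠ 0 := fun z hz h0 => by
        have : ‖conj q0 * (z * s z)‖ = 1 := by
          rw [show conj q0 * (z * s z) = -1 by linear_combination h0]; simp
        rw [norm_mul, RCLike.norm_conj] at this
        have := mul_le_of_le_one_right (norm_nonneg q0) (hzs z hz)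
        linarith
      have hden' : DifferentiableOn ℂ (fun z => 1 + conj q0 * (z * s z)) (ball 0 1) := by fun_prop
      refine ⟨fun z => (q0 + z * s z) / (1 + conj q0 * (z * s z)),
        fun z => (-R.eval z + w z * (1 - conj q0 * T.eval z)) / (1 + conj q0 * (z * s z)),
        ?_, ?_, ?_, ?_⟩
      · exact DifferentiableOn.div (by fun_prop) hden' fun z hz => hden z (by simpa using hz)
      · have e1 : Differentiable ℂ fun z => R.eval z := R.differentiable
        have e2 : Differentiable ℂ fun z => T.eval z := T.differentiable
        exact DifferentiableOn.div (by fun_prop) hden' fun z hz => hden z (by simpa using hz)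
      · intro z hz
        dsimp only
        rw [norm_div, div_le_one (norm_pos_iff.2 (hden z hz))]
        refine le_of_sq_le_sq ?_ (norm_nonneg _)
        have := schur_norm_identity (-q0) 1 (z * s z)
        rw [norm_neg, map_neg, neg_mul, sub_neg_eq_add, neg_mul, sub_neg_eq_add, mul_one,
          norm_one, one_pow, add_comm (z * s z)] at this
        have h3 : 0 ≤ (1 - ‖q0‖ ^ 2) * (1 - ‖z * s z‖ ^ 2) :=
          mul_nonneg (by nlinarith [norm_nonneg q0])
            (by nlinarith [norm_nonneg (z * s z), hzs z hz])
        linarith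
      · intro z hz
        have hR' := congrArg (Polynomial.eval z) hR
        simp only [Polynomial.eval_sub, Polynomial.eval_mul, Polynomial.eval_add,
          Polynomial.eval_one, Polynomial.eval_C, Polynomial.eval_X, Polynomial.eval_pow] at hR'
        have hd := hden z hz
        rw [mul_div_assoc', ← sub_eq_iff_eq_add', div_sub' hd, div_left_inj' hd, hsw z hz]
        linear_combination -hR'
    · have h2 : 0 ≤ ∑ n ∈ Finset.range M, ‖PowerSeries.coeff (n + 1) Q‖ ^ 2 :=
        Finset.sum_nonneg fun _ _ => by positivity
      have h3 : 1 ≤ ‖q0‖ ^ 2 := by nlinarith [not_lt.1 hq]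
      have h4 : ∑ n ∈ Finset.range M, ‖PowerSeries.coeff (n + 1) Q‖ ^ 2 = 0 := by linarith
      rw [Finset.sum_eq_zero_iff_of_nonneg fun _ _ => by positivity] at h4
      refine ⟨fun _ => q0, 0, by fun_prop, by fun_prop, fun z _ => ?_, fun z _ => ?_⟩
      · nlinarith [norm_nonneg q0]
      · have : PowerSeries.trunc (M + 1) Q = Polynomial.C q0 := by
          ext n
          rw [PowerSeries.coeff_trunc, Polynomial.coeff_C]
          rcases n with _ | n
          · simp [hq0]
          · split_ifs with h5 h6 h6
            · simp at h6
            · have := h4 n (Finset.mem_range.2 (by omega))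
              simpa using this
            · simp at h6
            · rfl
        simp [this]

lemma integral_circle_monomial (m n : ℕ) :
    ∫ t in (0:ℝ)..2 * Real.pi, exp (t * I) ^ m * conj (exp (t * I)) ^ n =
      if m = n then (2 * Real.pi : ℂ) else 0 := by
  have e : ∀ t : ℝ, exp (t * I) ^ m * conj (exp (t * I)) ^ n =
      exp ((((m : ℂ) - n) * I) * t) := fun t => by
    rw [← exp_conj, ← exp_nat_mul, ← exp_nat_mul, ← exp_add]
    congr 1
    simp
    ring
  simp only [e]
  split_ifs with h
  · simp [h]
  · have h1 : ((m : ℂ) - n) * I ≠ 0 := mul_ne_zero (sub_ne_zero.2 (by exact_mod_cast h)) I_ne_zero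
    rw [integral_exp_mul_complex h1]
    have h2 : exp (((m : ℂ) - n) * I * ((2 * Real.pi : ℝ) : ℂ)) = 1 := by
      rw [exp_eq_one_iff]
      exact ⟨(m : ℤ) - n, by push_cast; ring⟩
    rw [h2]
    simp

lemma integral_circle_coeff (p : Polynomial ℂ) (n : ℕ) :
    ∫ t in (0:ℝ)..2 * Real.pi, p.eval (exp (t * I)) * conj (exp (t * I)) ^ n =
      2 * Real.pi * p.coeff n := by
  simp only [Polynomial.eval_eq_sum_range, Finset.sum_mul]
  rw [intervalIntegral.integral_finsetSum
    fun i _ => Continuous.intervalIntegrable (by fun_prop) _ _]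
  simp only [mul_assoc, intervalIntegral.integral_const_mul, integral_circle_monomial]
  simp only [mul_ite, mul_zero, Finset.sum_ite_eq']
  split_ifs with h
  · ring
  · rw [Polynomial.coeff_eq_zero_of_natDegree_lt (by simpa using h)]
    ring

/-- Parseval's identity for polynomials. -/
lemma circleSq_eq_sum (p : Polynomial ℂ) {M : ℕ} (hM : p.natDegree < M) :
    (circleSq fun z => p.eval z) = 2 * Real.pi * ∑ n ∈ Finset.range M, ‖p.coeff n‖ ^ 2 := by
  have hp : Continuous fun z => p.eval z := p.continuous
  apply ofReal_injective
  rw [circleSq, ← intervalIntegral.integral_ofReal]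
  have e : ∀ t : ℝ, ((‖p.eval (exp (t * I))‖ ^ 2 : ℝ) : ℂ) = ∑ n ∈ Finset.range M,
      conj (p.coeff n) * (p.eval (exp (t * I)) * conj (exp (t * I)) ^ n) := fun t => by
    rw [← conj_mul_self_eq]
    nth_rw 1 [Polynomial.eval_eq_sum_range' hM]
    rw [map_sum, Finset.sum_mul]
    refine Finset.sum_congr rfl fun n _ => ?_
    simp only [map_mul, map_pow]
    ring
  simp only [e]
  rw [intervalIntegral.integral_finsetSum
    fun i _ => Continuous.intervalIntegrable (by fun_prop) _ _]
  simp only [intervalIntegral.integral_const_mul, integral_circle_coeff]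
  push_cast
  rw [Finset.mul_sum]
  refine Finset.sum_congr rfl fun n _ => ?_
  have := conj_mul_self_eq (p.coeff n)
  push_cast at this
  linear_combination (2 * (Real.pi : ℂ)) * this

end

section

open Complex Metric Set MeasureTheory
open scoped ComplexConjugate Topology

lemma exists_laurent_approx {D : ℂ → ℂ} (hD : ContinuousOn D (closedBall 0 1)) {η : ℝ}
    (hη : 0 < η) : ∃ (M : ℕ) (P : Polynomial ℂ), 1 ≤ M ∧
      ∀ t : ℝ, ‖exp (t * I) ^ M * D (exp (t * I)) - P.eval (exp (t * I))‖ ≤ η := by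
  have : Fact ((0:ℝ) < 2 * Real.pi) := ⟨by positivity⟩
  have hz : ∀ x : AddCircle (2 * Real.pi), (AddCircle.toCircle x : ℂ) ∈ closedBall (0:ℂ) 1 :=
    fun x => by simp [Circle.norm_coe]
  let F : C(AddCircle (2 * Real.pi), ℂ) := ⟨fun x => D (AddCircle.toCircle x : ℂ),
    hD.comp_continuous (by fun_prop) hz⟩
  have hF : F ∈ closure (Submodule.span ℂ (Set.range (@fourier (2 * Real.pi))) :
      Set C(AddCircle (2 * Real.pi), ℂ)) := by
    rw [← Submodule.topologicalClosure_coe, span_fourier_closure_eq_top]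
    trivial
  obtain ⟨h, hh, hFh⟩ := Metric.mem_closure_iff.1 hF η hη
  have key : ∃ (M : ℕ) (P : Polynomial ℂ), ∀ x : AddCircle (2 * Real.pi),
      (AddCircle.toCircle x : ℂ) ^ M * h x = P.eval (AddCircle.toCircle x : ℂ) := by
    clear hFh
    induction hh using Submodule.span_induction with
    | mem h hh =>
      obtain ⟨n, rfl⟩ := hh
      refine ⟨n.natAbs, Polynomial.X ^ (n + n.natAbs).toNat, fun x => ?_⟩
      rw [fourier_apply, AddCircle.toCircle_zsmul, Polynomial.eval_pow, Polynomial.eval_X,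
        Circle.coe_zpow, ← zpow_natCast, ← zpow_natCast,
        ← zpow_add₀ (Circle.coe_ne_zero _)]
      congr 1
      omega
    | zero => exact ⟨0, 0, by simp⟩
    | add a b _ _ ha hb =>
      obtain ⟨M, P, hP⟩ := ha
      obtain ⟨M', P', hP'⟩ := hb
      refine ⟨M + M', Polynomial.X ^ M' * P + Polynomial.X ^ M * P', fun x => ?_⟩
      simp only [Polynomial.eval_add, Polynomial.eval_mul, Polynomial.eval_pow, Polynomial.eval_X,
        ← hP, ← hP', ContinuousMap.add_apply]
      ring
    | smul c a _ ha =>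
      obtain ⟨M, P, hP⟩ := ha
      refine ⟨M, Polynomial.C c * P, fun x => ?_⟩
      simp only [Polynomial.eval_mul, Polynomial.eval_C, ← hP, ContinuousMap.smul_apply,
        smul_eq_mul]
      ring
  obtain ⟨M, P, hP⟩ := key
  refine ⟨M + 1, Polynomial.X * P, by omega, fun t => ?_⟩
  have h1 : (AddCircle.toCircle (t : AddCircle (2 * Real.pi)) : ℂ) = exp (t * I) := by
    rw [AddCircle.toCircle_apply_mk, div_self (by positivity), one_mul, Circle.coe_exp]
  have h2 := hP t
  rw [h1] at h2
  rw [Polynomial.eval_mul, Polynomial.eval_X, ← h2]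
  have h3 : exp (t * I) ^ (M + 1) * D (exp (t * I)) - exp (t * I) * (exp (t * I) ^ M * h t) =
      exp (t * I) ^ (M + 1) * (F - h) t := by
    rw [ContinuousMap.sub_apply, show F t = D (exp (t * I)) by rw [← h1]; rfl]
    ring
  rw [h3, norm_mul, norm_pow, norm_exp_ofReal_mul_I, one_pow, one_mul]
  rw [dist_eq_norm] at hFh
  exact (ContinuousMap.norm_coe_le_norm _ _).trans hFh.le

private lemma circleSq_trunc (M : ℕ) (hM : 1 ≤ M) (x : PowerSeries ℂ) :
    (circleSq fun z => (PowerSeries.trunc M x).eval z) =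
      2 * Real.pi * ∑ n ∈ Finset.range M, ‖PowerSeries.coeff n x‖ ^ 2 := by
  obtain ⟨N, rfl⟩ : ∃ N, M = N + 1 := ⟨M - 1, by omega⟩
  rw [circleSq_eq_sum _ (PowerSeries.natDegree_trunc_lt x N)]
  congr 1
  refine Finset.sum_congr rfl fun n hn => ?_
  rw [PowerSeries.coeff_trunc, if_pos (Finset.mem_range.1 hn)]

lemma hankel_approx {D : ℂ → ℂ} (hD : ContinuousOn D (closedBall 0 1)) {K η : ℝ}
    (hDK : ∀ p k : Polynomial ℂ, ‖∫ t in (0:ℝ)..2 * Real.pi, exp (t * I) *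
      (D (exp (t * I)) * (p.eval (exp (t * I)) * k.eval (exp (t * I))))‖ ≤
      K * ((circleSq fun z => p.eval z) + circleSq fun z => k.eval z)) {M : ℕ} {P : Polynomial ℂ}
    (hM : 1 ≤ M)
    (hP : ∀ t : ℝ, ‖exp (t * I) ^ M * D (exp (t * I)) - P.eval (exp (t * I))‖ ≤ η)
    (p k : Polynomial ℂ) :
    2 * Real.pi * ‖(P * (p * k)).coeff (M - 1)‖ ≤
      (K + η / 2) * ((circleSq fun z => p.eval z) + circleSq fun z => k.eval z) := by
  have cp : Continuous fun z => p.eval z := p.continuous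
  have ck : Continuous fun z => k.eval z := k.continuous
  have cP : Continuous fun z => P.eval z := P.continuous
  have cD : Continuous fun t : ℝ => D (exp (t * I)) :=
    hD.comp_continuous (by fun_prop) fun t => by
      rw [mem_closedBall_zero_iff, norm_exp_ofReal_mul_I]
  have e1 : 2 * Real.pi * ‖(P * (p * k)).coeff (M - 1)‖ =
      ‖∫ t in (0:ℝ)..2 * Real.pi, (P * (p * k)).eval (exp (t * I)) *
        conj (exp (t * I)) ^ (M - 1)‖ := by
    rw [integral_circle_coeff, norm_mul, norm_mul]
    simp [abs_of_pos Real.pi_pos]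
  have e2 : ∀ t : ℝ, (P * (p * k)).eval (exp (t * I)) * conj (exp (t * I)) ^ (M - 1) =
      exp (t * I) * (D (exp (t * I)) * (p.eval (exp (t * I)) * k.eval (exp (t * I)))) -
      (exp (t * I) ^ M * D (exp (t * I)) - P.eval (exp (t * I))) * conj (exp (t * I)) ^ (M - 1) *
        (p.eval (exp (t * I)) * k.eval (exp (t * I))) := fun t => by
    obtain ⟨N, rfl⟩ : ∃ N, M = N + 1 := ⟨M - 1, by omega⟩
    have h1 : conj (exp (t * I)) * exp (t * I) = 1 := by
      rw [conj_mul_self_eq, norm_exp_ofReal_mul_I]; simp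
    have h2 : conj (exp (t * I)) ^ N * exp (t * I) ^ N = 1 := by rw [← mul_pow, h1, one_pow]
    simp only [Polynomial.eval_mul, Nat.add_sub_cancel]
    linear_combination (exp (t * I) * D (exp (t * I)) *
      (p.eval (exp (t * I)) * k.eval (exp (t * I)))) * h2
  rw [e1]
  simp only [e2]
  have c1 : Continuous fun t : ℝ => exp (t * I) := by fun_prop
  have cX : Continuous fun t : ℝ => exp (t * I) * (D (exp (t * I)) *
      (p.eval (exp (t * I)) * k.eval (exp (t * I)))) := c1.mul (cD.mul (by fun_prop))
  have cY : Continuous fun t : ℝ => (exp (t * I) ^ M * D (exp (t * I)) - P.eval (exp (t * I))) *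
      conj (exp (t * I)) ^ (M - 1) * (p.eval (exp (t * I)) * k.eval (exp (t * I))) :=
    ((((c1.pow M).mul cD).sub (by fun_prop)).mul (by fun_prop)).mul (by fun_prop)
  rw [intervalIntegral.integral_sub (cX.intervalIntegrable _ _) (cY.intervalIntegrable _ _)]
  refine (norm_sub_le _ _).trans ?_
  have h3 : ‖∫ t in (0:ℝ)..2 * Real.pi, (exp (t * I) ^ M * D (exp (t * I)) - P.eval (exp (t * I))) *
      conj (exp (t * I)) ^ (M - 1) * (p.eval (exp (t * I)) * k.eval (exp (t * I)))‖ ≤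
      ∫ t in (0:ℝ)..2 * Real.pi, η / 2 * (‖p.eval (exp (t * I))‖ ^ 2 +
        ‖k.eval (exp (t * I))‖ ^ 2) := by
    refine intervalIntegral.norm_integral_le_of_norm_le (by positivity)
      (Filter.Eventually.of_forall fun t _ => ?_)
      (Continuous.intervalIntegrable (by fun_prop) _ _)
    rw [norm_mul, norm_mul, norm_pow, RCLike.norm_conj, norm_exp_ofReal_mul_I, one_pow, mul_one,
      norm_mul]
    have hη : 0 ≤ η := (norm_nonneg _).trans (hP t)
    refine (mul_le_mul_of_nonneg_right (hP t) (by positivity)).trans ?_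
    nlinarith [mul_nonneg hη (sq_nonneg (‖p.eval (exp (t * I))‖ - ‖k.eval (exp (t * I))‖))]
  rw [intervalIntegral.integral_const_mul, intervalIntegral.integral_add
    (Continuous.intervalIntegrable (by fun_prop) _ _)
    (Continuous.intervalIntegrable (by fun_prop) _ _)] at h3
  have h4 := hDK p k
  simp only [circleSq] at h4 ⊢
  linarith

private lemma quad_bound {K S X lam : ℝ} (hK : 0 < K) (hlam : lam = 1 / (2 * K))
    (h : lam * S ≤ K * (X + lam ^ 2 * S)) : S ≤ (2 * K) ^ 2 * X := by
  have e : lam * (2 * K) = 1 := by rw [hlam]; field_simp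
  have h2 := mul_le_mul_of_nonneg_left h (by positivity : 0 ≤ 4 * K)
  have e2 : 4 * K * (lam * S) = 2 * S := by linear_combination 2 * S * e
  have e3 : 4 * K * (K * (X + lam ^ 2 * S)) = (2 * K) ^ 2 * X + S := by
    linear_combination S * (lam * (2 * K) + 1) * e
  linarith

lemma toeplitzContractive_of_hankel {K : ℝ} (hK : 0 < K) {M : ℕ} {P : Polynomial ℂ} (hM : 1 ≤ M)
    (h : ∀ p k : Polynomial ℂ, 2 * Real.pi * ‖(P * (p * k)).coeff (M - 1)‖ ≤
      K * ((circleSq fun z => p.eval z) + circleSq fun z => k.eval z)) :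
    ToeplitzContractive M (PowerSeries.C (1 / (2 * K) : ℂ) * (P : PowerSeries ℂ)) := by
  intro x
  set S := ∑ n ∈ Finset.range M, ‖PowerSeries.coeff n ((P : PowerSeries ℂ) * x)‖ ^ 2 with hS
  set X := ∑ n ∈ Finset.range M, ‖PowerSeries.coeff n x‖ ^ 2 with hX
  set lam : ℝ := 1 / (2 * K) with hlam
  set y : PowerSeries ℂ := PowerSeries.mk fun n =>
    lam * conj (PowerSeries.coeff (M - 1 - n) ((P : PowerSeries ℂ) * x)) with hy
  have hlam0 : 0 ≤ lam := by positivity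
  have h1 := h (PowerSeries.trunc M x) (PowerSeries.trunc M y)
  rw [circleSq_trunc M hM, circleSq_trunc M hM] at h1
  have hyS : ∑ n ∈ Finset.range M, ‖PowerSeries.coeff n y‖ ^ 2 = lam ^ 2 * S := by
    rw [hS, Finset.mul_sum, ← Finset.sum_range_reflect]
    refine Finset.sum_congr rfl fun n hn => ?_
    have hn := Finset.mem_range.1 hn
    rw [hy, PowerSeries.coeff_mk, norm_mul, RCLike.norm_conj, norm_real,
      Real.norm_of_nonneg hlam0, mul_pow, show M - 1 - (M - 1 - n) = n by omega]
  have hc : (P * (PowerSeries.trunc M x * PowerSeries.trunc M y)).coeff (M - 1) =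
      ((lam * S : ℝ) : ℂ) := by
    rw [← mul_assoc, Polynomial.coeff_mul,
      Finset.Nat.sum_antidiagonal_eq_sum_range_succ fun i j =>
        (P * PowerSeries.trunc M x).coeff i * (PowerSeries.trunc M y).coeff j,
      show (M - 1).succ = M by omega, hS, Finset.mul_sum, ofReal_sum]
    refine Finset.sum_congr rfl fun n hn => ?_
    have hn := Finset.mem_range.1 hn
    rw [PowerSeries.coeff_trunc, if_pos (by omega), hy, PowerSeries.coeff_mk,
      show M - 1 - (M - 1 - n) = n by omega]
    have : (P * PowerSeries.trunc M x).coeff n =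
        PowerSeries.coeff n ((P : PowerSeries ℂ) * x) := by
      rw [Polynomial.coeff_mul, PowerSeries.coeff_mul]
      refine Finset.sum_congr rfl fun ij hij => ?_
      have := Finset.HasAntidiagonal.mem_antidiagonal.1 hij
      rw [PowerSeries.coeff_trunc, if_pos (by omega), Polynomial.coeff_coe]
    rw [this]
    have e := conj_mul_self_eq (PowerSeries.coeff n ((P : PowerSeries ℂ) * x))
    rw [ofReal_mul, ← e]
    ring
  have hS0 : 0 ≤ S := Finset.sum_nonneg fun _ _ => by positivity
  rw [hc, norm_real, Real.norm_of_nonneg (by positivity), hyS] at h1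
  have h2 : lam * S ≤ K * (X + lam ^ 2 * S) := by
    have : 2 * Real.pi * (lam * S) ≤ 2 * Real.pi * (K * (X + lam ^ 2 * S)) := by linarith
    exact le_of_mul_le_mul_left this (by positivity)
  have h3 := quad_bound hK hlam h2
  have e4 : ∑ n ∈ Finset.range M,
      ‖PowerSeries.coeff n (PowerSeries.C (1 / (2 * K) : ℂ) * (P : PowerSeries ℂ) * x)‖ ^ 2 =
      lam ^ 2 * S := by
    rw [hS, Finset.mul_sum]
    refine Finset.sum_congr rfl fun n _ => ?_
    rw [mul_assoc, PowerSeries.coeff_C_mul, norm_mul, mul_pow,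
      show (1 / (2 * K) : ℂ) = ((lam : ℝ) : ℂ) by rw [hlam]; push_cast; rfl, norm_real,
      Real.norm_of_nonneg hlam0]
  rw [e4]
  have e5 : lam * (2 * K) = 1 := by rw [hlam]; field_simp
  calc lam ^ 2 * S ≤ lam ^ 2 * ((2 * K) ^ 2 * X) := by gcongr
    _ = X := by linear_combination X * (lam * (2 * K) + 1) * e5

/-- A bounded extension of Nehari type: a continuous function whose Hankel form is bounded
is uniformly close to a holomorphic function near the unit circle. -/
lemma exists_nehari {D : ℂ → ℂ} (hD : ContinuousOn D (closedBall 0 1)) {K : ℝ} (hK : 0 < K)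
    (hDK : ∀ p k : Polynomial ℂ, ‖∫ t in (0:ℝ)..2 * Real.pi, exp (t * I) *
      (D (exp (t * I)) * (p.eval (exp (t * I)) * k.eval (exp (t * I))))‖ ≤
      K * ((circleSq fun z => p.eval z) + circleSq fun z => k.eval z)) :
    ∃ w : ℂ → ℂ, DifferentiableOn ℂ w (ball 0 1) ∧
      ∃ ρ < 1, ∀ z, ρ < ‖z‖ → ‖z‖ < 1 → ‖D z - w z‖ ≤ 10 * K := by
  obtain ⟨M, P, hM, hP⟩ := exists_laurent_approx hD hK
  have hK' : 0 < K + K / 2 := by positivity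
  have hT := toeplitzContractive_of_hankel hK' hM (hankel_approx hD hDK hM hP)
  obtain ⟨q, w, hq, hw, hq1, hqw⟩ := caratheodory_fejer M _ hT
  set a : ℂ := 2 * ((K + K / 2 : ℝ) : ℂ) with ha
  have ha0 : a ≠ 0 := mul_ne_zero two_ne_zero (ofReal_ne_zero.2 hK'.ne')
  have han : ‖a‖ = 3 * K := by
    rw [ha, norm_mul, norm_real, Real.norm_of_nonneg hK'.le]
    simp
    ring
  set Q := PowerSeries.C (1 / a) * (P : PowerSeries ℂ) with hQ
  have hdvd : (Polynomial.X : Polynomial ℂ) ^ M ∣ P - Polynomial.C a * PowerSeries.trunc M Q := by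
    rw [Polynomial.X_pow_dvd_iff]
    intro d hd
    rw [Polynomial.coeff_sub, Polynomial.coeff_C_mul, PowerSeries.coeff_trunc, if_pos hd, hQ,
      PowerSeries.coeff_C_mul, Polynomial.coeff_coe]
    field_simp
    ring
  obtain ⟨P2, hP2⟩ := hdvd
  have hPe : ∀ z : ℂ, ‖z‖ < 1 → z ^ M * (P2.eval z - a * w z) = P.eval z - a * q z := fun z hz => by
    have := congrArg (Polynomial.eval z) hP2
    simp only [Polynomial.eval_sub, Polynomial.eval_mul, Polynomial.eval_C, Polynomial.eval_pow,
      Polynomial.eval_X] at this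
    rw [hqw z hz]
    linear_combination -this
  refine ⟨fun z => P2.eval z - a * w z, ?_, ?_⟩
  · have := P2.differentiable
    fun_prop
  have hPc : Continuous fun z => P.eval z := P.continuous
  have huc := (isCompact_closedBall (0:ℂ) 1).uniformContinuousOn_of_continuous
    (f := fun z => z ^ M * D z - P.eval z) (by fun_prop)
  obtain ⟨δ, hδ, hδu⟩ := Metric.uniformContinuousOn_iff.1 huc K hK
  obtain ⟨ρ, hρ1, hρ⟩ : ∃ ρ : ℝ, ρ < 1 ∧ ∀ x, ρ < x → x < 1 → 1 - x < δ ∧ 0 < x ∧ 1 / 2 < x ^ M := by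
    have : ∀ᶠ x : ℝ in 𝓝 1, 1 - x < δ ∧ 0 < x ∧ 1 / 2 < x ^ M := by
      refine (ContinuousAt.eventually_lt (by fun_prop) continuousAt_const (by simpa)).and
        ((eventually_gt_nhds one_pos).and
        (ContinuousAt.eventually_lt continuousAt_const (by fun_prop) (by norm_num)))
    obtain ⟨r, hr, hr'⟩ := Metric.eventually_nhds_iff.1 this
    refine ⟨1 - r, by linarith, fun x hx hx1 => hr' ?_⟩
    rw [Real.dist_eq, abs_lt]
    constructor <;> linarith
  refine ⟨ρ, hρ1, fun z hz hz1 => ?_⟩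
  obtain ⟨h1, h2, h3⟩ := hρ ‖z‖ hz hz1
  have hz0 : z ≠ 0 := norm_pos_iff.1 h2
  have hζ : exp (arg z * I) * ‖z‖ = z := by rw [mul_comm, norm_mul_exp_arg_mul_I]
  have hh : ‖z ^ M * D z - P.eval z‖ ≤ 2 * K := by
    have h4 := hδu z (by simpa using hz1.le) (exp (arg z * I)) (by
      rw [mem_closedBall_zero_iff, norm_exp_ofReal_mul_I]) (by
      rw [dist_comm, dist_eq_norm]
      nth_rw 2 [← hζ]
      rw [show exp (arg z * I) - exp (arg z * I) * ‖z‖ = exp (arg z * I) * ((1 - ‖z‖ : ℝ) : ℂ) by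
        push_cast; ring, norm_mul, norm_exp_ofReal_mul_I, one_mul, norm_real,
        Real.norm_of_nonneg (by linarith)]
      exact h1)
    rw [dist_eq_norm] at h4
    have h5 := hP (arg z)
    have := norm_add_le (z ^ M * D z - P.eval z - (exp (arg z * I) ^ M * D (exp (arg z * I)) -
      P.eval (exp (arg z * I)))) (exp (arg z * I) ^ M * D (exp (arg z * I)) -
      P.eval (exp (arg z * I)))
    rw [sub_add_cancel] at this
    linarith
  have h6 : z ^ M * (D z - (P2.eval z - a * w z)) = (z ^ M * D z - P.eval z) + a * q z := by
    linear_combination -(hPe z hz1)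
  have h7 : ‖z‖ ^ M * ‖D z - (P2.eval z - a * w z)‖ ≤ 5 * K := by
    rw [← norm_pow, ← norm_mul, h6]
    refine (norm_add_le _ _).trans ?_
    rw [norm_mul, han]
    have := mul_le_mul_of_nonneg_left (hq1 z hz1) (by positivity : 0 ≤ 3 * K)
    linarith
  have h8 := mul_le_mul_of_nonneg_right h3.le (norm_nonneg (D z - (P2.eval z - a * w z)))
  linarith

end

section

open Complex Metric Set MeasureTheory
open scoped ComplexConjugate Topology

lemma hasDerivAt_max_zero_pow (n : ℕ) (x : ℝ) :
    HasDerivAt (fun x : ℝ => max 0 x ^ (n + 2)) ((n + 2) * max 0 x ^ (n + 1)) x := by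
  rcases lt_trichotomy x 0 with hx | rfl | hx
  · rw [max_eq_left hx.le]
    simp only [ne_eq, Nat.add_eq_zero_iff, one_ne_zero, and_false, not_false_eq_true, zero_pow,
      mul_zero]
    refine (hasDerivAt_const x (0:ℝ)).congr_of_eventuallyEq ?_
    filter_upwards [eventually_lt_nhds hx] with y hy
    rw [max_eq_left hy.le, zero_pow (by omega)]
  · rw [hasDerivAt_iff_isLittleO_nhds_zero]
    simp only [max_self, ne_eq, Nat.add_eq_zero_iff, one_ne_zero, and_false, not_false_eq_true,
      zero_pow, mul_zero, zero_add, smul_zero, sub_zero, OfNat.ofNat_ne_zero]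
    have h1 : (fun h : ℝ => max 0 h ^ (n + 2)) =O[𝓝 0] fun h : ℝ => h ^ 2 := by
      refine Asymptotics.IsBigO.of_bound 1 ?_
      filter_upwards [eventually_lt_nhds one_pos] with y hy
      have h0 : 0 ≤ max 0 y := le_max_left _ _
      have h1 : max 0 y ≤ 1 := max_le zero_le_one hy.le
      have h2 : max 0 y ≤ |y| := max_le (abs_nonneg _) (le_abs_self _)
      rw [Real.norm_of_nonneg (by positivity), one_mul, norm_pow, Real.norm_eq_abs, pow_add]
      calc max 0 y ^ n * max 0 y ^ 2 ≤ 1 * |y| ^ 2 := by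
            gcongr
            exact pow_le_one₀ h0 h1
        _ = |y| ^ 2 := one_mul _
    exact h1.trans_isLittleO (by simpa using Asymptotics.isLittleO_pow_id (𝕜 := ℝ) one_lt_two)
  · rw [max_eq_right hx.le]
    have := hasDerivAt_pow (n + 2) x
    push_cast at this
    refine this.congr_of_eventuallyEq ?_
    filter_upwards [eventually_gt_nhds hx] with y hy
    rw [max_eq_right hy.le]

lemma hasWirt_comp_norm_sq {g : ℂ → ℂ} {z g' : ℂ} (hg : HasDerivAt g g' z) {S : ℝ → ℝ} {S' : ℝ}
    (hS : HasDerivAt S S' (‖g z‖ ^ 2)) :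
    HasFDerivAt (fun z => (S (‖g z‖ ^ 2) : ℂ)) (wirt (S' * (conj (g z) * g')) (S' * (g z * conj g')))
      z := by
  have h1 := hasWirt_mul (hasWirt_conj hg.hasWirt) hg.hasWirt
  have h2 := (reCLM.hasFDerivAt (x := conj (g z) * g z)).comp z h1
  have e : ∀ z, reCLM (conj (g z) * g z) = ‖g z‖ ^ 2 := fun z => by
    rw [conj_mul_self_eq]
    exact ofReal_re _
  have h3 : HasFDerivAt (fun z => ‖g z‖ ^ 2) _ z := h2.congr_of_eventuallyEq
    (Filter.Eventually.of_forall fun z => (e z).symm)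
  have h4 := (ofRealCLM.hasFDerivAt (x := S (‖g z‖ ^ 2))).comp z (hS.comp_hasFDerivAt z h3)
  refine h4.congr_fderiv ?_
  ext h
  simp only [wirt_apply, ContinuousLinearMap.comp_apply, smul_apply, ofRealCLM_apply,
    reCLM_apply, smul_eq_mul, ofReal_mul, map_zero, zero_mul, zero_add, mul_zero, add_zero]
  have : (((conj g' * g z) * conj h + conj (g z) * g' * h).re : ℂ) =
      (conj g' * g z) * conj h + conj (g z) * g' * h := by
    apply conj_eq_iff_re.1
    simp
    ring
  rw [add_comm (conj (g z) * g' * h), this]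
  ring

/-- A cutoff equal to one where `w = 0` and vanishing where `‖w‖² ≥ 1/γ`. -/
noncomputable def cutoff (γ : ℝ) (w : ℂ) : ℝ := max 0 (1 - γ * ‖w‖ ^ 2)

lemma cutoff_nonneg (γ : ℝ) (w : ℂ) : 0 ≤ cutoff γ w := le_max_left _ _

lemma cutoff_le_one {γ : ℝ} (hγ : 0 ≤ γ) (w : ℂ) : cutoff γ w ≤ 1 :=
  max_le zero_le_one (by nlinarith [mul_nonneg hγ (sq_nonneg ‖w‖)])

lemma continuous_cutoff (γ : ℝ) : Continuous (cutoff γ) := by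
  unfold cutoff
  fun_prop

lemma cutoff_zero (γ : ℝ) : cutoff γ 0 = 1 := by simp [cutoff]

lemma one_sub_cutoff_cube_le {γ : ℝ} (hγ : 0 ≤ γ) (w : ℂ) :
    1 - cutoff γ w ^ 3 ≤ 3 * γ * ‖w‖ ^ 2 := by
  have h1 : 1 - γ * ‖w‖ ^ 2 ≤ cutoff γ w := le_max_right _ _
  have h2 := cutoff_le_one hγ w
  have h3 := cutoff_nonneg γ w
  nlinarith [mul_nonneg h3 (sub_nonneg.2 h2), mul_nonneg (mul_nonneg h3 h3) (sub_nonneg.2 h2)]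

lemma hasWirt_cutoff_pow (g : Polynomial ℂ) (γ : ℝ) (n : ℕ) (z : ℂ) :
    HasFDerivAt (fun z => ((cutoff γ (g.eval z) ^ (n + 2) : ℝ) : ℂ))
      (wirt (-γ * (n + 2) * cutoff γ (g.eval z) ^ (n + 1) *
          (conj (g.eval z) * (Polynomial.derivative g).eval z))
        (-γ * (n + 2) * cutoff γ (g.eval z) ^ (n + 1) *
          (g.eval z * conj ((Polynomial.derivative g).eval z)))) z := by
  have h1 : HasDerivAt (fun t : ℝ => 1 - γ * t) (-γ) (‖g.eval z‖ ^ 2) := by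
    simpa using ((hasDerivAt_id (‖g.eval z‖ ^ 2)).const_mul γ).const_sub 1
  have h2 := (hasDerivAt_max_zero_pow n _).comp _ h1
  have h3 := hasWirt_comp_norm_sq (g.hasDerivAt z) h2
  refine h3.congr_fderiv ?_
  unfold cutoff
  congr 1 <;> push_cast <;> ring

end

section

open Complex Metric Set MeasureTheory
open scoped ComplexConjugate Topology

section

variable {g : Polynomial ℂ} {ε R : ℝ} {c : ℂ → ℝ}

lemma cutoff_eq_zero_of_le (hε : 0 < ε) {w : ℂ} (h : ε ^ 2 / 2 ≤ ‖w‖ ^ 2) :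
    cutoff (2 / ε ^ 2) w = 0 := by
  refine max_eq_left ?_
  have : 2 / ε ^ 2 * (ε ^ 2 / 2) = 1 := by field_simp
  have h2 := mul_le_mul_of_nonneg_left h (by positivity : 0 ≤ 2 / ε ^ 2)
  linarith

/-- The locally constant function `c` truncated to the sublevel set `‖g‖ < ε`. -/
noncomputable def truncPhase (g : Polynomial ℂ) (ε : ℝ) (c : ℂ → ℝ) (z : ℂ) : ℝ :=
  open Classical in if ‖g.eval z‖ < ε then c z else 0

lemma abs_truncPhase_le {z : ℂ} (hz : ‖g.eval z‖ < ε → |c z| ≤ Real.pi) :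
    |truncPhase g ε c z| ≤ Real.pi := by
  unfold truncPhase
  split_ifs with h
  · exact hz h
  · simpa using Real.pi_nonneg

lemma truncPhase_of_lt {z : ℂ} (h : ‖g.eval z‖ < ε) : truncPhase g ε c z = c z := if_pos h

lemma truncPhase_eventually (hε : 0 < ε) {z : ℂ}
    (hc : ‖g.eval z‖ < ε → ∀ᶠ y in 𝓝 z, c y = c z) :
    ∀ᶠ y in 𝓝 z, truncPhase g ε c y = truncPhase g ε c z ∨
      cutoff (2 / ε ^ 2) (g.eval y) = 0 := by
  have hg : Continuous fun z => ‖g.eval z‖ := g.continuous.norm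
  by_cases h : ‖g.eval z‖ < ε
  · filter_upwards [hc h, hg.continuousAt.eventually_lt continuousAt_const h] with y hy hy'
    left
    rw [truncPhase_of_lt h, truncPhase_of_lt hy', hy]
  · have h2 : ε ^ 2 / 2 < ‖g.eval z‖ ^ 2 := by nlinarith [not_lt.1 h]
    filter_upwards [continuousAt_const.eventually_lt (hg.pow 2).continuousAt h2] with y hy
    exact Or.inr (cutoff_eq_zero_of_le hε hy.le)

lemma truncPhase_mul_eventuallyEq (hε : 0 < ε) {z : ℂ}
    (hc : ‖g.eval z‖ < ε → ∀ᶠ y in 𝓝 z, c y = c z) {F : ℂ → ℂ}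
    (hF : ∀ y, cutoff (2 / ε ^ 2) (g.eval y) = 0 → F y = 0) :
    (fun y => (truncPhase g ε c y : ℂ) * F y) =ᶠ[𝓝 z] fun y => (truncPhase g ε c z : ℂ) * F y := by
  filter_upwards [truncPhase_eventually hε hc] with y hy
  rcases hy with h | h
  · rw [h]
  · rw [hF y h]
    simp

end

lemma hasWirt_const_mul {Z : ℂ → ℂ} {a b z : ℂ} (k : ℂ) (h : HasFDerivAt Z (wirt a b) z) :
    HasFDerivAt (fun z => k * Z z) (wirt (k * a) (k * b)) z := by
  simpa using hasWirt_mul (hasDerivAt_const z k).hasWirt h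

/-- Holomorphic modification of a locally constant function defined where `g` is small. -/
lemma exists_lift {ε : ℝ} (hε : 0 < ε) : ∃ C, 0 < C ∧ ∀ g : Polynomial ℂ,
    (∀ z : ℂ, ‖z‖ ≤ 1 → ‖g.eval z‖ ≤ 1) →
    (∀ z : ℂ, g.eval z = 0 → (Polynomial.derivative g).eval z ≠ 0) →
    ∀ R : ℝ, 1 < R → ∀ c : ℂ → ℝ,
    (∀ x, ‖x‖ < R → ‖g.eval x‖ < ε → |c x| ≤ Real.pi ∧ ∀ᶠ y in 𝓝 x, c y = c x) →
    ∃ Ψ : ℂ → ℂ, DifferentiableOn ℂ Ψ (ball 0 1) ∧ (∀ z, ‖z‖ < 1 → g.eval z = 0 → Ψ z = c z) ∧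
      ∃ ρ < 1, ∀ z, ρ < ‖z‖ → ‖z‖ < 1 → ‖Ψ z‖ ≤ C ∧
        (‖g.eval z‖ < ε → ‖Ψ z - c z‖ ≤ C * ‖g.eval z‖) := by
  set γ : ℝ := 2 / ε ^ 2 with hγdef
  have hγ : 0 < γ := by positivity
  set B : ℝ := 3 * Real.pi * γ with hB
  set A : ℝ := 6 * Real.pi * γ ^ 2 with hA
  have hπ := Real.pi_pos
  have hB0 : 0 < B := by positivity
  have hA0 : 0 < A := by positivity
  set K : ℝ := 5 * (A + 2 * B) with hK
  have hK0 : 0 < K := by positivity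
  refine ⟨Real.pi + 3 * Real.pi * γ + 10 * K, by positivity, fun g hg hsimp R hR c hc => ?_⟩
  set g' := Polynomial.derivative g with hg'
  have cg : Continuous fun z => g.eval z := g.continuous
  have cg' : Continuous fun z => g'.eval z := g'.continuous
  have ccut := continuous_cutoff γ
  set e : ℂ → ℝ := truncPhase g ε c with he
  have heπ : ∀ z, ‖z‖ < R → |e z| ≤ Real.pi := fun z hz =>
    abs_truncPhase_le fun h => (hc z hz h).1
  have hloc : ∀ z, ‖z‖ < R → ∀ F : ℂ → ℂ, (∀ y, cutoff γ (g.eval y) = 0 → F y = 0) →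
      (fun y => (e y : ℂ) * F y) =ᶠ[𝓝 z] fun y => (e z : ℂ) * F y := fun z hz F hF =>
    truncPhase_mul_eventuallyEq hε (fun h => (hc z hz h).2) hF
  have hg0 : g ≠ 0 := by
    rintro rfl
    exact hsimp 0 (by simp) (by simp [hg'])
  set s : Finset ℂ := g.roots.toFinset with hs
  have hsz : ∀ z, z ∈ s ↔ g.eval z = 0 := fun z => by
    rw [hs, Multiset.mem_toFinset, Polynomial.mem_roots hg0, Polynomial.IsRoot.def]
  set J := Lagrange.interpolate s id fun z => (e z : ℂ) with hJ
  have hJe : ∀ z, g.eval z = 0 → J.eval z = e z := fun z hz => by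
    have := Lagrange.eval_interpolate_at_node (fun z => (e z : ℂ)) (v := id) (s := s)
      Function.injective_id.injOn ((hsz z).2 hz)
    simpa [hJ] using this
  have cJ : Continuous fun z => J.eval z := J.continuous
  set F3 : ℂ → ℂ := fun z => ((cutoff γ (g.eval z) ^ (1 + 2) : ℝ) : ℂ) with hF3
  have cF3 : Continuous F3 := by fun_prop
  set φ : ℂ → ℂ := fun z => (e z : ℂ) * F3 z with hφ
  have hF30 : ∀ y, cutoff γ (g.eval y) = 0 → F3 y = 0 := fun y hy => by simp [hF3, hy]
  set Fm : ℂ → ℂ := fun z => (-3 * γ : ℂ) *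
    (((cutoff γ (g.eval z) ^ (0 + 2) : ℝ) : ℂ) * conj (g'.eval z)) with hFm
  have cFm : Continuous Fm := by fun_prop
  have hFm0 : ∀ y, cutoff γ (g.eval y) = 0 → Fm y = 0 := fun y hy => by simp [hFm, hy]
  set m : ℂ → ℂ := fun z => (e z : ℂ) * Fm z with hm
  set Fd : ℂ → ℂ := fun z => (6 * γ ^ 2 : ℂ) * ((cutoff γ (g.eval z) : ℂ) *
    (conj (g.eval z) * g'.eval z * conj (g'.eval z))) with hFd
  have cFd : Continuous Fd := by fun_prop
  have hFd0 : ∀ y, cutoff γ (g.eval y) = 0 → Fd y = 0 := fun y hy => by simp [hFd, hy]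
  set dm : ℂ → ℂ := fun z => (e z : ℂ) * Fd z with hdm
  set bm : ℂ → ℂ := fun z => (e z : ℂ) * ((-3 * γ : ℂ) *
    ((-γ * ((0 : ℕ) + 2) * cutoff γ (g.eval z) ^ (0 + 1) * (g.eval z * conj (g'.eval z))) *
      conj (g'.eval z) + ((cutoff γ (g.eval z) ^ (0 + 2) : ℝ) : ℂ) *
      conj ((Polynomial.derivative g').eval z))) with hbm
  set aφ : ℂ → ℂ := fun z => (e z : ℂ) *
    (-γ * ((1 : ℕ) + 2) * cutoff γ (g.eval z) ^ (1 + 1) * (conj (g.eval z) * g'.eval z)) with haφ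
  have hφd : ∀ z, ‖z‖ < R → HasFDerivAt φ (wirt (aφ z) (g.eval z * m z)) z := fun z hz => by
    have h1 := hasWirt_const_mul (e z : ℂ) (hasWirt_cutoff_pow g γ 1 z)
    refine (h1.congr_of_eventuallyEq (hloc z hz F3 hF30)).congr_fderiv ?_
    congr 1
    simp only [hm, hFm]
    push_cast
    ring
  have hmd : ∀ z, ‖z‖ < R → HasFDerivAt m (wirt (dm z) (bm z)) z := fun z hz => by
    have h1 := hasWirt_const_mul (e z : ℂ) (hasWirt_const_mul (-3 * γ : ℂ)
      (hasWirt_mul (hasWirt_cutoff_pow g γ 0 z) (hasWirt_conj (polynomial_hasWirt g' z))))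
    refine (h1.congr_of_eventuallyEq (hloc z hz Fm hFm0)).congr_fderiv ?_
    congr 1
    simp only [hdm, hFd, ← hg', map_zero]
    push_cast
    ring
  have hcont : ∀ F : ℂ → ℂ, Continuous F → (∀ y, cutoff γ (g.eval y) = 0 → F y = 0) →
      ContinuousOn (fun z => (e z : ℂ) * F z) (closedBall 0 1) := fun F hFc hF0 z hz => by
    have hz' : ‖z‖ < R := lt_of_le_of_lt (by simpa using hz) hR
    have : ContinuousAt (fun y => (e z : ℂ) * F y) z := by fun_prop
    exact (this.congr (hloc z hz' F hF0).symm).continuousWithinAt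
  have hFm_le : ∀ z, ‖Fm z‖ ≤ 3 * γ * ‖g'.eval z‖ := fun z => by
    simp only [hFm, norm_mul, RCLike.norm_conj, norm_real, norm_neg]
    rw [Real.norm_of_nonneg hγ.le, Real.norm_of_nonneg (pow_nonneg (cutoff_nonneg _ _) _)]
    have := pow_le_one₀ (n := 0 + 2) (cutoff_nonneg γ (g.eval z)) (cutoff_le_one hγ.le (g.eval z))
    have h2 := mul_le_of_le_one_left (norm_nonneg (g'.eval z)) this
    have : ‖(3:ℂ)‖ = 3 := by simp
    rw [this]
    gcongr
  have hFd_le : ∀ z, ‖z‖ ≤ 1 → ‖Fd z‖ ≤ 6 * γ ^ 2 * ‖g'.eval z‖ ^ 2 := fun z hz => by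
    simp only [hFd, norm_mul, RCLike.norm_conj, norm_real, norm_pow]
    rw [Real.norm_of_nonneg hγ.le, Real.norm_of_nonneg (cutoff_nonneg _ _)]
    have h1 := cutoff_le_one hγ.le (g.eval z)
    have h3 : cutoff γ (g.eval z) * ‖g.eval z‖ ≤ 1 :=
      mul_le_one₀ h1 (norm_nonneg _) (hg z hz)
    have h4 := mul_le_of_le_one_left (sq_nonneg ‖g'.eval z‖) h3
    have : ‖(6:ℂ)‖ = 6 := by simp
    rw [this]
    have h5 := mul_le_mul_of_nonneg_left h4 (by positivity : 0 ≤ 6 * γ ^ 2)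
    linarith
  have he' : ∀ z, ‖z‖ ≤ 1 → ‖(e z : ℂ)‖ ≤ Real.pi := fun z hz => by
    rw [norm_real]
    exact heπ z (hz.trans_lt hR)
  have hmB : ∀ z, ‖z‖ ≤ 1 → ‖m z‖ ≤ B * ‖g'.eval z‖ := fun z hz => by
    rw [hm, norm_mul]
    have := mul_le_mul (he' z hz) (hFm_le z) (norm_nonneg _) hπ.le
    rw [hB]
    linarith
  have hdA : ∀ z, ‖z‖ ≤ 1 → ‖dm z‖ ≤ A * ‖g'.eval z‖ ^ 2 := fun z hz => by
    rw [hdm, norm_mul]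
    have := mul_le_mul (he' z hz) (hFd_le z hz) (norm_nonneg _) hπ.le
    rw [hA]
    linarith
  set D : ℂ → ℂ := fun z => open Classical in if g.eval z = 0 then
    -((Polynomial.derivative J).eval z / g'.eval z) else (φ z - J.eval z) * (g.eval z)⁻¹ with hD
  have hDg : ∀ z, g.eval z * D z = φ z - J.eval z := fun z => by
    by_cases h : g.eval z = 0
    · simp only [hφ, hF3]
      rw [h, hJe z h, cutoff_zero]
      simp
    · rw [show D z = (φ z - J.eval z) * (g.eval z)⁻¹ from if_neg h]
      field_simp
  have hDd : ∀ z : ℂ, ‖z‖ < R → g.eval z ≠ 0 →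
      HasFDerivAt D (wirt ((aφ z - (Polynomial.derivative J).eval z) * (g.eval z)⁻¹ +
        (φ z - J.eval z) * (-g'.eval z / g.eval z ^ 2)) (m z)) z := fun z hz hgz => by
    have h1 := hasWirt_mul (hasWirt_sub (hφd z hz) (polynomial_hasWirt J z))
      ((g.hasDerivAt z).inv hgz).hasWirt
    refine (h1.congr_of_eventuallyEq ?_).congr_fderiv ?_
    · filter_upwards [cg.continuousAt.eventually_ne hgz] with y hy
      exact if_neg hy
    · congr 1
      rw [Pi.inv_apply]
      field_simp
      ring
  have hDc : ContinuousOn D (closedBall 0 1) := by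
    intro z hz
    have hz' : ‖z‖ < R := lt_of_le_of_lt (by simpa using hz) hR
    by_cases hgz : g.eval z = 0
    · refine ContinuousAt.continuousWithinAt ?_
      set S : ℂ → ℂ := fun w => (((cutoff γ w ^ 3 - 1 : ℝ) : ℂ)) * w⁻¹ with hS
      have hSc : ContinuousAt S 0 := by
        have hS0 : S 0 = 0 := by simp [hS]
        rw [ContinuousAt, hS0]
        refine squeeze_zero_norm (a := fun w : ℂ => 3 * γ * ‖w‖) (fun w => ?_) ?_
        · rw [hS, norm_mul, norm_real, norm_inv, Real.norm_eq_abs, abs_sub_comm, abs_of_nonneg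
            (sub_nonneg.2 (pow_le_one₀ (cutoff_nonneg _ _) (cutoff_le_one hγ.le _)))]
          rcases eq_or_ne w 0 with rfl | hw
          · simp
          · rw [← div_eq_mul_inv, div_le_iff₀ (norm_pos_iff.2 hw)]
            have := one_sub_cutoff_cube_le hγ.le w
            linarith
        · have : Continuous fun w : ℂ => 3 * γ * ‖w‖ := by fun_prop
          simpa using this.tendsto 0
      have hd1 : ContinuousAt (dslope (fun z => J.eval z) z) z :=
        continuousAt_dslope_same.2 J.differentiable.differentiableAt
      have hd2 : ContinuousAt (dslope (fun z => g.eval z) z) z :=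
        continuousAt_dslope_same.2 g.differentiable.differentiableAt
      have hd3 : dslope (fun z => g.eval z) z z ≠ 0 := by
        rw [dslope_same, Polynomial.deriv]
        exact hsimp z hgz
      have hSc' : ContinuousAt (fun y => S (g.eval y)) z :=
        ContinuousAt.comp (f := fun y => g.eval y) (g := S) (by simpa only [hgz] using hSc)
          cg.continuousAt
      have hmain : ContinuousAt (fun y => (e z : ℂ) * S (g.eval y) -
          dslope (fun z => J.eval z) z y / dslope (fun z => g.eval z) z y) z :=
        (continuousAt_const.mul hSc').sub (hd1.div hd2 hd3)
      refine hmain.congr ?_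
      filter_upwards [hloc z hz' F3 hF30, hd2.eventually_ne hd3] with y hy hy2
      by_cases hyz : y = z
      · subst hyz
        rw [dslope_same, dslope_same, Polynomial.deriv, Polynomial.deriv]
        rw [show D y = -((Polynomial.derivative J).eval y / g'.eval y) from if_pos hgz, hgz, ← hg']
        simp [hS]
      · have h1 : g.eval y = (y - z) * dslope (fun z => g.eval z) z y := by
          have := sub_smul_dslope (fun z => g.eval z) z y
          rw [hgz, sub_zero] at this
          exact this.symm
        have h2 : J.eval y - e z = (y - z) * dslope (fun z => J.eval z) z y := by
          have := sub_smul_dslope (fun z => J.eval z) z y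
          rw [hJe z hgz] at this
          exact this.symm
        have hyz' : y - z ≠ 0 := sub_ne_zero.2 hyz
        have h3 : g.eval y ≠ 0 := by
          rw [h1]
          exact mul_ne_zero hyz' hy2
        have h4 : g.eval y * D y = φ y - J.eval y := hDg y
        have h5 : dslope (fun z => J.eval z) z y / dslope (fun z => g.eval z) z y =
            (J.eval y - e z) / g.eval y := by
          rw [h1, h2, mul_div_mul_left _ _ hyz']
        apply mul_left_cancel₀ h3
        rw [h4, h5, mul_sub, mul_div_cancel₀ _ h3]
        have h6 : g.eval y * S (g.eval y) = F3 y - 1 := by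
          simp only [hS, hF3]
          rw [mul_comm (_ : ℂ) (g.eval y)⁻¹, mul_inv_cancel_left₀ h3]
          push_cast
          ring
        have h7 : φ y = (e z : ℂ) * F3 y := hy
        rw [h7]
        linear_combination (e z : ℂ) * h6
    · exact (hDd z hz' hgz).continuousAt.continuousWithinAt
  have hW := fun p k => wolff_estimate hg (s := (s : Set ℂ)) s.countable_toSet hA0.le hB0.le hDc
    (hcont Fm cFm hFm0) (hcont Fd cFd hFd0)
    (fun z hz hzs => hDd z (hz.trans hR) fun h => hzs ((hsz z).2 h))
    (fun z hz => hmd z (hz.trans hR)) hmB hdA p k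
  obtain ⟨w, hw, ρ, hρ, hwρ⟩ := exists_nehari hDc hK0 hW
  refine ⟨fun z => J.eval z + g.eval z * w z, ?_, ?_, ρ, hρ, fun z hz hz1 => ?_⟩
  · have h1 := J.differentiable
    have h2 := g.differentiable
    fun_prop
  · intro z hz hgz
    dsimp only
    rw [hgz, hJe z hgz, zero_mul, add_zero, he, truncPhase_of_lt (by rwa [hgz, norm_zero])]
  · have h1 := hwρ z hz hz1
    have h2 : J.eval z + g.eval z * w z = φ z - g.eval z * (D z - w z) := by
      linear_combination (hDg z)
    have h3 : ‖g.eval z * (D z - w z)‖ ≤ 10 * K * ‖g.eval z‖ := by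
      rw [norm_mul, mul_comm]
      gcongr
    have hgz := hg z hz1.le
    have hF31 : ‖F3 z‖ ≤ 1 := by
      rw [hF3, norm_real, Real.norm_of_nonneg (pow_nonneg (cutoff_nonneg _ _) _)]
      exact pow_le_one₀ (cutoff_nonneg _ _) (cutoff_le_one hγ.le _)
    dsimp only
    rw [h2]
    constructor
    · refine (norm_sub_le _ _).trans ?_
      have h4 : ‖φ z‖ ≤ Real.pi := by
        rw [hφ, norm_mul]
        exact (mul_le_mul (he' z hz1.le) hF31 (norm_nonneg _) hπ.le).trans (mul_one _).le
      have h5 : 10 * K * ‖g.eval z‖ ≤ 10 * K := mul_le_of_le_one_right (by positivity) hgz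
      have : 0 ≤ 3 * Real.pi * γ := by positivity
      linarith
    · intro hlt
      have hec : e z = c z := truncPhase_of_lt hlt
      have h4 : ‖φ z - c z‖ ≤ 3 * Real.pi * γ * ‖g.eval z‖ := by
        have h6 : φ z - c z = (e z : ℂ) * ((cutoff γ (g.eval z) ^ 3 - 1 : ℝ) : ℂ) := by
          simp only [hφ, hF3]
          rw [hec]
          push_cast
          ring
        rw [h6, norm_mul, norm_real (cutoff γ (g.eval z) ^ 3 - 1), Real.norm_eq_abs, abs_sub_comm,
          abs_of_nonneg
            (sub_nonneg.2 (pow_le_one₀ (cutoff_nonneg _ _) (cutoff_le_one hγ.le _)))]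
        have h7 := one_sub_cutoff_cube_le hγ.le (g.eval z)
        have h8 : ‖g.eval z‖ ^ 2 ≤ ‖g.eval z‖ := by nlinarith [norm_nonneg (g.eval z)]
        have h9 : 3 * γ * ‖g.eval z‖ ^ 2 ≤ 3 * γ * ‖g.eval z‖ := by gcongr
        have := mul_le_mul (he' z hz1.le) (h7.trans h9)
          (sub_nonneg.2 (pow_le_one₀ (cutoff_nonneg _ _) (cutoff_le_one hγ.le _))) hπ.le
        linarith
      rw [show φ z - g.eval z * (D z - w z) - c z = (φ z - c z) - g.eval z * (D z - w z) by ring]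
      refine (norm_sub_le _ _).trans ?_
      have : 0 ≤ Real.pi * ‖g.eval z‖ := by positivity
      linarith

end

section

open Complex Metric Set MeasureTheory
open scoped ComplexConjugate Topology

lemma norm_le_of_norm_le_near_circle {F : ℂ → ℂ} (hF : DifferentiableOn ℂ F (ball 0 1)) {s : Set ℂ}
    (hs : s.Finite) {ρ C : ℝ} (hρ : ρ < 1)
    (hb : ∀ z, ρ < ‖z‖ → ‖z‖ < 1 → z ∉ s → ‖F z‖ ≤ C) {z : ℂ} (hz : ‖z‖ < 1) : ‖F z‖ ≤ C := by
  have hinf : (Ioo (max (max ρ ‖z‖) 0) 1 \ (norm '' s)).Nonempty :=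
    ((Ioo_infinite (max_lt (max_lt hρ hz) one_pos)).sdiff (hs.image _)).nonempty
  obtain ⟨r, ⟨hr0, hr1⟩, hrs⟩ := hinf
  have hr : ρ < r ∧ ‖z‖ < r ∧ 0 < r := by
    simpa only [max_lt_iff, and_assoc] using hr0
  obtain ⟨h1, h2, h3⟩ := hr
  have hcl : closure (ball (0 : ℂ) r) = closedBall 0 r := closure_ball _ h3.ne'
  refine Complex.norm_le_of_forall_mem_frontier_norm_le (U := ball 0 r) isBounded_ball
    (DifferentiableOn.diffContOnCl ?_) (fun w hw => ?_) (subset_closure (by simpa using h2))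
  · rw [hcl]
    exact hF.mono (closedBall_subset_ball hr1)
  · rw [frontier_ball _ h3.ne'] at hw
    have hw' : ‖w‖ = r := by simpa using hw
    exact hb w (hw' ▸ h1) (hw' ▸ hr1) fun hmem => hrs ⟨w, hmem, hw'⟩

lemma exists_quotient {k g : ℂ → ℂ} (hk : DifferentiableOn ℂ k (ball 0 1))
    (hg : DifferentiableOn ℂ g (ball 0 1)) (h0 : ∀ z, ‖z‖ < 1 → g z = 0 → k z = 0)
    (h1 : ∀ z, ‖z‖ < 1 → g z = 0 → deriv g z ≠ 0) :
    ∃ G : ℂ → ℂ, DifferentiableOn ℂ G (ball 0 1) ∧ ∀ z, ‖z‖ < 1 → g z * G z = k z := by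
  classical
  refine ⟨fun z => if g z = 0 then deriv k z / deriv g z else k z / g z, fun z hz => ?_,
    fun z hz => ?_⟩
  · have hz' : ‖z‖ < 1 := by simpa using hz
    have hn : ball (0 : ℂ) 1 ∈ 𝓝 z := isOpen_ball.mem_nhds hz
    apply DifferentiableAt.differentiableWithinAt
    by_cases hgz : g z = 0
    · have hdk := ((Complex.differentiableOn_dslope hn).2 hk).differentiableAt hn
      have hdg := ((Complex.differentiableOn_dslope hn).2 hg).differentiableAt hn
      have hne : dslope g z z ≠ 0 := by rw [dslope_same]; exact h1 z hz' hgz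
      refine (hdk.div hdg hne).congr_of_eventuallyEq ?_
      filter_upwards [hdg.continuousAt.eventually_ne hne] with w hw
      by_cases hwz : w = z
      · subst hwz
        simp [hgz, dslope_same]
      · have e1 : (w - z) * dslope g z w = g w := by
          simpa [hgz] using sub_smul_dslope g z w
        have e2 : (w - z) * dslope k z w = k w := by
          simpa [h0 z hz' hgz] using sub_smul_dslope k z w
        have hwz' := sub_ne_zero.2 hwz
        have : g w ≠ 0 := e1 ▸ mul_ne_zero hwz' hw
        simp only [this, if_false, Pi.div_apply]
        rw [← e1, ← e2, mul_div_mul_left _ _ hwz']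
    · have hc := (hg.differentiableAt hn)
      refine ((hk.differentiableAt hn).div hc hgz).congr_of_eventuallyEq ?_
      filter_upwards [hc.continuousAt.eventually_ne hgz] with w hw
      simp [hw]
  · by_cases hgz : g z = 0
    · simp [hgz, h0 z hz hgz]
    · simp only [hgz, if_false]
      field_simp

lemma exists_small_shift_simple_roots (q : Polynomial ℂ) {η : ℝ} (hη : 0 < η) :
    ∃ δ : ℂ, ‖δ‖ ≤ η ∧ ∀ z, (q + Polynomial.C δ).eval z = 0 →
      (Polynomial.derivative (q + Polynomial.C δ)).eval z ≠ 0 := by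
  have hfin : {δ : ℂ | ∃ z, (Polynomial.derivative q).eval z = 0 ∧ q.eval z + δ = 0}.Finite := by
    by_cases hq : Polynomial.derivative q = 0
    · obtain ⟨a, ha⟩ : ∃ a, q = Polynomial.C a :=
        ⟨_, Polynomial.eq_C_of_derivative_eq_zero hq⟩
      refine (finite_singleton (-a)).subset ?_
      rintro δ ⟨z, -, h⟩
      rw [ha, Polynomial.eval_C] at h
      exact eq_neg_of_add_eq_zero_right h
    · refine ((Polynomial.finite_setOfPred_isRoot hq).image fun z => -q.eval z).subset ?_
      rintro δ ⟨z, h1, h2⟩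
      exact ⟨z, h1, (eq_neg_of_add_eq_zero_right h2).symm⟩
  have hinf : (closedBall (0 : ℂ) η).Infinite :=
    infinite_of_mem_nhds 0 (closedBall_mem_nhds 0 hη)
  obtain ⟨δ, hδ, hδ'⟩ := (hinf.sdiff hfin).nonempty
  refine ⟨δ, by simpa using hδ, fun z h1 h2 => hδ' ⟨z, ?_, ?_⟩⟩
  · simpa using h2
  · simpa using h1

lemma exists_polynomial_approx {F : ℂ → ℂ} (hF : DifferentiableOn ℂ F (ball 0 1)) {r η : ℝ}
    (hr0 : 0 < r) (hr : r < 1) (hη : 0 < η) :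
    ∃ P : Polynomial ℂ, ∀ z, ‖z‖ ≤ 1 → ‖P.eval z - F (r * z)‖ ≤ η := by
  obtain ⟨r', h1, h2⟩ := exists_between hr
  obtain ⟨R, h3, h4⟩ := exists_between h2
  lift r' to NNReal using (hr0.trans h1).le
  lift R to NNReal using ((hr0.trans h1).trans h3).le
  have hR : 0 < R := by
    have := (hr0.trans h1).trans h3
    exact_mod_cast this
  have hps := (hF.mono (closedBall_subset_ball h4)).hasFPowerSeriesOnBall hR
  have hu := hps.tendstoUniformlyOn (r' := r') (by exact_mod_cast h3)
  rw [Metric.tendstoUniformlyOn_iff] at hu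
  obtain ⟨n, hn⟩ := (hu η hη).exists
  set p := cauchyPowerSeries F 0 R
  refine ⟨(∑ k ∈ Finset.range n, Polynomial.C (p.coeff k) * Polynomial.X ^ k).comp
    (Polynomial.C (r : ℂ) * Polynomial.X), fun z hz => ?_⟩
  have hz' : (r * z : ℂ) ∈ ball (0 : ℂ) r' := by
    simp only [mem_ball, dist_zero_right, norm_mul, norm_real, Real.norm_eq_abs, abs_of_pos hr0]
    nlinarith [norm_nonneg z]
  have h5 := (hn _ hz').le
  rw [dist_comm, dist_eq_norm, zero_add] at h5
  refine le_trans (le_of_eq (congrArg (fun w => ‖w - F (r * z)‖) ?_)) h5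
  simp only [Polynomial.eval_comp, Polynomial.eval_finsetSum, Polynomial.eval_mul,
    Polynomial.eval_C, Polynomial.eval_X, Polynomial.eval_pow, FormalMultilinearSeries.partialSum,
    FormalMultilinearSeries.apply_eq_pow_smul_coeff, smul_eq_mul, mul_comm]

lemma exists_holomorphic_limit {F : ℕ → ℂ → ℂ} {C : ℝ} (hC : 0 < C)
    (hF : ∀ n, DifferentiableOn ℂ (F n) (ball 0 1)) (hb : ∀ n z, ‖z‖ < 1 → ‖F n z‖ ≤ C) :
    ∃ G : ℂ → ℂ, DifferentiableOn ℂ G (ball 0 1) ∧ (∀ z, ‖z‖ < 1 → ‖G z‖ ≤ C) ∧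
      ∀ z, ‖z‖ < 1 → Filter.Tendsto (fun n => F n z) (Filter.hyperfilter ℕ) (𝓝 (G z)) := by
  have hex : ∀ z : ℂ, ∃ a : ℂ, ‖z‖ < 1 → ‖a‖ ≤ C ∧
      Filter.Tendsto (fun n => F n z) (Filter.hyperfilter ℕ) (𝓝 a) := by
    intro z
    by_cases hz : ‖z‖ < 1
    · obtain ⟨a, ha, h⟩ := (isCompact_closedBall (0 : ℂ) C).ultrafilter_le_nhds
        ((Filter.hyperfilter ℕ).map fun n => F n z) (by
          simp only [Ultrafilter.coe_map, Filter.le_principal_iff, Filter.mem_map]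
          exact Filter.Eventually.of_forall fun n => by simpa using hb n z hz)
      exact ⟨a, fun _ => ⟨by simpa using ha, h⟩⟩
    · exact ⟨0, fun h => absurd h hz⟩
  choose G hG using hex
  refine ⟨G, ?_, fun z hz => (hG z hz).1, fun z hz => (hG z hz).2⟩
  have hlip : ∀ n x y, ‖x‖ < 1 → y ∈ ball x (1 - ‖x‖) →
      dist (F n y) (F n x) ≤ 3 * C / (1 - ‖x‖) * dist y x := by
    intro n x y hx hy
    have hsub : ball x (1 - ‖x‖) ⊆ ball 0 1 := ball_subset_ball' (by simp)
    refine Complex.dist_le_div_mul_dist_of_mapsTo_ball ((hF n).mono hsub) (fun w hw => ?_) hy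
    have hw' : ‖w‖ < 1 := by simpa using hsub hw
    rw [mem_closedBall, dist_eq_norm]
    have := norm_sub_le (F n w) (F n x)
    linarith [hb n w hw', hb n x hx]
  have hlu : TendstoLocallyUniformlyOn F G (Filter.hyperfilter ℕ : Filter ℕ) (ball 0 1) := by
    rw [Metric.tendstoLocallyUniformlyOn_iff]
    intro ε hε x hx
    have hx' : ‖x‖ < 1 := by simpa using hx
    have h1 : 0 < 1 - ‖x‖ := by linarith
    set K := 3 * C / (1 - ‖x‖) with hK
    have hK0 : 0 < K := by positivity
    refine ⟨ball x (min (1 - ‖x‖) (ε / (4 * K))), mem_nhdsWithin_of_mem_nhds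
      (ball_mem_nhds _ (by positivity)), ?_⟩
    filter_upwards [Metric.tendsto_nhds.1 (hG x hx').2 (ε / 4) (by positivity)] with n hn y hy
    have hy1 : y ∈ ball x (1 - ‖x‖) := ball_subset_ball (min_le_left _ _) hy
    have hy2 : dist y x < ε / (4 * K) := lt_of_lt_of_le hy (min_le_right _ _)
    have hy3 : ‖y‖ < 1 := by
      simpa using ball_subset_ball' (by simp : 1 - ‖x‖ + dist x 0 ≤ (1 : ℝ)) hy1
    have h2 : ∀ m, dist (F m y) (F m x) ≤ ε / 4 := fun m => by
      refine (hlip m x y hx' hy1).trans ?_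
      have := (lt_div_iff₀ (by positivity : 0 < 4 * K)).1 hy2
      linarith
    have h3 : dist (G y) (G x) ≤ ε / 4 :=
      le_of_tendsto ((hG y hy3).2.dist (hG x hx').2) (Filter.Eventually.of_forall h2)
    have h4 := dist_triangle4 (G y) (G x) (F n x) (F n y)
    rw [dist_comm (G x) (F n x), dist_comm (F n x) (F n y)] at h4
    linarith [h2 n]
  exact hlu.differentiableOn (Filter.Eventually.of_forall hF) isOpen_ball

end

section

open Complex Metric Set MeasureTheory
open scoped ComplexConjugate Topology

lemma eval_comp_const_mul (p : Polynomial ℂ) (a z : ℂ) :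
    (p.comp (Polynomial.C a * Polynomial.X)).eval z = p.eval (a * z) := by
  simp

lemma exists_reduction_polynomial {M0 : ℝ} (hM : 1 ≤ M0) : ∃ C, 0 < C ∧ ∀ f g : Polynomial ℂ,
    (∀ z, ‖z‖ ≤ 1 → ‖f.eval z‖ ≤ 1) → (∀ z, ‖z‖ ≤ 1 → ‖g.eval z‖ ≤ 1) →
    (∀ z, g.eval z = 0 → (Polynomial.derivative g).eval z ≠ 0) →
    ∀ u v : ℂ → ℂ, DifferentiableOn ℂ u (ball 0 1) → (∀ z, ‖z‖ < 1 → ‖u z‖ ≤ M0) →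
    (∀ z, ‖z‖ < 1 → ‖v z‖ ≤ M0) → (∀ z, ‖z‖ < 1 → u z * f.eval z + v z * g.eval z = 1) →
    ∀ r : ℝ, 0 < r → r < 1 → ∃ G : ℂ → ℂ, DifferentiableOn ℂ G (ball 0 1) ∧
      (∀ z, ‖z‖ < 1 → ‖G z‖ ≤ C) ∧
      ∀ z : ℂ, ‖z‖ < 1 → 1 / C ≤ ‖f.eval (r * z) + g.eval (r * z) * G z‖ := by
  obtain ⟨C1, ε, hC1, hε, hε1, hphase⟩ := exists_phase hM
  obtain ⟨C2, hC2, hlift⟩ := exists_lift hε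
  set E := Real.exp (C1 + C2) with hE
  have hE1 : 1 ≤ E := Real.one_le_exp (by positivity)
  set B := max ((C1 + C2) * Real.exp C2) ((E + 1) / ε) with hB
  have hB0 : 0 < B := lt_max_of_lt_right (by positivity)
  refine ⟨B + E, by positivity, fun f g hf hg hsimple u v hu hu0 hv0 huv r hr0 hr1 => ?_⟩
  obtain ⟨H, c, hH, hHC, hc⟩ := hphase f g hf hg u v hu hu0 hv0 huv
  have hrn : ∀ z : ℂ, ‖(r : ℂ) * z‖ = r * ‖z‖ := fun z => by
    rw [norm_mul, norm_real, Real.norm_of_nonneg hr0.le]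
  have hr : (r : ℂ) ≠ 0 := by exact_mod_cast hr0.ne'
  have hle : ∀ z : ℂ, ‖z‖ ≤ 1 → ‖(r : ℂ) * z‖ < 1 := fun z hz => by
    rw [hrn]; nlinarith [norm_nonneg z]
  set gr := g.comp (Polynomial.C (r : ℂ) * Polynomial.X) with hgr
  have hgre : ∀ z, gr.eval z = g.eval (r * z) := eval_comp_const_mul g r
  have hgrd : ∀ z, gr.eval z = 0 → (Polynomial.derivative gr).eval z ≠ 0 := fun z hz => by
    rw [hgr, Polynomial.derivative_comp]
    simpa [hr] using hsimple _ (hgre z ▸ hz)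
  obtain ⟨Ψ, hΨ, hΨ0, ρ, hρ, hΨρ⟩ := hlift gr
    (fun z hz => by rw [hgre]; exact hg _ (hle z hz).le) hgrd (1 / r)
    (by rwa [lt_div_iff₀ hr0, one_mul]) (fun z => c (r * z)) (fun x hx hgx => by
      have hx' : ‖(r : ℂ) * x‖ < 1 := by
        rw [hrn, mul_comm]; exact (lt_div_iff₀ hr0).1 hx
      rw [hgre] at hgx
      obtain ⟨h1, h2, -⟩ := hc _ hx' hgx
      exact ⟨h1, (continuous_const_mul (r : ℂ)).continuousAt.eventually h2⟩)
  have hΨC : ∀ z, ‖z‖ < 1 → ‖Ψ z‖ ≤ C2 := fun z hz =>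
    norm_le_of_norm_le_near_circle hΨ finite_empty hρ (fun w h1 h2 _ => (hΨρ w h1 h2).1) hz
  set h : ℂ → ℂ := fun z => exp (H (r * z) - I * Ψ z) with hh
  have hre : ∀ z, ‖z‖ < 1 → |(H (r * z) - I * Ψ z).re| ≤ C1 + C2 := fun z hz => by
    have h1 := hHC _ (hle z hz.le)
    have h2 : |(I * Ψ z).re| ≤ C2 := by
      refine (abs_re_le_norm _).trans ?_
      rw [norm_mul, norm_I, one_mul]
      exact hΨC z hz
    rw [sub_re]
    exact (abs_sub _ _).trans (add_le_add h1 h2)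
  have hhup : ∀ z, ‖z‖ < 1 → ‖h z‖ ≤ E := fun z hz => by
    rw [hh, hE, norm_exp]
    exact Real.exp_le_exp.2 (abs_le.1 (hre z hz)).2
  have hhlow : ∀ z, ‖z‖ < 1 → 1 / E ≤ ‖h z‖ := fun z hz => by
    rw [hh, hE, norm_exp, one_div, ← Real.exp_neg]
    exact Real.exp_le_exp.2 (abs_le.1 (hre z hz)).1
  have hmaps : MapsTo (fun z : ℂ => (r : ℂ) * z) (ball 0 1) (ball 0 1) := fun z hz => by
    simpa only [mem_ball_zero_iff] using hle z (mem_ball_zero_iff.1 hz).le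
  have hhd : DifferentiableOn ℂ h (ball 0 1) :=
    ((hH.comp (differentiable_id.const_mul _).differentiableOn hmaps).sub (hΨ.const_mul I)).cexp
  have hfd : DifferentiableOn ℂ (fun z : ℂ => f.eval (r * z)) (ball 0 1) := by
    have := (f.comp (Polynomial.C (r : ℂ) * Polynomial.X)).differentiable.differentiableOn
      (s := ball (0 : ℂ) 1)
    simpa only [eval_comp_const_mul] using this
  obtain ⟨G, hG, hgG⟩ := exists_quotient (hhd.sub hfd) gr.differentiable.differentiableOn
    (fun z hz h0 => by
      have h1 := hΨ0 z hz h0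
      rw [hgre] at h0
      have h2 := (hc _ (hle z hz.le) (by rw [h0, norm_zero]; exact hε)).2.2
      rw [h0, norm_zero, mul_zero] at h2
      simp only [Pi.sub_apply, hh, h1]
      exact norm_le_zero_iff.1 h2)
    (fun z hz h0 => by rw [Polynomial.deriv]; exact hgrd z h0)
  have hgr0 : gr ≠ 0 := fun h0 => by
    have := hgrd 0 (by rw [h0, Polynomial.eval_zero])
    rw [h0] at this
    simp at this
  have hkey : ∀ z, ρ < ‖z‖ → ‖z‖ < 1 → ‖h z - f.eval (r * z)‖ ≤ B * ‖gr.eval z‖ := by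
    intro z h1 h2
    have hf1 := hf _ (hle z h2.le).le
    by_cases hlt : ‖gr.eval z‖ < ε
    · obtain ⟨-, hΨc⟩ := hΨρ z h1 h2
      have h3 := hΨc hlt
      have hlt' := hlt
      rw [hgre] at hlt'
      obtain ⟨-, -, h4⟩ := hc _ (hle z h2.le) hlt'
      rw [← hgre] at h4
      have hg1 : ‖gr.eval z‖ ≤ 1 := hlt.le.trans hε1
      set d : ℂ := -(I * (Ψ z - c (r * z))) with hd
      have hdn : ‖d‖ = ‖Ψ z - c (r * z)‖ := by rw [hd, norm_neg, norm_mul, norm_I, one_mul]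
      have hd2 : ‖d‖ ≤ C2 := hdn ▸ h3.trans (mul_le_of_le_one_right hC2.le hg1)
      have e1 : h z - f.eval (r * z) = (exp (H (r * z) - I * c (r * z)) - f.eval (r * z)) * exp d
          + f.eval (r * z) * (exp d - 1) := by
        have : h z = exp (H (r * z) - I * c (r * z)) * exp d := by
          change exp (H (r * z) - I * Ψ z) = _
          rw [← exp_add, hd]
          congr 1
          ring
        rw [this]
        ring
      have h5 : ‖exp d‖ ≤ Real.exp C2 := (norm_exp_le_exp_norm d).trans (Real.exp_le_exp.2 hd2)
      have h6 : ‖exp d - 1‖ ≤ C2 * ‖gr.eval z‖ * Real.exp C2 :=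
        (norm_exp_sub_one_le_mul_exp d).trans
          (mul_le_mul (hdn ▸ h3) (Real.exp_le_exp.2 hd2) (Real.exp_pos _).le (by positivity))
      rw [e1]
      refine (norm_add_le _ _).trans ?_
      rw [norm_mul, norm_mul]
      have h7 := mul_le_mul h4 h5 (norm_nonneg _) (by positivity)
      have h8 := mul_le_mul hf1 h6 (norm_nonneg _) zero_le_one
      have h9 : (C1 + C2) * Real.exp C2 * ‖gr.eval z‖ ≤ B * ‖gr.eval z‖ :=
        mul_le_mul_of_nonneg_right (le_max_left _ _) (norm_nonneg _)
      linarith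
    · have h3 : ‖h z - f.eval (r * z)‖ ≤ E + 1 :=
        (norm_sub_le _ _).trans (add_le_add (hhup z h2) hf1)
      have h4 : (E + 1) / ε * ‖gr.eval z‖ ≤ B * ‖gr.eval z‖ :=
        mul_le_mul_of_nonneg_right (le_max_right _ _) (norm_nonneg _)
      have h5 : E + 1 ≤ (E + 1) / ε * ‖gr.eval z‖ := by
        rw [div_mul_eq_mul_div, le_div_iff₀ hε]
        exact mul_le_mul_of_nonneg_left (not_lt.1 hlt) (by linarith)
      linarith
  refine ⟨G, hG, fun z hz => ?_, fun z hz => ?_⟩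
  · have h1 : ‖G z‖ ≤ B := by
      refine norm_le_of_norm_le_near_circle hG (Polynomial.finite_setOfPred_isRoot hgr0) hρ
        (fun w h1 h2 h3 => ?_) hz
      have h3' : 0 < ‖gr.eval w‖ := norm_pos_iff.2 h3
      have h4 := hkey w h1 h2
      have h5 := hgG w h2
      simp only [Pi.sub_apply] at h5
      rw [← h5, norm_mul, mul_comm] at h4
      exact le_of_mul_le_mul_right h4 h3'
    linarith
  · have h1 := hgG z hz
    simp only [Pi.sub_apply] at h1
    rw [← hgre, h1, add_sub_cancel]
    exact (one_div_le_one_div_of_le (by linarith) (by linarith)).trans (hhlow z hz)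

end

section

open Complex Metric Set MeasureTheory
open scoped ComplexConjugate Topology

lemma exists_reduction_dilation {M0 : ℝ} (hM : 1 ≤ M0) : ∃ C, 0 < C ∧ ∀ f g u v : ℂ → ℂ,
    DifferentiableOn ℂ f (ball 0 1) → DifferentiableOn ℂ g (ball 0 1) →
    DifferentiableOn ℂ u (ball 0 1) → DifferentiableOn ℂ v (ball 0 1) →
    (∀ z, ‖z‖ < 1 → ‖f z‖ ≤ 1 / 2) → (∀ z, ‖z‖ < 1 → ‖g z‖ ≤ 1 / 2) →
    (∀ z, ‖z‖ < 1 → ‖u z‖ ≤ M0) → (∀ z, ‖z‖ < 1 → ‖v z‖ ≤ M0) →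
    (∀ z, ‖z‖ < 1 → u z * f z + v z * g z = 1) →
    ∀ r : ℝ, 0 < r → r < 1 → ∃ G : ℂ → ℂ, DifferentiableOn ℂ G (ball 0 1) ∧
      (∀ z, ‖z‖ < 1 → ‖G z‖ ≤ C) ∧
      ∀ z : ℂ, ‖z‖ < 1 → 1 / C ≤ ‖f (r * (r * z)) + g (r * (r * z)) * G z‖ := by
  obtain ⟨C, hC, hred⟩ := exists_reduction_polynomial (M0 := 2 * M0) (by linarith)
  refine ⟨2 * C, by positivity, fun f g u v hf hg hu hv hf0 hg0 hu0 hv0 huv r hr0 hr1 => ?_⟩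
  obtain ⟨η, hη, hη1, hη2, hη3⟩ : ∃ η : ℝ, 0 < η ∧ η ≤ 1 / 4 ∧ 4 * M0 * η ≤ 1 / 2 ∧
      η + 2 * η * C ≤ 1 / (2 * C) := by
    have h1 : 0 < 1 / (2 * C) := by positivity
    refine ⟨min (1 / 4) (min (1 / (8 * M0)) (1 / (2 * C) / (1 + 2 * C))), by positivity,
      min_le_left _ _, ?_, ?_⟩
    · have : min (1 / 4) (min (1 / (8 * M0)) (1 / (2 * C) / (1 + 2 * C))) ≤ 1 / (8 * M0) :=
        (min_le_right _ _).trans (min_le_left _ _)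
      rw [le_div_iff₀ (by positivity)] at this
      linarith
    · have : min (1 / 4) (min (1 / (8 * M0)) (1 / (2 * C) / (1 + 2 * C))) ≤
          1 / (2 * C) / (1 + 2 * C) := (min_le_right _ _).trans (min_le_right _ _)
      rw [le_div_iff₀ (by positivity)] at this
      linarith
  obtain ⟨p, hp⟩ := exists_polynomial_approx hf hr0 hr1 hη
  obtain ⟨q', hq'⟩ := exists_polynomial_approx hg hr0 hr1 hη
  obtain ⟨δ, hδ, hq0⟩ := exists_small_shift_simple_roots q' hη
  set q := q' + Polynomial.C δ with hqdef
  have hq : ∀ z, ‖z‖ ≤ 1 → ‖q.eval z - g (r * z)‖ ≤ 2 * η := fun z hz => by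
    rw [hqdef, Polynomial.eval_add, Polynomial.eval_C, add_sub_right_comm]
    refine (norm_add_le _ _).trans ?_
    linarith [hq' z hz]
  have hle : ∀ z : ℂ, ‖z‖ ≤ 1 → ‖(r : ℂ) * z‖ < 1 := fun z hz => by
    rw [norm_mul, norm_real, Real.norm_of_nonneg hr0.le]
    nlinarith [norm_nonneg z]
  have hmaps : MapsTo (fun z : ℂ => (r : ℂ) * z) (ball 0 1) (ball 0 1) := fun z hz => by
    simpa only [mem_ball_zero_iff] using hle z (mem_ball_zero_iff.1 hz).le
  have hdil : ∀ {F : ℂ → ℂ}, DifferentiableOn ℂ F (ball 0 1) →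
      DifferentiableOn ℂ (fun z : ℂ => F (r * z)) (ball 0 1) := fun hF =>
    hF.comp (differentiable_id.const_mul _).differentiableOn hmaps
  set e : ℂ → ℂ := fun z => u (r * z) * p.eval z + v (r * z) * q.eval z with he
  have he1 : ∀ z, ‖z‖ < 1 → ‖e z - 1‖ ≤ 1 / 2 := fun z hz => by
    have h0 := hle z hz.le
    have h1 : e z - 1 = u (r * z) * (p.eval z - f (r * z)) + v (r * z) * (q.eval z - g (r * z)) := by
      rw [← huv _ h0]
      simp only [he]
      ring
    rw [h1]
    refine (norm_add_le _ _).trans ?_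
    rw [norm_mul, norm_mul]
    have h2 := mul_le_mul (hu0 _ h0) (hp z hz.le) (norm_nonneg _) (by linarith)
    have h3 := mul_le_mul (hv0 _ h0) (hq z hz.le) (norm_nonneg _) (by linarith)
    nlinarith
  have hen : ∀ z, ‖z‖ < 1 → 1 / 2 ≤ ‖e z‖ := fun z hz => by
    have h1 := he1 z hz
    have h2 := norm_sub_norm_le (1 : ℂ) (e z)
    rw [norm_one, norm_sub_rev] at h2
    linarith
  have he0 : ∀ z, ‖z‖ < 1 → e z ≠ 0 := fun z hz =>
    norm_pos_iff.1 (lt_of_lt_of_le (by norm_num) (hen z hz))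
  have hed : DifferentiableOn ℂ e (ball 0 1) :=
    ((hdil hu).mul p.differentiable.differentiableOn).add
      ((hdil hv).mul q.differentiable.differentiableOn)
  have hdiv : ∀ {a : ℂ} {z : ℂ}, ‖z‖ < 1 → ‖a‖ ≤ M0 → ‖a / e z‖ ≤ 2 * M0 := fun {a z} hz ha => by
    rw [norm_div, div_le_iff₀ (norm_pos_iff.2 (he0 z hz))]
    nlinarith [hen z hz]
  obtain ⟨G, hG, hGC, hlow⟩ := hred p q
    (fun z hz => by
      have h1 := norm_sub_norm_le (p.eval z) (f (r * z))
      linarith [hp z hz, hf0 _ (hle z hz)])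
    (fun z hz => by
      have h1 := norm_sub_norm_le (q.eval z) (g (r * z))
      linarith [hq z hz, hg0 _ (hle z hz)])
    hq0 (fun z => u (r * z) / e z) (fun z => v (r * z) / e z)
    ((hdil hu).div hed fun z hz => he0 z (mem_ball_zero_iff.1 hz))
    (fun z hz => hdiv hz (hu0 _ (hle z hz.le))) (fun z hz => hdiv hz (hv0 _ (hle z hz.le)))
    (fun z hz => by
      rw [div_mul_eq_mul_div, div_mul_eq_mul_div, ← add_div]
      exact div_self (he0 z hz)) r hr0 hr1
  refine ⟨G, hG, fun z hz => (hGC z hz).trans (by linarith), fun z hz => ?_⟩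
  have h1 := hlow z hz
  have h2 := hp _ (hle z hz.le).le
  have h3 := hq _ (hle z hz.le).le
  have h4 : p.eval (r * z) + q.eval (r * z) * G z - (f (r * (r * z)) + g (r * (r * z)) * G z) =
      (p.eval (r * z) - f (r * (r * z))) + (q.eval (r * z) - g (r * (r * z))) * G z := by ring
  have h5 := norm_sub_norm_le (p.eval (r * z) + q.eval (r * z) * G z)
    (f (r * (r * z)) + g (r * (r * z)) * G z)
  have h6 := norm_add_le (p.eval (r * z) - f (r * (r * z)))
    ((q.eval (r * z) - g (r * (r * z))) * G z)
  rw [h4] at h5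
  rw [norm_mul] at h6
  have h7 := mul_le_mul h3 (hGC z hz) (norm_nonneg _) (by positivity)
  have h8 : 1 / C = 2 * (1 / (2 * C)) := by field_simp
  linarith

lemma exists_reduction {M0 : ℝ} (hM : 1 ≤ M0) {f g u v : ℂ → ℂ}
    (hf : DifferentiableOn ℂ f (ball 0 1)) (hg : DifferentiableOn ℂ g (ball 0 1))
    (hu : DifferentiableOn ℂ u (ball 0 1)) (hv : DifferentiableOn ℂ v (ball 0 1))
    (hf0 : ∀ z, ‖z‖ < 1 → ‖f z‖ ≤ 1 / 2) (hg0 : ∀ z, ‖z‖ < 1 → ‖g z‖ ≤ 1 / 2)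
    (hu0 : ∀ z, ‖z‖ < 1 → ‖u z‖ ≤ M0) (hv0 : ∀ z, ‖z‖ < 1 → ‖v z‖ ≤ M0)
    (huv : ∀ z, ‖z‖ < 1 → u z * f z + v z * g z = 1) :
    ∃ (G : ℂ → ℂ) (C : ℝ), 0 < C ∧ DifferentiableOn ℂ G (ball 0 1) ∧
      (∀ z, ‖z‖ < 1 → ‖G z‖ ≤ C) ∧ ∀ z : ℂ, ‖z‖ < 1 → 1 / C ≤ ‖f z + g z * G z‖ := by
  obtain ⟨C, hC, hred⟩ := exists_reduction_dilation hM
  obtain ⟨r, -, hr, hrt⟩ := exists_seq_strictMono_tendsto' (zero_lt_one' ℝ)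
  choose G hG hGC hlow using fun n =>
    hred f g u v hf hg hu hv hf0 hg0 hu0 hv0 huv (r n) (hr n).1 (hr n).2
  obtain ⟨G', hG', hGC', hlim⟩ := exists_holomorphic_limit hC hG hGC
  refine ⟨G', C, hC, hG', hGC', fun z hz => ?_⟩
  have hr1 : Filter.Tendsto (fun n => (r n : ℂ) * (r n * z)) (Filter.hyperfilter ℕ) (𝓝 z) := by
    have h1 : Filter.Tendsto (fun n => (r n : ℂ)) Filter.atTop (𝓝 1) := by
      have := (continuous_ofReal.tendsto 1).comp hrt
      rwa [ofReal_one] at this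
    have h2 := h1.mul (h1.mul_const z)
    rw [one_mul, one_mul] at h2
    exact h2.mono_left Nat.hyperfilter_le_atTop
  have hn : ball (0 : ℂ) 1 ∈ 𝓝 z := isOpen_ball.mem_nhds (mem_ball_zero_iff.2 hz)
  have hF := (hf.differentiableAt hn).continuousAt.tendsto.comp hr1
  have hGl := (hg.differentiableAt hn).continuousAt.tendsto.comp hr1
  exact ge_of_tendsto (hF.add (hGl.mul (hlim z hz))).norm
    (Filter.Eventually.of_forall fun n => hlow n z hz)

end

end HinfReduction

/-- **`H^∞` is a B-ring (Bass stable rank one).** If `(f, g)` is a unimodular pair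
in `H^∞(𝔻)`, i.e. `u·f + v·g = 1` on `𝔻` for some `u, v ∈ H^∞`, then there exists
`G ∈ H^∞` such that `f + g·G` is invertible in `H^∞`, i.e.
`inf_{z ∈ 𝔻} |f(z) + g(z)·G(z)| > 0`. -/
theorem Hinf_disk_Bring (f g u v : ℂ → ℂ)
    (hf : MemHinf f) (hg : MemHinf g) (hu : MemHinf u) (hv : MemHinf v)
    (hunim : ∀ z ∈ Metric.ball (0 : ℂ) 1, u z * f z + v z * g z = 1) :
    ∃ G : ℂ → ℂ, MemHinf G ∧
      ∃ ε : ℝ, 0 < ε ∧ ∀ z ∈ Metric.ball (0 : ℂ) 1, ε ≤ ‖f z + g z * G z‖ := by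
  obtain ⟨hf, Mf, hfM⟩ := hf
  obtain ⟨hg, Mg, hgM⟩ := hg
  obtain ⟨hu, Mu, huM⟩ := hu
  obtain ⟨hv, Mv, hvM⟩ := hv
  obtain ⟨N, hN, hNf, hNg, hNu, hNv⟩ : ∃ N : ℝ, 1 ≤ N ∧ Mf ≤ N ∧ Mg ≤ N ∧ Mu ≤ N ∧ Mv ≤ N :=
    ⟨max 1 (max (max Mf Mg) (max Mu Mv)), by simp⟩
  simp only [mem_ball_zero_iff] at hfM hgM huM hvM hunim
  have hN0 : (N : ℂ) ≠ 0 := by exact_mod_cast (by linarith : N ≠ 0)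
  have hNn : ‖(2 * N : ℂ)‖ = 2 * N := by
    rw [norm_mul, Complex.norm_real, Real.norm_of_nonneg (by linarith)]
    norm_num
  have hdiv : ∀ {a : ℂ}, ‖a‖ ≤ N → ‖a / (2 * N)‖ ≤ 1 / 2 := fun ha => by
    rw [norm_div, hNn, div_le_iff₀ (by linarith)]
    linarith
  have hmul : ∀ {a : ℂ}, ‖a‖ ≤ N → ‖2 * N * a‖ ≤ 2 * N ^ 2 := fun ha => by
    rw [norm_mul, hNn]
    nlinarith
  obtain ⟨G, C, hC, hG, hGC, hlow⟩ := HinfReduction.exists_reduction (M0 := 2 * N ^ 2) (by nlinarith)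
    (hf.div_const (2 * N)) (hg.div_const (2 * N)) (hu.const_mul (2 * (N : ℂ)))
    (hv.const_mul (2 * (N : ℂ)))
    (fun z hz => hdiv ((hfM z hz).trans hNf)) (fun z hz => hdiv ((hgM z hz).trans hNg))
    (fun z hz => hmul ((huM z hz).trans hNu)) (fun z hz => hmul ((hvM z hz).trans hNv))
    (fun z hz => by
      rw [← hunim z hz]
      field_simp)
  refine ⟨G, ⟨hG, C, fun z hz => hGC z (mem_ball_zero_iff.1 hz)⟩, 1 / C, by positivity,
    fun z hz => (hlow z (mem_ball_zero_iff.1 hz)).trans ?_⟩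
  rw [div_mul_eq_mul_div, ← add_div, norm_div, hNn]
  exact div_le_self (norm_nonneg _) (by linarith)
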